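/- Suppose that for all sufficiently large T, every nontrivial zero ρ = β + iγ of the Riemann zeta function with T < γ ≤ 2T satisfies |β − 1/2| < 0.001/(2 log T). Then, as T → ∞, the number of nontrivial zeros ρ = β + iγ of ζ with T < γ ≤ 2T that are simple and satisfy β = 1/2 is at least (0.34500129 + o(1)) · (T/(2π)) log T. -/

import Mathlib

open Filter Topology MeasureTheory Set

/-- The multiplicity of `ρ` as a zero of the Riemann zeta function:
the least `n` such that the `n`-th iterated derivative of `ζ` is nonzero at `ρ`. -/
noncomputable def zetaMult (ρ : ℂ) : ℕ :=
  sInf {n : ℕ | iteratedDeriv n riemannZeta ρ ≠ 0}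

/-- `ρ` is a nontrivial zero of the Riemann zeta function. -/
def IsNontrivialZero (ρ : ℂ) : Prop :=
  riemannZeta ρ = 0 ∧ 0 < ρ.re ∧ ρ.re < 1

/-- The set of nontrivial zeros `ρ = β + iγ` with `T < γ ≤ 2T`. -/
def zeroBand (T : ℝ) : Set ℂ :=
  {ρ | IsNontrivialZero ρ ∧ T < ρ.im ∧ ρ.im ≤ 2 * T}

/-- Number of nontrivial zeros with `T < γ ≤ 2T`, counted with multiplicity. -/
noncomputable def Ntot (T : ℝ) : ℝ :=
  ∑ᶠ ρ ∈ zeroBand T, (zetaMult ρ : ℝ)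

/-- Number of simple nontrivial zeros with `T < γ ≤ 2T`. -/
noncomputable def Nsimple (T : ℝ) : ℝ :=
  ∑ᶠ ρ ∈ {ρ ∈ zeroBand T | zetaMult ρ = 1}, (1 : ℝ)

/-- Number of nontrivial zeros with `T < γ ≤ 2T` on the critical line, with multiplicity. -/
noncomputable def Nline (T : ℝ) : ℝ :=
  ∑ᶠ ρ ∈ {ρ ∈ zeroBand T | ρ.re = 1/2}, (zetaMult ρ : ℝ)

/-- Number of simple critical-line nontrivial zeros with `T < γ ≤ 2T`. -/
noncomputable def NlineSimple (T : ℝ) : ℝ :=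
  ∑ᶠ ρ ∈ {ρ ∈ zeroBand T | ρ.re = 1/2 ∧ zetaMult ρ = 1}, (1 : ℝ)

local notation "rexp" => Real.exp
local notation "rlog" => Real.log
local notation "cI" => Complex.I
local notation "cexp" => Complex.exp
local notation "rpi" => Real.pi
local notation "rsq" => Real.sqrt
local notation "cGR" => Complex.Gammaℝ
local notation "cJ" => (starRingEnd ℂ)
open Complex in
noncomputable def xi (s : ℂ) : ℂ := s * (s - 1) * completedRiemannZeta₀ s + 1

lemma xi_diff : Differentiable ℂ xi := by
  unfold xi
  exact ((differentiable_id.mul (differentiable_id.sub_const 1)).mul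
    differentiable_completedZeta₀).add_const 1

lemma xi_symm (s : ℂ) : xi (1 - s) = xi s := by
  unfold xi
  rw [completedRiemannZeta₀_one_sub]; ring

lemma xi_eq {s : ℂ} (h0 : s ≠ 0) (h1 : s ≠ 1) : xi s = s * (s - 1) * completedRiemannZeta s := by
  unfold xi
  rw [completedRiemannZeta_eq]
  have : 1 - s ≠ 0 := sub_ne_zero.mpr h1.symm
  field_simp
  ring

lemma xi_eq' {s : ℂ} (h0 : 0 < s.re) (h1 : s ≠ 1) :
    xi s = s * (s - 1) * (cGR s * riemannZeta s) := by
  have h : s ≠ 0 := by rintro rfl; simp at h0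
  rw [xi_eq h h1, riemannZeta_def_of_ne_zero h, mul_div_cancel₀]
  exact Complex.Gammaℝ_ne_zero_of_re_pos h0

lemma xi_zero_iff_right {s : ℂ} (h0 : 0 < s.re) : xi s = 0 ↔ IsNontrivialZero s := by
  by_cases h1 : s = 1
  · subst h1
    simp [xi, IsNontrivialZero]
  rw [xi_eq' h0 h1]
  have h : s ≠ 0 := by rintro rfl; simp at h0
  simp only [mul_eq_zero, h, sub_eq_zero, h1, false_or, Complex.Gammaℝ_ne_zero_of_re_pos h0]
  refine ⟨fun hz => ⟨hz, h0, ?_⟩, fun hz => hz.1⟩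
  by_contra hc
  exact riemannZeta_ne_zero_of_one_le_re (not_lt.mp hc) hz

lemma xi_zero_iff {s : ℂ} : xi s = 0 ↔ IsNontrivialZero s := by
  by_cases h0 : 0 < s.re
  · exact xi_zero_iff_right h0
  · have h1 : 0 < (1 - s).re := by simp; linarith
    refine ⟨fun h => ?_, fun h => absurd h.2.1 h0⟩
    rw [← xi_symm, xi_zero_iff_right h1] at h
    have := h.2.2
    simp at this; linarith

lemma zero_symm {s : ℂ} (h : IsNontrivialZero s) : IsNontrivialZero (1 - cJ s) := by
  have h2 : IsNontrivialZero (cJ s) := by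
    refine ⟨?_, by simpa using h.2.1, by simpa using h.2.2⟩
    rw [riemannZeta_conj, h.1]; simp
  rw [← xi_zero_iff, xi_symm, xi_zero_iff]; exact h2

lemma zeta0_bound (a b : ℝ) : ∃ C, 0 ≤ C ∧ ∀ s : ℂ, a ≤ s.re → s.re ≤ b →
    ‖completedRiemannZeta₀ s‖ ≤ C := by
  set P := HurwitzZeta.hurwitzEvenFEPair 0
  have hm : ∀ s : ℂ, MellinConvergent P.f_modif s := fun s =>
    (P.isStrongFEPair_toStrongFEPair.hasMellin s).1
  have hint : ∀ r : ℝ, IntegrableOn (fun t : ℝ => t ^ (r - 1) * ‖P.f_modif t‖) (Ioi 0) := by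
    intro r
    have h0 : IntegrableOn (fun t : ℝ => ‖(t : ℂ) ^ ((r : ℂ) - 1) • P.f_modif t‖) (Ioi 0) := (hm r).norm
    refine h0.congr_fun ?_ measurableSet_Ioi
    intro t ht
    simp only [norm_smul]
    rw [Complex.norm_cpow_eq_rpow_re_of_pos ht]; simp
  refine ⟨(∫ t in Ioi 0, (t ^ (a / 2 - 1) * ‖P.f_modif t‖ + t ^ (b / 2 - 1) * ‖P.f_modif t‖)) / 2,
    ?_, ?_⟩
  · apply div_nonneg _ (by norm_num)
    refine setIntegral_nonneg measurableSet_Ioi ?_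
    intro t ht
    have : (0:ℝ) < t := ht
    positivity
  intro s ha hb
  have : completedRiemannZeta₀ s = P.Λ₀ (s / 2) / 2 := rfl
  rw [this, norm_div, Complex.norm_ofNat]
  gcongr
  unfold WeakFEPair.Λ₀ mellin
  refine (norm_integral_le_integral_norm _).trans ?_
  refine setIntegral_mono_on (hm _).norm ((hint _).add (hint _)) measurableSet_Ioi ?_
  intro t ht
  have ht : (0:ℝ) < t := ht
  rw [norm_smul, Complex.norm_cpow_eq_rpow_re_of_pos ht, ← add_mul]
  gcongr
  have e : (s / 2 - 1).re = s.re / 2 - 1 := by simp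
  rw [e]
  rcases le_total 1 t with h | h
  · have : t ^ (s.re / 2 - 1) ≤ t ^ (b / 2 - 1) := Real.rpow_le_rpow_of_exponent_le h (by linarith)
    have : 0 < t ^ (a / 2 - 1) := by positivity
    linarith
  · have : t ^ (s.re / 2 - 1) ≤ t ^ (a / 2 - 1) :=
      Real.rpow_le_rpow_of_exponent_ge ht h (by linarith)
    have : 0 < t ^ (b / 2 - 1) := by positivity
    linarith

lemma xi_bound (a b : ℝ) : ∃ C, 1 ≤ C ∧ ∀ s : ℂ, a ≤ s.re → s.re ≤ b →
    ‖xi s‖ ≤ C * (1 + ‖s‖) ^ 2 := by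
  obtain ⟨C, hC0, hC⟩ := zeta0_bound a b
  refine ⟨C + 1, by linarith, fun s h1 h2 => ?_⟩
  unfold xi
  have h3 := hC s h1 h2
  have h4 : ‖s - 1‖ ≤ 1 + ‖s‖ := by
    have := norm_sub_le s 1; simp at this; linarith
  have := norm_nonneg s
  calc ‖s * (s - 1) * completedRiemannZeta₀ s + 1‖ ≤ ‖s‖ * ‖s - 1‖ * ‖completedRiemannZeta₀ s‖ + 1 := by
        refine (norm_add_le _ _).trans ?_
        simp
    _ ≤ (1 + ‖s‖) * (1 + ‖s‖) * C + 1 := by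
        gcongr; linarith
    _ ≤ _ := by nlinarith

/-- lower bound at `2 + iR` -/
lemma gamma_lower (y : ℝ) : rexp (-(rpi * |y|)) ≤ ‖Complex.Gamma (1 + y * cI)‖ := by
  by_cases hy : y = 0
  · subst hy; simp
  have hz : (y * cI : ℂ) ≠ 0 := by simp [hy]
  have h1 := Complex.Gamma_mul_Gamma_one_sub (y * cI)
  have h2 : Complex.Gamma (1 + y * cI) = y * cI * Complex.Gamma (y * cI) := by
    rw [add_comm, Complex.Gamma_add_one _ hz]
  have h3 : ‖Complex.Gamma (1 - y * cI)‖ ≤ 1 := by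
    rw [Complex.Gamma_eq_integral (by simp), Complex.GammaIntegral]
    refine (norm_integral_le_integral_norm _).trans ?_
    have : ∫ t in Ioi (0:ℝ), rexp (-t) = 1 := integral_exp_neg_Ioi_zero
    rw [← this]
    refine le_of_eq (setIntegral_congr_fun measurableSet_Ioi ?_)
    intro t ht
    simp only [norm_mul]
    rw [Complex.norm_cpow_eq_rpow_re_of_pos ht]
    simp [Complex.norm_exp]
  have h4 : Complex.Gamma (1 + y * cI) * Complex.Gamma (1 - y * cI) =
      y * cI * (rpi / Complex.sin (rpi * (y * cI))) := by
    rw [h2, ← h1]; ring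
  have h5 : Complex.sin (rpi * (y * cI)) = (Real.sinh (rpi * y) : ℝ) * cI := by
    rw [← mul_assoc, Complex.sin_mul_I]; push_cast; rfl
  have h6 : ‖y * cI * (rpi / Complex.sin (rpi * (y * cI)))‖ =
      rpi * |y| / |Real.sinh (rpi * y)| := by
    rw [h5]
    simp only [norm_mul, norm_div, Complex.norm_I, Complex.norm_real, Real.norm_eq_abs,
      abs_of_pos Real.pi_pos, mul_one]
    ring
  have hpos : 0 < rpi * |y| := mul_pos Real.pi_pos (abs_pos.mpr hy)
  have h7 : |Real.sinh (rpi * y)| = Real.sinh (rpi * |y|) := by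
    rw [Real.abs_sinh, abs_mul, abs_of_pos Real.pi_pos]
  have h8 : Real.sinh (rpi * |y|) ≤ rpi * |y| * rexp (rpi * |y|) := by
    set u := rpi * |y|
    rw [Real.sinh_eq]
    have e1 : rexp (-u) = (rexp u)⁻¹ := Real.exp_neg u
    have e2 : 1 ≤ rexp u := Real.one_le_exp hpos.le
    have e3 : 1 - 2 * u ≤ rexp (-(2*u)) := by
      have := Real.add_one_le_exp (-(2*u)); linarith
    have e4 : rexp (-(2*u)) * rexp u = rexp (-u) := by
      rw [← Real.exp_add]; ring_nf
    nlinarith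
  have h9 : 0 < Real.sinh (rpi * |y|) := Real.sinh_pos_iff.mpr hpos
  have h10 : rexp (-(rpi * |y|)) ≤ rpi * |y| / |Real.sinh (rpi * y)| := by
    rw [h7, le_div_iff₀ h9, Real.exp_neg, inv_mul_le_iff₀ (Real.exp_pos _)]
    linarith
  rw [← h6, ← h4, norm_mul] at h10
  refine h10.trans ?_
  exact mul_le_of_le_one_right (norm_nonneg _) h3

lemma zeta_lower (y : ℝ) : 1/4 ≤ ‖riemannZeta (2 + y * cI)‖ := by
  have hre : 1 < (2 + y * cI : ℂ).re := by simp
  have h1 := zeta_eq_tsum_one_div_nat_add_one_cpow hre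
  have hn : ∀ n : ℕ, ‖1 / ((n:ℂ) + 1) ^ (2 + y * cI)‖ = 1 / ((n:ℝ) + 1) ^ 2 := by
    intro n
    rw [norm_div, norm_one]
    have : ((n:ℂ) + 1) = ((n + 1 : ℝ) : ℂ) := by push_cast; rfl
    rw [this, Complex.norm_cpow_eq_rpow_re_of_pos (by positivity)]
    simp
  have hs0 : HasSum (fun n : ℕ => 1 / ((n:ℝ) + 1) ^ 2) (rpi ^ 2 / 6) := by
    have := (hasSum_nat_add_iff' 1).mpr hasSum_zeta_two
    simpa using this
  have hs : Summable (fun n : ℕ => 1 / ((n:ℂ) + 1) ^ (2 + y * cI)) := by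
    apply Summable.of_norm
    simp_rw [hn]; exact hs0.summable
  rw [h1, hs.tsum_eq_zero_add]
  have hb : ‖∑' n : ℕ, 1 / (((n+1:ℕ):ℂ) + 1) ^ (2 + y * cI)‖ ≤ rpi^2/6 - 1 := by
    have h2 := (hasSum_nat_add_iff' 1).mpr hs0
    refine tsum_of_norm_bounded (by simpa using h2) ?_
    intro n
    rw [hn, one_div]
    push_cast
    exact le_rfl
  have h3 : ‖(1 / (((0:ℕ):ℂ) + 1) ^ (2 + y * cI))‖ = 1 := by simp
  have h4 := norm_sub_le_norm_add (1 / (((0:ℕ):ℂ) + 1) ^ (2 + y * cI))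
    (∑' n : ℕ, 1 / (((n+1:ℕ):ℂ) + 1) ^ (2 + y * cI))
  rw [h3] at h4
  have h5 : rpi ^ 2 / 6 ≤ 7/4 := by
    have := Real.pi_lt_d2; have := Real.pi_pos; nlinarith
  linarith

lemma xi_lower (R : ℝ) : (1/16) * rexp (-(rpi * |R|)) ≤ ‖xi (2 + R * cI)‖ := by
  have h1 : (2 + R * cI : ℂ) ≠ 1 := by
    intro h; have := congrArg Complex.re h; simp at this
  rw [xi_eq' (by simp) h1]
  simp only [norm_mul]
  have h2 : 2 ≤ ‖(2 + R * cI : ℂ)‖ := by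
    have := Complex.abs_re_le_norm (2 + R * cI : ℂ); simpa using this
  have h3 : 1 ≤ ‖(2 + R * cI - 1 : ℂ)‖ := by
    have := Complex.abs_re_le_norm (2 + R * cI - 1: ℂ)
    have e : (2 + R * cI - 1: ℂ).re = 1 := by simp; norm_num
    rw [e] at this; simpa using this
  have h4 := zeta_lower R
  have h5 : (1/4) * rexp (-(rpi * |R|)) ≤ ‖cGR (2 + R * cI)‖ := by
    rw [Complex.Gammaℝ_def, norm_mul]
    have e1 : (2 + R * cI : ℂ) / 2 = 1 + (R/2 : ℝ) * cI := by push_cast; ring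
    have e2 := gamma_lower (R/2)
    rw [← e1] at e2
    have e3 : 1/4 ≤ ‖(rpi : ℂ) ^ (-(2 + R * cI : ℂ) / 2)‖ := by
      rw [Complex.norm_cpow_eq_rpow_re_of_pos Real.pi_pos]
      have : (-(2 + R * cI : ℂ) / 2).re = -1 := by simp
      rw [this, Real.rpow_neg_one]
      rw [one_div]
      exact inv_anti₀ Real.pi_pos Real.pi_le_four
    have e4 : rexp (-(rpi * |R|)) ≤ rexp (-(rpi * |R/2|)) := by
      apply Real.exp_le_exp.mpr
      rw [abs_div, abs_two]
      have := mul_nonneg Real.pi_pos.le (abs_nonneg R)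
      linarith [mul_div_assoc rpi (|R|) 2]
    calc _ ≤ (1/4) * ‖Complex.Gamma ((2 + R * cI : ℂ) / 2)‖ := by gcongr; linarith
      _ ≤ _ := by gcongr
  have hp := Real.exp_pos (-(rpi * |R|))
  calc (1/16) * rexp (-(rpi * |R|)) ≤ (2 * 1) * (((1/4) * rexp (-(rpi * |R|))) * (1/4)) := by linarith
    _ ≤ _ := by gcongr

lemma ord_ne_top {f : ℂ → ℂ} (hf : Differentiable ℂ f) {z0 : ℂ} (h0 : f z0 ≠ 0) (ρ : ℂ) :
    analyticOrderAt f ρ ≠ ⊤ := by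
  intro h
  rw [analyticOrderAt_eq_top] at h
  have h1 : AnalyticOnNhd ℂ f Set.univ := fun z _ => hf.analyticAt z
  have := h1.eqOn_zero_of_preconnected_of_eventuallyEq_zero isPreconnected_univ (mem_univ ρ) h
  exact h0 (this (mem_univ z0))

lemma factor_one {f : ℂ → ℂ} (hf : Differentiable ℂ f) {z0 : ℂ} (h0 : f z0 ≠ 0) (ρ : ℂ) :
    ∃ g : ℂ → ℂ, Differentiable ℂ g ∧ g ρ ≠ 0 ∧
      ∀ z, f z = (z - ρ) ^ (analyticOrderNatAt f ρ) * g z := by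
  classical
  have hne := ord_ne_top hf h0 ρ
  obtain ⟨g0, hg0, hg1, hg2⟩ := ((hf.analyticAt ρ).analyticOrderAt_ne_top).mp hne
  set m := analyticOrderNatAt f ρ
  have hgr : ∀ᶠ z in 𝓝 ρ, (if z = ρ then g0 ρ else f z / (z - ρ) ^ m) = g0 z := by
    filter_upwards [hg2] with z hz
    split_ifs with h
    · rw [h]
    · have : (z - ρ) ^ m ≠ 0 := pow_ne_zero _ (sub_ne_zero.mpr h)
      rw [hz, smul_eq_mul]; field_simp
  refine ⟨fun z => if z = ρ then g0 ρ else f z / (z - ρ) ^ m, ?_, ?_, ?_⟩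
  · intro z
    by_cases hz : z = ρ
    · subst hz
      exact hg0.differentiableAt.congr_of_eventuallyEq hgr
    · have : DifferentiableAt ℂ (fun z => f z / (z - ρ) ^ m) z :=
        (hf z).div (((differentiableAt_id).sub_const ρ).pow m)
          (pow_ne_zero _ (sub_ne_zero.mpr hz))
      refine this.congr_of_eventuallyEq ?_
      filter_upwards [isOpen_ne.mem_nhds hz] with w hw
      simp [show w ≠ ρ from hw]
  · simpa using hg1
  · intro z
    by_cases hz : z = ρ
    · subst hz
      have := hg2.self_of_nhds
      simpa using this
    · simp only [hz, if_false]
      have : (z - ρ) ^ m ≠ 0 := pow_ne_zero _ (sub_ne_zero.mpr hz)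
      field_simp

lemma factor_fin {f : ℂ → ℂ} (hf : Differentiable ℂ f) {z0 : ℂ} (h0 : f z0 ≠ 0) (Z : Finset ℂ) :
    ∃ g : ℂ → ℂ, Differentiable ℂ g ∧ (∀ ρ ∈ Z, g ρ ≠ 0) ∧
      ∀ z, f z = (∏ ρ ∈ Z, (z - ρ) ^ (analyticOrderNatAt f ρ)) * g z := by
  classical
  induction Z using Finset.induction_on with
  | empty => exact ⟨f, hf, by simp, by simp⟩
  | insert ρ Z hρ ih =>
    obtain ⟨g, hg, hgz, hfg⟩ := ih
    have hg0 : g z0 ≠ 0 := by intro h; apply h0; rw [hfg, h, mul_zero]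
    obtain ⟨k, hk, hkρ, hgk⟩ := factor_one hg hg0 ρ
    have hP : AnalyticAt ℂ (fun z => ∏ ρ ∈ Z, (z - ρ) ^ (analyticOrderNatAt f ρ)) ρ := by
      apply Differentiable.analyticAt
      fun_prop
    have hord : analyticOrderNatAt f ρ = analyticOrderNatAt g ρ := by
      unfold analyticOrderNatAt
      congr 1
      have : f = (fun z => ∏ ρ ∈ Z, (z - ρ) ^ (analyticOrderNatAt f ρ)) * g := by
        funext z; exact hfg z
      conv_lhs => rw [this]
      rw [analyticOrderAt_mul hP (hg.analyticAt ρ)]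
      rw [hP.analyticOrderAt_eq_zero.mpr, zero_add]
      rw [Finset.prod_ne_zero_iff]
      intro a ha
      apply pow_ne_zero
      rw [sub_ne_zero]; rintro rfl; exact hρ ha
    refine ⟨k, hk, ?_, ?_⟩
    · intro a ha
      rcases Finset.mem_insert.mp ha with rfl | ha
      · exact hkρ
      · intro h; apply hgz a ha; rw [hgk, h, mul_zero]
    · intro z
      rw [Finset.prod_insert hρ, hfg, hgk z, hord]; ring

lemma zero_count {f : ℂ → ℂ} (hf : Differentiable ℂ f) {z0 : ℂ} (h0 : f z0 ≠ 0) {r M : ℝ}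
    (hr : 0 < r) (hM : ∀ z, ‖z - z0‖ ≤ 3 * r → ‖f z‖ ≤ M * ‖f z0‖) (Z : Finset ℂ)
    (hZ : ∀ ρ ∈ Z, ‖ρ - z0‖ ≤ r) :
    ∃ g : ℂ → ℂ, Differentiable ℂ g ∧ (∀ ρ ∈ Z, g ρ ≠ 0) ∧
      (∀ z, f z = (∏ ρ ∈ Z, (z - ρ) ^ (analyticOrderNatAt f ρ)) * g z) ∧
      (∀ z, ‖z - z0‖ ≤ 3 * r → ‖g z‖ ≤ M * ‖g z0‖) ∧
      (2:ℝ) ^ (∑ ρ ∈ Z, analyticOrderNatAt f ρ) ≤ M := by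
  obtain ⟨g, hg, hgz, hfg⟩ := factor_fin hf h0 Z
  have hg0 : g z0 ≠ 0 := by intro h; apply h0; rw [hfg, h, mul_zero]
  set n := ∑ ρ ∈ Z, analyticOrderNatAt f ρ with hn
  have hlow : ‖f z0‖ ≤ r ^ n * ‖g z0‖ := by
    rw [hfg z0, norm_mul, norm_prod, hn, ← Finset.prod_pow_eq_pow_sum]
    gcongr with ρ hρ
    rw [norm_pow]
    gcongr
    rw [norm_sub_rev]; exact hZ ρ hρ
  have hM0 : 0 ≤ M := by
    have := hM z0 (by simp; positivity)
    have h2 : 0 < ‖f z0‖ := norm_pos_iff.mpr h0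
    by_contra h
    nlinarith
  have hsph : ∀ z ∈ frontier (Metric.ball z0 (3 * r)), ‖g z‖ ≤ (M / 2 ^ n) * ‖g z0‖ := by
    intro z hz
    rw [frontier_ball z0 (by positivity)] at hz
    have hz' : ‖z - z0‖ = 3 * r := by simpa [dist_eq_norm] using hz
    have h1 : (2 * r) ^ n * ‖g z‖ ≤ ‖f z‖ := by
      rw [hfg z, norm_mul, norm_prod, hn, ← Finset.prod_pow_eq_pow_sum]
      gcongr with ρ hρ
      rw [norm_pow]
      gcongr
      have := norm_sub_norm_le (z - z0) (ρ - z0)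
      have h3 := hZ ρ hρ
      rw [sub_sub_sub_cancel_right] at this
      linarith
    have h2 := hM z hz'.le
    have h3 : (2 * r) ^ n * ‖g z‖ ≤ M * (r ^ n * ‖g z0‖) := 
      h1.trans (h2.trans (by gcongr))
    rw [mul_pow] at h3
    have h4 : 0 < r ^ n := by positivity
    have h5 : (2:ℝ) ^ n * ‖g z‖ ≤ M * ‖g z0‖ := by
      have : r ^ n * (2 ^ n * ‖g z‖) ≤ r ^ n * (M * ‖g z0‖) := by linarith
      exact le_of_mul_le_mul_left this h4
    rw [div_mul_eq_mul_div, le_div_iff₀ (by positivity)]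
    linarith
  have hin : ∀ z, ‖z - z0‖ ≤ 3 * r → ‖g z‖ ≤ (M / 2 ^ n) * ‖g z0‖ := by
    intro z hz
    refine Complex.norm_le_of_forall_mem_frontier_norm_le Metric.isBounded_ball
      hg.diffContOnCl hsph ?_
    rw [closure_ball z0 (by positivity)]
    simpa [dist_eq_norm] using hz
  refine ⟨g, hg, hgz, hfg, ?_, ?_⟩
  · intro z hz
    refine (hin z hz).trans ?_
    gcongr
    exact div_le_self hM0 (one_le_pow₀ (by norm_num))
  · have h1 := hin z0 (by simp; positivity)
    have h2 : 0 < ‖g z0‖ := norm_pos_iff.mpr hg0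
    have h3 : 1 ≤ M / 2 ^ n := by
      by_contra h; push Not at h; nlinarith
    rwa [le_div_iff₀ (by positivity), one_mul] at h3

lemma logderiv_bound {g : ℂ → ℂ} (hg : Differentiable ℂ g) {z0 : ℂ} {r M : ℝ} (hr : 0 < r)
    (hM1 : 1 < M) (hnz : ∀ z, ‖z - z0‖ < r → g z ≠ 0)
    (hM : ∀ z, ‖z - z0‖ < r → ‖g z‖ ≤ M * ‖g z0‖) :
    ∀ z, ‖z - z0‖ ≤ r / 2 → ‖deriv g z / g z‖ ≤ 24 * rlog M / r := by
  have hg' : Differentiable ℂ (deriv g) := fun z =>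
    (hg.analyticAt z).deriv.differentiableAt
  have hd : DifferentiableOn ℂ (fun z => deriv g z / g z) (Metric.ball z0 r) := by
    intro z hz
    refine ((hg' z).div (hg z) (hnz z ?_)).differentiableWithinAt
    simpa [dist_eq_norm] using hz
  obtain ⟨F, hF0, hF⟩ := hd.isExactOn_ball.with_val_at z0 0
  have hz0 : z0 ∈ Metric.ball z0 r := Metric.mem_ball_self hr
  have hFd : DifferentiableOn ℂ F (Metric.ball z0 r) := fun z hz =>
    (hF z hz).differentiableAt.differentiableWithinAt
  have hexp : ∀ z ∈ Metric.ball z0 r, g z * cexp (-F z) = g z0 := by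
    have hder : ∀ z ∈ Metric.ball z0 r, HasDerivAt (fun z => g z * cexp (-F z)) 0 z := by
      intro z hz
      have h1 := (hg z).hasDerivAt.mul (hF z hz).neg.cexp
      have hne := hnz z (by simpa [dist_eq_norm] using hz)
      refine h1.congr_deriv ?_
      have e : g z * (deriv g z / g z) = deriv g z := by field_simp
      linear_combination (-cexp (-F z)) * e
    have hdo : DifferentiableOn ℂ (fun z => g z * cexp (-F z)) (Metric.ball z0 r) :=
      fun z hz => (hder z hz).differentiableAt.differentiableWithinAt
    intro z hz
    have := Metric.isOpen_ball.is_const_of_deriv_eq_zero (Metric.isConnected_ball hr).isPreconnected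
      hdo (fun z hz => (hder z hz).deriv) hz hz0
    simpa [hF0] using this
  have hA : 0 < rlog M := Real.log_pos hM1
  have hre : ∀ z ∈ Metric.ball z0 r, (F z).re ≤ rlog M := by
    intro z hz
    have hz' : ‖z - z0‖ < r := by simpa [dist_eq_norm] using hz
    have h1 : g z = g z0 * cexp (F z) := by
      rw [← hexp z hz, mul_assoc, ← Complex.exp_add]; simp
    have h2 := hM z hz'
    rw [h1, norm_mul, Complex.norm_exp] at h2
    have h3 : 0 < ‖g z0‖ := norm_pos_iff.mpr (hnz z0 (by simpa using hr))
    rw [Real.le_log_iff_exp_le (by linarith)]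
    have : ‖g z0‖ * rexp (F z).re ≤ ‖g z0‖ * M := by linarith
    exact le_of_mul_le_mul_left this h3
  have hBC : ∀ z, ‖z - z0‖ ≤ 2 * r / 3 → ‖F z‖ ≤ 4 * rlog M := by
    intro z hz
    have hmap : MapsTo (fun w => z0 + w) (Metric.ball 0 r) (Metric.ball z0 r) := by
      intro w hw; simpa [dist_eq_norm] using hw
    have hFc : DifferentiableOn ℂ (fun w => F (z0 + w)) (Metric.ball 0 r) :=
      hFd.comp (by fun_prop) hmap
    have := Complex.borelCaratheodory_zero (f := fun w => F (z0 + w)) (M := rlog M) (R := r)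
      (z := z - z0) hA hFc (fun w hw => hre _ (hmap hw)) hr (by simp; linarith)
      (by simpa using hF0)
    simp only [add_sub_cancel] at this
    refine this.trans ?_
    rw [div_le_iff₀ (by linarith)]
    nlinarith
  intro z hz
  have hzb : z ∈ Metric.ball z0 r := by
    simp [dist_eq_norm]; linarith
  rw [← (hF z hzb).deriv]
  have : ‖deriv F z‖ ≤ 4 * rlog M / (r / 6) := by
    refine Complex.norm_deriv_le_of_forall_mem_sphere_norm_le (by positivity) ?_ ?_
    · apply DifferentiableOn.diffContOnCl
      refine hFd.mono ?_
      rw [closure_ball z (by positivity)]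
      intro w hw
      have hw : ‖w - z‖ ≤ r / 6 := by simpa [dist_eq_norm] using hw
      have := norm_sub_le_norm_sub_add_norm_sub w z z0
      simp [dist_eq_norm]; linarith
    · intro w hw
      have hw : ‖w - z‖ = r / 6 := by simpa [dist_eq_norm] using hw
      have := norm_sub_le_norm_sub_add_norm_sub w z z0
      apply hBC; linarith
  refine this.trans (le_of_eq ?_)
  field_simp
  norm_num

/-- multiplicity -/
noncomputable def mu (ρ : ℂ) : ℕ := analyticOrderNatAt xi ρ

lemma xi_ne : xi 2 ≠ 0 := by
  intro h
  have := (xi_zero_iff.mp h).2.2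
  norm_num at this

lemma mu_pos_iff {ρ : ℂ} : 0 < mu ρ ↔ IsNontrivialZero ρ := by
  rw [← xi_zero_iff, ← (xi_diff.analyticAt ρ).analyticOrderAt_ne_zero]
  unfold mu analyticOrderNatAt
  have := ord_ne_top xi_diff xi_ne ρ
  rw [pos_iff_ne_zero, not_iff_not, ENat.toNat_eq_zero]
  tauto

lemma mu_eq_zero {ρ : ℂ} (h : ¬ IsNontrivialZero ρ) : mu ρ = 0 := by
  by_contra hc
  exact h (mu_pos_iff.mp (Nat.pos_of_ne_zero hc))

lemma xi_growth : ∃ C : ℝ, 1 ≤ C ∧ ∀ k : ℝ, ∃ M : ℝ, 1 < M ∧ rlog M ≤ C * (1 + |k|) ∧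
    ∀ z, ‖z - (2 + k * cI)‖ ≤ 18 → ‖xi z‖ ≤ M * ‖xi (2 + k * cI)‖ := by
  obtain ⟨C, hC1, hC⟩ := xi_bound (-16) 20
  refine ⟨16 * C + 60, by linarith, fun k => ?_⟩
  have hk := abs_nonneg k
  refine ⟨16 * C * (21 + |k|) ^ 2 * rexp (rpi * |k|), ?_, ?_, ?_⟩
  · have : 1 ≤ rexp (rpi * |k|) := Real.one_le_exp (by positivity)
    have h2 : (1:ℝ) < 16 * C * (21 + |k|) ^ 2 := by nlinarith
    nlinarith
  · rw [Real.log_mul (by positivity) (by positivity), Real.log_exp, Real.log_mul (by positivity) (by positivity), Real.log_pow]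
    have h1 := Real.log_le_sub_one_of_pos (show 0 < 16 * C by linarith)
    have h2 := Real.log_le_sub_one_of_pos (show 0 < 21 + |k| by linarith)
    have h3 := Real.pi_le_four
    push_cast
    nlinarith
  · intro z hz
    have h1 : |(z - (2 + k * cI)).re| ≤ 18 := (Complex.abs_re_le_norm _).trans hz
    simp at h1
    rw [abs_le] at h1
    have h2 : ‖z‖ ≤ 20 + |k| := by
      have a1 := norm_le_norm_sub_add z (2 + k * cI)
      have a2 : ‖(2 + k * cI : ℂ)‖ ≤ 2 + |k| := by
        refine (norm_add_le _ _).trans ?_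
        simp
      linarith
    have h3 := hC z (by linarith) (by linarith)
    have h4 := xi_lower k
    have h5 : 1 = rexp (rpi * |k|) * rexp (-(rpi * |k|)) := by
      rw [← Real.exp_add]; simp
    calc ‖xi z‖ ≤ C * (1 + ‖z‖) ^ 2 := h3
      _ ≤ C * (21 + |k|) ^ 2 := by
          have : 1 + ‖z‖ ≤ 21 + |k| := by linarith
          gcongr
      _ = 16 * C * (21 + |k|) ^ 2 * rexp (rpi * |k|) * ((1/16) * rexp (-(rpi * |k|))) := by
          linear_combination (C * (21 + |k|) ^ 2) * h5
      _ ≤ _ := by gcongr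

lemma xi_ne_two (k : ℝ) : xi (2 + k * cI) ≠ 0 := by
  intro h
  have := (xi_zero_iff.mp h).2.2
  norm_num at this

/-- crude local count -/
lemma crude_count : ∃ C : ℝ, 1 ≤ C ∧ ∀ (k : ℝ) (Z : Finset ℂ),
    (∀ ρ ∈ Z, ‖ρ - (2 + k * cI)‖ ≤ 6) → ((∑ ρ ∈ Z, mu ρ : ℕ) : ℝ) ≤ C * (1 + |k|) := by
  obtain ⟨C, hC1, hC⟩ := xi_growth
  refine ⟨2 * C, by linarith, fun k Z hZ => ?_⟩
  obtain ⟨M, hM1, hM2, hM3⟩ := hC k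
  obtain ⟨g, -, -, -, -, h⟩ := zero_count xi_diff (xi_ne_two k) (r := 6) (by norm_num)
    (fun z hz => hM3 z (by linarith)) Z hZ
  have h2 := Real.log_le_log (by positivity) h
  rw [Real.log_pow] at h2
  have h3 := Real.log_two_gt_d9
  have h4 : (0:ℝ) ≤ ((∑ ρ ∈ Z, mu ρ : ℕ) : ℝ) := by positivity
  unfold mu at *
  nlinarith

lemma avoid (N : ℕ) (Y : Finset ℝ) (hY : Y.card ≤ N) (k : ℝ) :
    ∃ x ∈ Icc k (k + 1), ∀ y ∈ Y, 1 / (2 * ((N:ℝ) + 1)) ≤ |x - y| := by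
  by_contra hc
  push Not at hc
  have hsub : Icc k (k+1) ⊆ ⋃ y ∈ Y, Ioo (y - 1 / (2 * ((N:ℝ) + 1))) (y + 1 / (2 * ((N:ℝ) + 1))) := by
    intro x hx
    obtain ⟨y, hy, h⟩ := hc x hx
    rw [abs_lt] at h
    simp only [mem_iUnion]
    exact ⟨y, hy, by constructor <;> linarith⟩
  have h1 := (measure_mono hsub).trans (measure_biUnion_finset_le (μ := volume) Y _)
  simp only [Real.volume_Icc, Real.volume_Ioo] at h1
  have e1 : ∀ y:ℝ, y + 1 / (2 * ((N:ℝ) + 1)) - (y - 1 / (2 * ((N:ℝ) + 1))) = 1 / ((N:ℝ)+1) := by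
    intro y; field_simp; ring
  simp only [e1, add_sub_cancel_left, Finset.sum_const, nsmul_eq_mul] at h1
  rw [← ENNReal.ofReal_natCast, ← ENNReal.ofReal_mul (by positivity), ENNReal.ofReal_le_ofReal_iff (by positivity)] at h1
  have h2 : (Y.card : ℝ) ≤ N := by exact_mod_cast hY
  rw [mul_one_div, le_div_iff₀ (by positivity)] at h1
  linarith

lemma zeros_finite (z0 : ℂ) (r : ℝ) : {ρ | xi ρ = 0 ∧ ‖ρ - z0‖ ≤ r}.Finite := by
  have hA : AnalyticOnNhd ℂ xi univ := fun z _ => xi_diff.analyticAt z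
  by_contra hinf
  have hinf : Set.Infinite {ρ | xi ρ = 0 ∧ ‖ρ - z0‖ ≤ r} := hinf
  have hK : IsCompact (Metric.closedBall z0 r) := isCompact_closedBall z0 r
  obtain ⟨x, hx, hacc⟩ := hinf.exists_accPt_of_subset_isCompact hK (by
    intro z hz; simpa [dist_eq_norm] using hz.2)
  have hfr : ∃ᶠ z in 𝓝[≠] x, xi z = 0 := by
    rw [accPt_iff_frequently_nhdsNE] at hacc
    exact hacc.mono fun z hz => hz.1
  exact xi_ne (hA.eqOn_zero_of_preconnected_of_frequently_eq_zero isPreconnected_univ (mem_univ x) hfr (mem_univ 2))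

/-- good heights -/
lemma good_height : ∃ C : ℝ, 1 ≤ C ∧ ∀ k : ℝ, ∃ R ∈ Icc k (k+1), ∀ σ ∈ Icc (-1/2:ℝ) (3/2),
    xi (σ + R * cI) ≠ 0 ∧ ‖logDeriv xi (σ + R * cI)‖ ≤ C * (1 + |k|) ^ 2 := by
  obtain ⟨C, hC1, hC⟩ := xi_growth
  refine ⟨20 * C ^ 2, by nlinarith, fun k => ?_⟩
  obtain ⟨M, hM1, hM2, hM3⟩ := hC k
  set Z := (zeros_finite (2 + k * cI) 6).toFinset with hZdef
  have hZ : ∀ ρ, ρ ∈ Z ↔ (xi ρ = 0 ∧ ‖ρ - (2 + k * cI)‖ ≤ 6) := by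
    intro ρ; simp [hZdef]
  obtain ⟨g, hg, hgz, hfg, hgM, hcount⟩ := zero_count xi_diff (xi_ne_two k) (r := 6) (by norm_num)
    (fun z hz => hM3 z (by linarith)) Z (fun ρ hρ => ((hZ ρ).mp hρ).2)
  set n := ∑ ρ ∈ Z, analyticOrderNatAt xi ρ with hn
  have hlog : (n:ℝ) ≤ 2 * rlog M := by
    have h2 := Real.log_le_log (by positivity) hcount
    rw [Real.log_pow] at h2
    have h3 := Real.log_two_gt_d9
    have : (0:ℝ) ≤ n := by positivity
    nlinarith
  have hcard : Z.card ≤ n := by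
    rw [hn, Finset.card_eq_sum_ones]
    refine Finset.sum_le_sum fun ρ hρ => ?_
    exact mu_pos_iff.mpr (xi_zero_iff.mp ((hZ ρ).mp hρ).1)
  obtain ⟨R, hR, hdist⟩ := avoid n (Z.image Complex.im) (Finset.card_image_le.trans hcard) k
  refine ⟨R, hR, fun σ hσ => ?_⟩
  set z : ℂ := σ + R * cI with hz
  have hzn : ‖z - (2 + k * cI)‖ ≤ 3 + 1/2 := by
    have : z - (2 + k * cI) = ((σ - 2 : ℝ):ℂ) + ((R - k : ℝ):ℂ) * cI := by
      rw [hz]; push_cast; ring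
    rw [this]
    refine (norm_add_le _ _).trans ?_
    rw [norm_mul, Complex.norm_real, Complex.norm_real, Complex.norm_I, Real.norm_eq_abs, Real.norm_eq_abs]
    have a1 : |σ - 2| ≤ 5/2 := by rw [abs_le]; constructor <;> linarith [hσ.1, hσ.2]
    have a2 : |R - k| ≤ 1 := by rw [abs_le]; constructor <;> linarith [hR.1, hR.2]
    linarith
  have hzn3 : ‖z - (2 + k * cI)‖ ≤ 3 := by
    have : z - (2 + k * cI) = ((σ - 2 : ℝ):ℂ) + ((R - k : ℝ):ℂ) * cI := by
      rw [hz]; push_cast; ring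
    rw [this, Complex.norm_add_mul_I]
    rw [Real.sqrt_le_left (by norm_num)]
    have := hσ.1; have := hσ.2; have := hR.1; have := hR.2
    nlinarith
  have hδ : ∀ ρ ∈ Z, 1 / (2 * ((n:ℝ) + 1)) ≤ ‖z - ρ‖ := by
    intro ρ hρ
    refine (hdist ρ.im (Finset.mem_image_of_mem _ hρ)).trans ?_
    have := Complex.abs_im_le_norm (z - ρ)
    simpa [hz] using this
  have hzne : ∀ ρ ∈ Z, z - ρ ≠ 0 := by
    intro ρ hρ h
    have := hδ ρ hρ
    rw [h, norm_zero] at this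
    have h2 : 0 < 1 / (2 * ((n:ℝ) + 1)) := by positivity
    linarith
  have hxz : xi z ≠ 0 := by
    intro h
    have := hzne z ((hZ z).mpr ⟨h, by linarith⟩)
    simp at this
  refine ⟨hxz, ?_⟩
  have hnzg : ∀ w, ‖w - (2 + k * cI)‖ < 6 → g w ≠ 0 := by
    intro w hw h
    have : xi w = 0 := by rw [hfg, h, mul_zero]
    exact hgz w ((hZ w).mpr ⟨this, hw.le⟩) h
  have hgb := logderiv_bound hg (z0 := 2 + k * cI) (r := 6) (M := M) (by norm_num) hM1 hnzg
    (fun w hw => hgM w (by linarith)) z (by linarith)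
  have hld : logDeriv xi z = (∑ ρ ∈ Z, (analyticOrderNatAt xi ρ : ℂ) / (z - ρ)) + deriv g z / g z := by
    have e1 : xi = fun z => (∏ ρ ∈ Z, (z - ρ) ^ (analyticOrderNatAt xi ρ)) * g z := funext hfg
    conv_lhs => rw [e1]
    rw [logDeriv_mul]
    · rw [logDeriv_prod]
      · congr 1
        refine Finset.sum_congr rfl fun ρ hρ => ?_
        rw [logDeriv_fun_pow (by fun_prop)]
        simp [logDeriv_apply]
        ring
      · intro ρ hρ; exact pow_ne_zero _ (hzne ρ hρ)
      · intro ρ hρ; fun_prop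
    · rw [Finset.prod_ne_zero_iff]; intro ρ hρ; exact pow_ne_zero _ (hzne ρ hρ)
    · exact hnzg z (by linarith)
    · fun_prop
    · exact hg z
  rw [hld]
  have hsum : ‖∑ ρ ∈ Z, (analyticOrderNatAt xi ρ : ℂ) / (z - ρ)‖ ≤ n * (2 * ((n:ℝ) + 1)) := by
    refine (norm_sum_le _ _).trans ?_
    rw [hn]; push_cast; rw [Finset.sum_mul]
    refine Finset.sum_le_sum fun ρ hρ => ?_
    rw [norm_div, Complex.norm_natCast, div_eq_mul_inv]
    gcongr
    have h1 := hδ ρ hρ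
    rw [one_div] at h1
    rw [hn] at h1; push_cast at h1
    exact inv_le_of_inv_le₀ (by positivity) h1
  have h24 : 24 * rlog M / 6 = 4 * rlog M := by ring
  rw [h24] at hgb
  refine (norm_add_le _ _).trans ((add_le_add hsum hgb).trans ?_)
  have hA : 1 ≤ C * (1 + |k|) := by nlinarith [abs_nonneg k]
  have hl0 := Real.log_pos hM1
  have hn0 : (0:ℝ) ≤ n := by positivity
  have : (20:ℝ) * C ^ 2 * (1 + |k|) ^ 2 = 20 * (C * (1 + |k|)) ^ 2 := by ring
  rw [this]
  nlinarith

noncomputable def RI (f : ℂ → ℂ) (a b c d : ℝ) : ℂ :=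
  (∫ x in a..b, f (x + c * cI)) - (∫ x in a..b, f (x + d * cI)) +
    cI * (∫ y in c..d, f (b + y * cI)) - cI * (∫ y in c..d, f (a + y * cI))

def Bd (a b c d : ℝ) : Set ℂ :=
  {z | (z.re ∈ Icc a b ∧ z.im ∈ Icc c d) ∧ ¬ (z.re ∈ Ioo a b ∧ z.im ∈ Ioo c d)}

lemma bd_h {a b c d : ℝ} (hcd : c < d) {x : ℝ} (hx : x ∈ Icc a b) {y : ℝ} (hy : y = c ∨ y = d) :
    (x + y * cI : ℂ) ∈ Bd a b c d := by
  refine ⟨⟨by simpa using hx, ?_⟩, ?_⟩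
  · rcases hy with rfl | rfl <;> simp [hcd.le]
  · rcases hy with rfl | rfl <;> simp

lemma bd_v {a b c d : ℝ} (hab : a < b) {y : ℝ} (hy : y ∈ Icc c d) {x : ℝ} (hx : x = a ∨ x = b) :
    (x + y * cI : ℂ) ∈ Bd a b c d := by
  refine ⟨⟨?_, by simpa using hy⟩, ?_⟩
  · rcases hx with rfl | rfl <;> simp [hab.le]
  · rcases hx with rfl | rfl <;> simp

lemma int_h {a b c d : ℝ} (hab : a < b) (hcd : c < d) {f : ℂ → ℂ} (hf : ContinuousOn f (Bd a b c d))
    {y : ℝ} (hy : y = c ∨ y = d) : IntervalIntegrable (fun x : ℝ => f (x + y * cI)) volume a b := by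
  apply ContinuousOn.intervalIntegrable
  rw [uIcc_of_le hab.le]
  exact hf.comp (by fun_prop) (fun x hx => bd_h hcd hx hy)

lemma int_v {a b c d : ℝ} (hab : a < b) (hcd : c < d) {f : ℂ → ℂ} (hf : ContinuousOn f (Bd a b c d))
    {x : ℝ} (hx : x = a ∨ x = b) : IntervalIntegrable (fun y : ℝ => f (x + y * cI)) volume c d := by
  apply ContinuousOn.intervalIntegrable
  rw [uIcc_of_le hcd.le]
  exact hf.comp (by fun_prop) (fun y hy => bd_v hab hy hx)

lemma RI_add {a b c d : ℝ} (hab : a < b) (hcd : c < d) {f g : ℂ → ℂ}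
    (hf : ContinuousOn f (Bd a b c d)) (hg : ContinuousOn g (Bd a b c d)) :
    RI (fun z => f z + g z) a b c d = RI f a b c d + RI g a b c d := by
  unfold RI
  rw [intervalIntegral.integral_add (int_h hab hcd hf (.inl rfl)) (int_h hab hcd hg (.inl rfl)),
    intervalIntegral.integral_add (int_h hab hcd hf (.inr rfl)) (int_h hab hcd hg (.inr rfl)),
    intervalIntegral.integral_add (int_v hab hcd hf (.inl rfl)) (int_v hab hcd hg (.inl rfl)),
    intervalIntegral.integral_add (int_v hab hcd hf (.inr rfl)) (int_v hab hcd hg (.inr rfl))]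
  ring

lemma RI_smul {a b c d : ℝ} (k : ℂ) (f : ℂ → ℂ) :
    RI (fun z => k * f z) a b c d = k * RI f a b c d := by
  unfold RI
  simp only [intervalIntegral.integral_const_mul]
  ring

lemma RI_sum {ι : Type*} {a b c d : ℝ} (hab : a < b) (hcd : c < d) (Z : Finset ι) (f : ι → ℂ → ℂ)
    (hf : ∀ i ∈ Z, ContinuousOn (f i) (Bd a b c d)) :
    RI (fun z => ∑ i ∈ Z, f i z) a b c d = ∑ i ∈ Z, RI (f i) a b c d := by
  classical
  induction Z using Finset.induction_on with
  | empty => simp [RI]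
  | insert i Z hi ih =>
    simp only [Finset.sum_insert hi]
    rw [RI_add hab hcd (hf i (Finset.mem_insert_self _ _))
      (continuousOn_finsetSum _ fun j hj => hf j (Finset.mem_insert_of_mem hj)),
      ih fun j hj => hf j (Finset.mem_insert_of_mem hj)]

lemma RI_congr {a b c d : ℝ} (hab : a < b) (hcd : c < d) {f g : ℂ → ℂ}
    (h : EqOn f g (Bd a b c d)) : RI f a b c d = RI g a b c d := by
  unfold RI
  congr 1
  · congr 1
    · congr 1
      · apply intervalIntegral.integral_congr
        intro x hx; rw [uIcc_of_le hab.le] at hx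
        exact h (bd_h hcd hx (.inl rfl))
      · apply intervalIntegral.integral_congr
        intro x hx; rw [uIcc_of_le hab.le] at hx
        exact h (bd_h hcd hx (.inr rfl))
    · congr 1
      apply intervalIntegral.integral_congr
      intro x hx; rw [uIcc_of_le hcd.le] at hx
      exact h (bd_v hab hx (.inr rfl))
  · congr 1
    apply intervalIntegral.integral_congr
    intro x hx; rw [uIcc_of_le hcd.le] at hx
    exact h (bd_v hab hx (.inl rfl))

lemma RI_zero {a b c d : ℝ} (hab : a < b) (hcd : c < d) {f : ℂ → ℂ}
    (hf : DifferentiableOn ℂ f (Icc a b ×ℂ Icc c d)) : RI f a b c d = 0 := by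
  have := Complex.integral_boundary_rect_eq_zero_of_differentiableOn f (a + c * cI)
    (b + d * cI) (by simpa [uIcc_of_le hab.le, uIcc_of_le hcd.le] using hf)
  simp at this
  unfold RI
  exact this

lemma log_sub_neg_pos {z : ℂ} (h : 0 < z.im) : Complex.log z - Complex.log (-z) = rpi * cI := by
  unfold Complex.log
  rw [Complex.arg_neg_eq_arg_sub_pi_of_im_pos h, norm_neg]
  push_cast; ring

lemma log_sub_neg_neg {z : ℂ} (h : z.im < 0) : Complex.log z - Complex.log (-z) = -(rpi * cI) := by
  unfold Complex.log
  rw [Complex.arg_neg_eq_arg_add_pi_of_im_neg h, norm_neg]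
  push_cast; ring

lemma RI_inv {a b c d : ℝ} {ρ : ℂ} (h1 : a < ρ.re) (h2 : ρ.re < b) (h3 : c < ρ.im) (h4 : ρ.im < d) :
    RI (fun z => (z - ρ)⁻¹) a b c d = 2 * rpi * cI := by
  have hh : ∀ y : ℝ, y ≠ ρ.im → ∫ x in a..b, ((x + y * cI : ℂ) - ρ)⁻¹ =
      Complex.log (b + y * cI - ρ) - Complex.log (a + y * cI - ρ) := by
    intro y hy
    have him : ∀ x : ℝ, ((x + y * cI : ℂ) - ρ).im ≠ 0 := by
      intro x; simpa [sub_eq_zero] using hy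
    refine intervalIntegral.integral_eq_sub_of_hasDerivAt (f := fun x : ℝ => Complex.log (x + y * cI - ρ)) (fun x _ => ?_) ?_
    · have : HasDerivAt (fun x : ℝ => ((x:ℂ) + y * cI - ρ)) 1 x :=
        ((Complex.ofRealCLM.hasDerivAt (x := x)).add_const _).sub_const _
      exact (this.clog_real (Or.inr (him x))).congr_deriv (by rw [one_div])
    · apply ContinuousOn.intervalIntegrable
      refine ContinuousOn.inv₀ (by fun_prop) fun x _ h => him x ?_
      rw [h]; simp
  have hv : ∀ x : ℝ, x ≠ ρ.re → ∀ e : ℂ, (e = 1 ∨ e = -1) → (∀ y : ℝ, e * ((x + y * cI : ℂ) - ρ) ∈ Complex.slitPlane) →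
      cI * ∫ y in c..d, ((x + y * cI : ℂ) - ρ)⁻¹ =
      Complex.log (e * (x + d * cI - ρ)) - Complex.log (e * (x + c * cI - ρ)) := by
    intro x hx e he hs
    have he0 : e ≠ 0 := by rcases he with rfl | rfl <;> simp
    rw [← intervalIntegral.integral_const_mul]
    have hne : ∀ y : ℝ, (x + y * cI : ℂ) - ρ ≠ 0 := by
      intro y h
      have := congrArg Complex.re h
      simp [sub_eq_zero] at this
      exact hx this
    refine intervalIntegral.integral_eq_sub_of_hasDerivAt (f := fun y : ℝ => Complex.log (e * (x + y * cI - ρ))) (fun y _ => ?_) ?_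
    · have : HasDerivAt (fun y : ℝ => e * ((x:ℂ) + y * cI - ρ)) (e * (1 * cI)) y :=
        ((((Complex.ofRealCLM.hasDerivAt (x := y)).mul_const cI).const_add (x:ℂ)).sub_const ρ).const_mul e
      refine (this.clog_real (hs y)).congr_deriv ?_
      have := hne y
      field_simp
    · apply ContinuousOn.intervalIntegrable
      exact ContinuousOn.mul continuousOn_const (ContinuousOn.inv₀ (by fun_prop) fun x _ => hne x)
  unfold RI
  rw [hh c h3.ne, hh d h4.ne', hv b h2.ne' 1 (.inl rfl) ?_, hv a h1.ne (-1) (.inr rfl) ?_]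
  · have e1 := log_sub_neg_pos (z := a + d * cI - ρ) (by simpa using h4)
    have e2 := log_sub_neg_neg (z := a + c * cI - ρ) (by simpa using h3)
    simp only [one_mul, neg_one_mul]
    linear_combination e1 - e2
  · intro y; left; simpa using h1
  · intro y; left; simpa using h2

lemma RI_residue {a b c d : ℝ} (hab : a < b) (hcd : c < d) {H : ℂ → ℂ} (hH : Differentiable ℂ H)
    (hnz : ∀ z ∈ Bd a b c d, xi z ≠ 0) (Z : Finset ℂ)
    (hZ : ∀ ρ, ρ ∈ Z ↔ (xi ρ = 0 ∧ ρ.re ∈ Ioo a b ∧ ρ.im ∈ Ioo c d)) :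
    RI (fun z => H z * logDeriv xi z) a b c d = 2 * rpi * cI * ∑ ρ ∈ Z, mu ρ * H ρ := by
  obtain ⟨g, hg, hgz, hfg⟩ := factor_fin xi_diff xi_ne Z
  have hg' : Differentiable ℂ (deriv g) := fun z => (hg.analyticAt z).deriv.differentiableAt
  have hzne : ∀ z ∈ Bd a b c d, ∀ ρ ∈ Z, z - ρ ≠ 0 := by
    intro z hz ρ hρ h
    rw [sub_eq_zero] at h; subst h
    exact hnz z hz ((hZ z).mp hρ).1
  have hgn : ∀ z ∈ Icc a b ×ℂ Icc c d, g z ≠ 0 := by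
    intro z hz h
    have h0 : xi z = 0 := by rw [hfg, h, mul_zero]
    by_cases hb : z.re ∈ Ioo a b ∧ z.im ∈ Ioo c d
    · exact hgz z ((hZ z).mpr ⟨h0, hb⟩) h
    · exact hnz z ⟨⟨hz.1, hz.2⟩, hb⟩ h0
  have hds : ∀ ρ : ℂ, Differentiable ℂ (dslope H ρ) := by
    intro ρ
    have : DifferentiableOn ℂ (dslope H ρ) univ :=
      (Complex.differentiableOn_dslope univ_mem).mpr hH.differentiableOn
    exact differentiableOn_univ.mp this
  set A : ℂ → ℂ := fun z => (∑ ρ ∈ Z, (mu ρ : ℂ) * dslope H ρ z) + H z * (deriv g z / g z) with hA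
  have hAd : DifferentiableOn ℂ A (Icc a b ×ℂ Icc c d) := by
    intro z hz
    apply DifferentiableAt.differentiableWithinAt
    have := hds
    refine DifferentiableAt.add ?_ ((hH z).mul ((hg' z).div (hg z) (hgn z hz)))
    refine DifferentiableAt.fun_sum fun ρ _ => (hds ρ z).const_mul _
  have hsub : Bd a b c d ⊆ Icc a b ×ℂ Icc c d := fun z hz => ⟨hz.1.1, hz.1.2⟩
  have heq : EqOn (fun z => H z * logDeriv xi z)
      (fun z => (∑ ρ ∈ Z, (mu ρ * H ρ) * (z - ρ)⁻¹) + A z) (Bd a b c d) := by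
    intro z hz
    have hld : logDeriv xi z = (∑ ρ ∈ Z, (analyticOrderNatAt xi ρ : ℂ) / (z - ρ)) + deriv g z / g z := by
      have e1 : xi = fun z => (∏ ρ ∈ Z, (z - ρ) ^ (analyticOrderNatAt xi ρ)) * g z := funext hfg
      conv_lhs => rw [e1]
      rw [logDeriv_mul]
      · rw [logDeriv_prod]
        · congr 1
          refine Finset.sum_congr rfl fun ρ hρ => ?_
          rw [logDeriv_fun_pow (by fun_prop)]
          simp [logDeriv_apply]
          ring
        · intro ρ hρ; exact pow_ne_zero _ (hzne z hz ρ hρ)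
        · intro ρ hρ; fun_prop
      · rw [Finset.prod_ne_zero_iff]; intro ρ hρ; exact pow_ne_zero _ (hzne z hz ρ hρ)
      · exact hgn z (hsub hz)
      · fun_prop
      · exact hg z
    simp only [hA]
    rw [hld, mul_add, ← add_assoc, ← Finset.sum_add_distrib, Finset.mul_sum]
    congr 1
    refine Finset.sum_congr rfl fun ρ hρ => ?_
    have h1 := hzne z hz ρ hρ
    rw [dslope_of_ne _ (sub_ne_zero.mp h1), slope_def_field]
    unfold mu
    field_simp
    ring
  have hci : ∀ ρ ∈ Z, ContinuousOn (fun z => (mu ρ * H ρ) * (z - ρ)⁻¹) (Bd a b c d) := by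
    intro ρ hρ
    exact continuousOn_const.mul (ContinuousOn.inv₀ (by fun_prop) fun z hz => hzne z hz ρ hρ)
  rw [RI_congr hab hcd heq, RI_add hab hcd (continuousOn_finsetSum _ hci) (hAd.continuousOn.mono hsub),
    RI_zero hab hcd hAd, add_zero, RI_sum hab hcd _ _ hci, Finset.mul_sum]
  refine Finset.sum_congr rfl fun ρ hρ => ?_
  have h := (hZ ρ).mp hρ
  rw [RI_smul, RI_inv h.2.1.1 h.2.1.2 h.2.2.1 h.2.2.2]
  ring

lemma mu_summable : Summable (fun ρ : ℂ => (mu ρ : ℝ) / (1 + |ρ.im|) ^ 3) := by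
  classical
  obtain ⟨C, hC1, hC⟩ := crude_count
  have hsumZ : Summable (fun k : ℤ => 8 * C / (1 + |(k:ℝ)|) ^ 2) := by
    have h1 : Summable (fun k : ℤ => 8 * C * (1 / |(k:ℝ)| ^ (2:ℝ))) :=
      ((Real.summable_one_div_int_add_rpow 0 2 |>.mpr (by norm_num)).mul_left (8 * C)).congr (by intro k; simp)
    refine Summable.of_norm_bounded_eventually h1 ?_
    have : ({0}ᶜ : Set ℤ) ∈ cofinite := (finite_singleton (0:ℤ)).compl_mem_cofinite
    filter_upwards [this] with k hk
    have hk0 : (0:ℝ) < |(k:ℝ)| := abs_pos.mpr (by simpa using hk)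
    rw [Real.norm_of_nonneg (by positivity), mul_one_div, Real.rpow_ofNat]
    gcongr
    linarith
  refine summable_of_sum_le (c := ∑' k : ℤ, 8 * C / (1 + |(k:ℝ)|) ^ 2) (fun ρ => by positivity) ?_
  intro u
  have hfib := Finset.sum_fiberwise_of_maps_to (s := u) (t := u.image (fun ρ => ⌊ρ.im⌋))
    (g := fun ρ => ⌊ρ.im⌋) (fun ρ hρ => Finset.mem_image_of_mem _ hρ)
    (f := fun ρ : ℂ => (mu ρ : ℝ) / (1 + |ρ.im|) ^ 3)
  rw [← hfib]
  refine le_trans (Finset.sum_le_sum fun k hk => ?_)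
    (hsumZ.sum_le_tsum (u.image (fun ρ => ⌊ρ.im⌋)) (fun k _ => by positivity))
  have hk : ∀ ρ ∈ u.filter (fun ρ => ⌊ρ.im⌋ = k), (mu ρ : ℝ) / (1 + |ρ.im|) ^ 3 ≤
      (mu ρ : ℝ) * (8 / (1 + |(k:ℝ)|) ^ 3) := by
    intro ρ hρ
    have hfl := (Finset.mem_filter.mp hρ).2
    rw [Int.floor_eq_iff] at hfl
    rw [div_eq_mul_inv]
    gcongr
    rw [inv_le_comm₀ (by positivity) (by positivity), inv_div]
    have h1 : 1 + |(k:ℝ)| ≤ 2 * (1 + |ρ.im|) := by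
      have : |(k:ℝ)| ≤ |ρ.im| + 1 := by
        have := abs_sub_abs_le_abs_sub (k:ℝ) ρ.im
        have h2 : |(k:ℝ) - ρ.im| ≤ 1 := by rw [abs_le]; constructor <;> linarith
        linarith
      linarith [abs_nonneg ρ.im]
    rw [div_le_iff₀ (by norm_num)]
    calc (1 + |(k:ℝ)|)^3 ≤ (2 * (1 + |ρ.im|))^3 := by gcongr
      _ = _ := by ring
  refine (Finset.sum_le_sum hk).trans ?_
  rw [← Finset.sum_mul]
  have h2 : ∑ ρ ∈ u.filter (fun ρ => ⌊ρ.im⌋ = k), (mu ρ : ℝ) ≤ C * (1 + |(k:ℝ)|) := by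
    have h3 := hC k ((u.filter (fun ρ => ⌊ρ.im⌋ = k)).filter (fun ρ => IsNontrivialZero ρ)) ?_
    · rw [Finset.sum_filter_of_ne] at h3
      · push_cast at h3; exact h3
      · intro ρ _ hne
        exact mu_pos_iff.mp (Nat.pos_of_ne_zero hne)
    · intro ρ hρ
      have h4 := Finset.mem_filter.mp hρ
      have hfl := (Finset.mem_filter.mp h4.1).2
      rw [Int.floor_eq_iff] at hfl
      have h5 := h4.2.2
      have : ρ - (2 + ((k:ℝ):ℂ) * cI) = ((ρ.re - 2 : ℝ):ℂ) + ((ρ.im - k : ℝ):ℂ) * cI := by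
        apply Complex.ext <;> simp
      rw [this]
      refine (norm_add_le _ _).trans ?_
      rw [norm_mul, Complex.norm_real, Complex.norm_real, Complex.norm_I, Real.norm_eq_abs, Real.norm_eq_abs]
      have a1 : |ρ.re - 2| ≤ 3 := by rw [abs_le]; constructor <;> linarith [h5.1, h5.2]
      have a2 : |ρ.im - k| ≤ 1 := by rw [abs_le]; constructor <;> linarith
      linarith
  calc _ ≤ C * (1 + |(k:ℝ)|) * (8 / (1 + |(k:ℝ)|) ^ 3) := by gcongr
    _ = _ := by field_simp

lemma logDeriv_xi_symm (s : ℂ) : logDeriv xi (1 - s) = - logDeriv xi s := by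
  have h : deriv xi s = - deriv xi (1 - s) := by
    have h1 : xi = fun s => xi (1 - s) := funext fun s => (xi_symm s).symm
    conv_lhs => rw [h1]
    have := (xi_diff (1 - s)).hasDerivAt.comp s ((hasDerivAt_id s).const_sub 1)
    have := this.deriv
    simpa [Function.comp_def] using this
  rw [logDeriv_apply, logDeriv_apply, xi_symm, h]; ring

lemma xi_ne_line (x τ : ℝ) (hx : x < 0 ∨ 1 < x) : xi (x + τ * cI) ≠ 0 := by
  intro h
  have := (xi_zero_iff.mp h)
  have h1 := this.2.1
  have h2 := this.2.2
  simp at h1 h2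
  rcases hx with h | h <;> linarith

lemma logDeriv_cont : Continuous (fun τ : ℝ => logDeriv xi (3/2 + τ * cI)) := by
  have hd : Continuous (deriv xi) := by
    have : Differentiable ℂ (deriv xi) := fun z => (xi_diff.analyticAt z).deriv.differentiableAt
    exact this.continuous
  have hx := xi_diff.continuous
  simp only [logDeriv_apply]
  refine Continuous.div (by fun_prop) (by fun_prop) fun τ => ?_
  have := xi_ne_line (3/2) τ (Or.inr (by norm_num))
  push_cast at this; exact this

lemma explicit_formula {H : ℂ → ℂ} (hH : Differentiable ℂ H) {B : ℝ} (hB0 : 0 ≤ B)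
    (hB : ∀ s : ℂ, -1/2 ≤ s.re → s.re ≤ 3/2 → ‖H s‖ ≤ B / (1 + |s.im|) ^ 4)
    {C : ℝ} (hC : ∀ τ : ℝ, ‖logDeriv xi (3/2 + τ * cI)‖ ≤ C * (1 + |τ|)) :
    ∑' ρ : ℂ, (mu ρ : ℂ) * H ρ = (1 / (2 * rpi)) *
      ((∫ τ : ℝ, logDeriv xi (3/2 + τ * cI) * H (3/2 + τ * cI)) +
       ∫ τ : ℝ, logDeriv xi (3/2 + τ * cI) * H (-1/2 - τ * cI)) := by
  obtain ⟨G, hG1, hG⟩ := good_height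
  have hC0 : 0 ≤ C := by
    have := (norm_nonneg _).trans (hC 0); simpa using this
  choose R hR using hG
  set d : ℕ → ℝ := fun k => R k with hd
  set c : ℕ → ℝ := fun k => R (-(k:ℝ) - 1) with hc
  have hdk : ∀ k : ℕ, (k:ℝ) ≤ d k ∧ d k ≤ k + 1 := fun k => (hR k).1
  have hck : ∀ k : ℕ, -(k:ℝ) - 1 ≤ c k ∧ c k ≤ -k := by
    intro k; have := (hR (-(k:ℝ) - 1)).1
    exact ⟨this.1, by linarith [this.2]⟩
  have hdt : Tendsto d atTop atTop := tendsto_atTop_mono (fun k => (hdk k).1) tendsto_natCast_atTop_atTop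
  have hct : Tendsto c atTop atBot := by
    refine tendsto_atBot_mono (fun k => (hck k).2) ?_
    exact tendsto_neg_atTop_atBot.comp tendsto_natCast_atTop_atTop
  have hfin : ∀ k : ℕ, {ρ | xi ρ = 0 ∧ ρ.re ∈ Ioo (-1/2:ℝ) (3/2) ∧ ρ.im ∈ Ioo (c k) (d k)}.Finite := by
    intro k
    refine (zeros_finite 0 (3 + k)).subset ?_
    rintro ρ ⟨h1, h2, h3⟩
    refine ⟨h1, ?_⟩
    rw [sub_zero]
    refine (Complex.norm_le_abs_re_add_abs_im ρ).trans ?_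
    have a1 : |ρ.re| ≤ 2 := by rw [abs_le]; constructor <;> linarith [h2.1, h2.2]
    have a2 : |ρ.im| ≤ k + 1 := by
      rw [abs_le]; constructor <;> linarith [h3.1, h3.2, (hck k).1, (hdk k).2]
    linarith
  -- the residue identity
  have hres : ∀ k : ℕ, 0 < k → RI (fun z => H z * logDeriv xi z) (-1/2) (3/2) (c k) (d k) =
      2 * rpi * cI * ∑ ρ ∈ (hfin k).toFinset, mu ρ * H ρ := by
    intro k hk
    have hk : (0:ℝ) < k := by exact_mod_cast hk
    have hcd : c k < d k := by linarith [(hck k).2, (hdk k).1]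
    refine RI_residue (by norm_num) hcd hH ?_ _ (by intro ρ; simp)
    intro z hz
    have hzz : z = (z.re : ℂ) + (z.im : ℂ) * cI := (Complex.re_add_im z).symm
    by_cases h1 : z.re ∈ Ioo (-1/2:ℝ) (3/2)
    · have h2 : z.im = c k ∨ z.im = d k := by
        by_contra hcon
        push Not at hcon
        exact hz.2 ⟨h1, lt_of_le_of_ne hz.1.2.1 hcon.1.symm, lt_of_le_of_ne hz.1.2.2 hcon.2⟩
      rcases h2 with h2 | h2
      · rw [hzz, h2]; exact ((hR (-(k:ℝ)-1)).2 z.re hz.1.1).1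
      · rw [hzz, h2]; exact ((hR k).2 z.re hz.1.1).1
    · rw [hzz]
      apply xi_ne_line
      by_contra hcon
      push Not at hcon
      apply h1
      constructor <;> linarith [hcon.1, hcon.2]
  -- sum side
  have hsumm : Summable (fun ρ : ℂ => B * ((mu ρ : ℝ) / (1 + |ρ.im|) ^ 3)) := mu_summable.mul_left B
  have hdom : ∀ ρ : ℂ, ‖(mu ρ : ℂ) * H ρ‖ ≤ B * ((mu ρ : ℝ) / (1 + |ρ.im|) ^ 3) := by
    intro ρ
    rw [norm_mul, Complex.norm_natCast]
    by_cases hz : IsNontrivialZero ρ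
    · have := hB ρ (by linarith [hz.2.1]) (by linarith [hz.2.2])
      have h2 : B / (1 + |ρ.im|) ^ 4 ≤ B / (1 + |ρ.im|) ^ 3 := by
        gcongr
        · linarith [abs_nonneg ρ.im]
        · norm_num
      calc (mu ρ : ℝ) * ‖H ρ‖ ≤ mu ρ * (B / (1 + |ρ.im|) ^ 3) := by gcongr; linarith
        _ = _ := by ring
    · simp [mu_eq_zero hz]
  have hsum : Tendsto (fun k : ℕ => ∑ ρ ∈ (hfin k).toFinset, (mu ρ : ℂ) * H ρ) atTop
      (𝓝 (∑' ρ : ℂ, (mu ρ : ℂ) * H ρ)) := by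
    have e : ∀ k : ℕ, ∑ ρ ∈ (hfin k).toFinset, (mu ρ : ℂ) * H ρ =
        ∑' ρ : ℂ, ((hfin k).toFinset : Set ℂ).indicator (fun ρ => (mu ρ : ℂ) * H ρ) ρ :=
      fun k => sum_eq_tsum_indicator _ _
    simp_rw [e]
    refine tendsto_tsum_of_dominated_convergence hsumm ?_ ?_
    · intro ρ
      by_cases hz : IsNontrivialZero ρ
      · apply tendsto_const_nhds.congr'
        filter_upwards [hdt.eventually_gt_atTop ρ.im, hct.eventually_lt_atBot ρ.im] with k h1 h2
        rw [indicator_of_mem]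
        simp only [Finite.coe_toFinset, mem_ofPred_eq]
        exact ⟨xi_zero_iff.mpr hz, ⟨by linarith [hz.2.1], by linarith [hz.2.2]⟩, h2, h1⟩
      · have : ∀ k : ℕ, ((hfin k).toFinset : Set ℂ).indicator (fun ρ => (mu ρ : ℂ) * H ρ) ρ = (mu ρ : ℂ) * H ρ := by
          intro k
          simp [indicator, mu_eq_zero hz]
        simp_rw [this]
        exact tendsto_const_nhds
    · refine Eventually.of_forall fun k ρ => ?_
      exact (norm_indicator_le_norm_self _ _).trans (hdom ρ)
  -- horizontal
  have hhor : ∀ f : ℕ → ℝ, (∀ k : ℕ, (k:ℝ) ≤ |f k|) →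
      (∀ k : ℕ, ∀ σ ∈ Icc (-1/2:ℝ) (3/2), ‖logDeriv xi (σ + f k * cI)‖ ≤ G * (2 + k) ^ 2) →
      Tendsto (fun k : ℕ => ∫ x in (-1/2:ℝ)..(3/2), H (x + f k * cI) * logDeriv xi (x + f k * cI))
        atTop (𝓝 0) := by
    intro f hf1 hf2
    have hb : ∀ k : ℕ, ‖∫ x in (-1/2:ℝ)..(3/2), H (x + f k * cI) * logDeriv xi (x + f k * cI)‖
        ≤ (8 * B * G) * (1 / ((k:ℝ) + 1)) := by
      intro k
      have := intervalIntegral.norm_integral_le_of_norm_le_const (a := (-1/2:ℝ)) (b := 3/2)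
        (C := 4 * B * G * (1 / ((k:ℝ) + 1)))
        (f := fun x : ℝ => H (x + f k * cI) * logDeriv xi (x + f k * cI)) ?_
      · refine this.trans (le_of_eq ?_)
        rw [show |(3/2:ℝ) - -1/2| = 2 by norm_num]; ring
      · intro x hx
        rw [uIoc_of_le (by norm_num)] at hx
        have hx' : x ∈ Icc (-1/2:ℝ) (3/2) := ⟨hx.1.le, hx.2⟩
        rw [norm_mul]
        have h1 := hB (x + f k * cI) (by simpa using hx'.1) (by simpa using hx'.2)
        have h2 := hf2 k x hx'
        have h3 : (x + f k * cI : ℂ).im = f k := by simp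
        rw [h3] at h1
        have h4 : B / (1 + |f k|) ^ 4 ≤ B / (1 + (k:ℝ)) ^ 4 := by
          gcongr; exact hf1 k
        calc _ ≤ (B / (1 + (k:ℝ)) ^ 4) * (G * (2 + k) ^ 2) := by gcongr; linarith
          _ ≤ (B / (1 + (k:ℝ)) ^ 4) * (G * (2 * (1 + k)) ^ 2) := by gcongr; linarith [(Nat.cast_nonneg k : (0:ℝ) ≤ k)]
          _ = 4 * B * G * (1 / ((k:ℝ) + 1) ^ 2) := by field_simp; ring
          _ ≤ _ := by
            gcongr
            have : (0:ℝ) ≤ k := Nat.cast_nonneg k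
            nlinarith
    refine squeeze_zero_norm hb ?_
    have := (tendsto_one_div_add_atTop_nhds_zero_nat (𝕜 := ℝ)).const_mul (8 * B * G)
    simpa using this
  have hbot := hhor c (by
      intro k; rw [abs_of_nonpos (by linarith [(hck k).2, (Nat.cast_nonneg k : (0:ℝ) ≤ k)])]; linarith [(hck k).2]) (by
      intro k σ hσ
      refine ((hR (-(k:ℝ)-1)).2 σ hσ).2.trans (le_of_eq ?_)
      rw [show -(k:ℝ) - 1 = -(k+1) by ring, abs_neg, abs_of_nonneg (by positivity)]; ring)
  have htop := hhor d (by
      intro k; exact (hdk k).1.trans (le_abs_self _)) (by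
      intro k σ hσ
      refine ((hR k).2 σ hσ).2.trans ?_
      rw [abs_of_nonneg (by positivity)]
      gcongr; norm_num)
  -- vertical
  have hHc := hH.continuous
  have hint : ∀ s : ℝ → ℂ, Continuous s → (∀ τ, -1/2 ≤ (s τ).re ∧ (s τ).re ≤ 3/2 ∧ |(s τ).im| = |τ|) →
      Integrable (fun τ : ℝ => logDeriv xi (3/2 + τ * cI) * H (s τ)) := by
    intro s hs hs2
    have hI := (integrable_inv_one_add_sq).const_mul (2 * C * B)
    refine hI.mono' ((logDeriv_cont.mul (hHc.comp hs)).aestronglyMeasurable) ?_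
    refine Eventually.of_forall fun τ => ?_
    rw [norm_mul]
    have h1 := hB (s τ) (hs2 τ).1 (hs2 τ).2.1
    rw [(hs2 τ).2.2] at h1
    have hτ := abs_nonneg τ
    calc _ ≤ (C * (1 + |τ|)) * (B / (1 + |τ|) ^ 4) := by
          gcongr; exact hC τ
      _ = C * B * (1 / (1 + |τ|) ^ 3) := by field_simp
      _ ≤ C * B * (2 * (1 + τ ^ 2)⁻¹) := by
          gcongr
          rw [← sq_abs τ, ← div_eq_mul_inv, div_le_div_iff₀ (by positivity) (by positivity)]
          have := pow_nonneg hτ 3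
          nlinarith
      _ = _ := by ring
  have hint1 := hint (fun τ => 3/2 + τ * cI) (by fun_prop) (by intro τ; norm_num)
  have hint2 := hint (fun τ => -1/2 - τ * cI) (by fun_prop) (by intro τ; norm_num)
  have hint2' : Integrable (fun τ : ℝ => logDeriv xi (3/2 - τ * cI) * H (-1/2 + τ * cI)) := by
    have := hint2.comp_neg
    refine this.congr (Eventually.of_forall fun τ => ?_)
    simp [sub_eq_add_neg]
  have hv1 := intervalIntegral_tendsto_integral hint1 hct hdt
  have hv2 := intervalIntegral_tendsto_integral hint2' hct hdt
  have e2 : ∫ τ : ℝ, logDeriv xi (3/2 - τ * cI) * H (-1/2 + τ * cI) =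
      ∫ τ : ℝ, logDeriv xi (3/2 + τ * cI) * H (-1/2 - τ * cI) := by
    rw [← integral_neg_eq_self]
    congr 1; funext τ; simp [sub_eq_add_neg]
  rw [e2] at hv2
  have hRI : Tendsto (fun k => RI (fun z => H z * logDeriv xi z) (-1/2) (3/2) (c k) (d k)) atTop
      (𝓝 (0 - 0 + cI * (∫ τ : ℝ, logDeriv xi (3/2 + τ * cI) * H (3/2 + τ * cI)) +
       cI * ∫ τ : ℝ, logDeriv xi (3/2 + τ * cI) * H (-1/2 - τ * cI))) := by
    refine (((hbot.sub htop).add (hv1.const_mul cI)).add (hv2.const_mul cI)).congr ?_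
    intro k
    unfold RI
    have e3 : ∀ y : ℝ, H (((-1/2:ℝ):ℂ) + y * cI) * logDeriv xi (((-1/2:ℝ):ℂ) + y * cI) =
        - (logDeriv xi (3/2 - y * cI) * H (-1/2 + y * cI)) := by
      intro y
      have : ((-1/2:ℝ):ℂ) + y * cI = 1 - (3/2 - y * cI) := by push_cast; ring
      rw [this, logDeriv_xi_symm]
      rw [show (1:ℂ) - (3/2 - y * cI) = -1/2 + y * cI by ring]; ring
    simp_rw [e3]
    rw [intervalIntegral.integral_neg]
    have e4 : ∀ y : ℝ, H (((3/2:ℝ):ℂ) + y * cI) * logDeriv xi (((3/2:ℝ):ℂ) + y * cI) =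
        logDeriv xi (3/2 + y * cI) * H (3/2 + y * cI) := by
      intro y; push_cast; ring
    simp_rw [e4]
    ring
  have hfinal := (hsum.const_mul (2 * rpi * cI)).congr' (by
    filter_upwards [eventually_gt_atTop 0] with k hk
    exact (hres k hk).symm)
  have := tendsto_nhds_unique hRI hfinal
  have hpi : (rpi : ℂ) ≠ 0 := by exact_mod_cast Real.pi_ne_zero
  have hI := Complex.I_ne_zero
  generalize (∑' ρ : ℂ, (mu ρ : ℂ) * H ρ) = S at this ⊢
  generalize (∫ τ : ℝ, logDeriv xi (3/2 + τ * cI) * H (3/2 + τ * cI)) = X at this ⊢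
  generalize (∫ τ : ℝ, logDeriv xi (3/2 + τ * cI) * H (-1/2 - τ * cI)) = Y at this ⊢
  field_simp
  apply mul_left_cancel₀ hI
  linear_combination -this

noncomputable def hh (w : ℂ) : ℂ := w⁻¹ - Complex.log (1 + w⁻¹)

lemma hh_bound {w : ℂ} (hw : 2 ≤ ‖w‖) : ‖hh w‖ ≤ 1 / ‖w‖ ^ 2 := by
  have h1 : ‖w⁻¹‖ ≤ 1/2 := by
    rw [norm_inv, one_div]; exact inv_anti₀ (by norm_num) hw
  have h2 := Complex.norm_log_one_add_sub_self_le (z := w⁻¹) (by linarith)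
  unfold hh
  rw [norm_sub_rev]
  refine h2.trans ?_
  have h3 : (1 - ‖w⁻¹‖)⁻¹ ≤ 2 := by
    rw [inv_le_comm₀ (by linarith) (by norm_num)]; linarith
  have h4 : 1 / ‖w‖ ^ 2 = ‖w⁻¹‖ ^ 2 := by rw [norm_inv, one_div, inv_pow]
  rw [h4]
  nlinarith [sq_nonneg ‖w⁻¹‖]

lemma norm_add_nat_ge {s : ℂ} (hs : 2 < s.re) (n : ℕ) : (n:ℝ) + 2 ≤ ‖s + n‖ := by
  have := Complex.re_le_norm (s + n)
  simp at this; linarith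

lemma sum_sq_hasSum {r : ℝ} (hr : 2 ≤ r) :
    HasSum (fun n : ℕ => 1 / ((n:ℝ) + r - 1) - 1 / (((n + 1 : ℕ):ℝ) + r - 1)) (1 / (r - 1)) := by
  rw [hasSum_iff_tendsto_nat_of_nonneg]
  · have : ∀ n : ℕ, ∑ i ∈ Finset.range n, (1 / ((i:ℝ) + r - 1) - 1 / (((i + 1 : ℕ):ℝ) + r - 1)) =
        1 / (r - 1) - 1 / ((n:ℝ) + r - 1) := by
      intro n
      rw [Finset.sum_range_sub' (fun i : ℕ => 1 / ((i:ℝ) + r - 1))]; simp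
    simp_rw [this]
    have h2 : Tendsto (fun n : ℕ => 1 / ((n:ℝ) + r - 1)) atTop (𝓝 0) := by
      simp_rw [one_div]
      apply tendsto_inv_atTop_zero.comp
      simp_rw [add_sub_assoc]
      exact tendsto_atTop_add_const_right _ _ tendsto_natCast_atTop_atTop
    simpa using tendsto_const_nhds.sub h2
  · intro n
    rw [sub_nonneg]
    have : (0:ℝ) ≤ n := Nat.cast_nonneg n
    apply one_div_le_one_div_of_le (by linarith)
    push_cast; linarith

lemma hh_sum {s : ℂ} (hs : 2 < s.re) : Summable (fun n : ℕ => hh (s + n)) ∧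
    ‖∑' n : ℕ, hh (s + n)‖ ≤ 4 / ‖s‖ := by
  have hs2 : 2 ≤ ‖s‖ := by have := Complex.re_le_norm s; linarith
  have h1 := (sum_sq_hasSum hs2).mul_left 2
  have hb : ∀ n : ℕ, ‖hh (s + n)‖ ≤ 2 * (1 / ((n:ℝ) + ‖s‖ - 1) - 1 / (((n + 1 : ℕ):ℝ) + ‖s‖ - 1)) := by
    intro n
    have hn : (0:ℝ) ≤ n := Nat.cast_nonneg n
    refine (hh_bound (by linarith [norm_add_nat_ge hs n])).trans ?_
    have e1 : ((n:ℝ) + ‖s‖) ^ 2 ≤ 2 * ‖s + n‖ ^ 2 := by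
      have a1 : ‖s + n‖ ^ 2 = (s.re + n) ^ 2 + s.im ^ 2 := by
        rw [Complex.sq_norm, Complex.normSq_apply]; simp; ring
      have a2 : ‖s‖ ^ 2 = s.re ^ 2 + s.im ^ 2 := by
        rw [Complex.sq_norm, Complex.normSq_apply]; ring
      rw [a1]
      nlinarith [sq_nonneg ((n:ℝ) - ‖s‖), mul_nonneg hn (by linarith : 0 ≤ s.re)]
    have e2 : 1 / ((n:ℝ) + ‖s‖ - 1) - 1 / (((n + 1 : ℕ):ℝ) + ‖s‖ - 1) = 1 / (((n:ℝ) + ‖s‖ - 1) * ((n:ℝ) + ‖s‖)) := by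
      have : (n:ℝ) + ‖s‖ - 1 ≠ 0 := by linarith
      have : (n:ℝ) + ‖s‖ ≠ 0 := by linarith
      push_cast
      rw [show (n:ℝ) + 1 + ‖s‖ - 1 = n + ‖s‖ by ring]
      field_simp; ring
    have hpos : 0 < ‖s + n‖ := by linarith [norm_add_nat_ge hs n]
    rw [e2, mul_one_div, div_le_div_iff₀ (by positivity) (by nlinarith)]
    nlinarith
  refine ⟨Summable.of_norm_bounded h1.summable hb, ?_⟩
  refine (tsum_of_norm_bounded h1 hb).trans ?_
  rw [mul_one_div, div_le_div_iff₀ (by linarith) (by linarith)]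
  linarith

lemma real_digamma {x : ℝ} (hx : 1 < x) : ∃ p : ℝ, Complex.digamma x = p ∧
    rlog (x - 1) ≤ p ∧ p ≤ rlog x := by
  have hne : ∀ m : ℕ, x ≠ -m := by
    intro m h; have : (0:ℝ) ≤ m := Nat.cast_nonneg m; linarith
  have hneC : ∀ m : ℕ, (x:ℂ) ≠ -m := by
    intro m h; apply hne m; exact_mod_cast h
  have hd := (Real.differentiableAt_Gamma hne).hasDerivAt
  have hpos : 0 < Real.Gamma x := Real.Gamma_pos_of_pos (by linarith)
  refine ⟨deriv Real.Gamma x / Real.Gamma x, ?_, ?_, ?_⟩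
  · rw [Complex.digamma_def, logDeriv_apply, Complex.Gamma_ofReal]
    have h1 := hd.ofReal_comp
    have h2 := (Complex.differentiableAt_Gamma x hneC).hasDerivAt.comp_ofReal
    simp_rw [Complex.Gamma_ofReal] at h2
    rw [h2.unique h1]; push_cast; rfl
  all_goals
    have hl : HasDerivAt (rlog ∘ Real.Gamma) (deriv Real.Gamma x / Real.Gamma x) x :=
      hd.log hpos.ne'
  · have := Real.convexOn_log_Gamma.slope_le_of_hasDerivAt (x := x - 1) (y := x)
      (by simp; linarith) (by simp; linarith) (by linarith) hl
    refine le_trans (le_of_eq ?_) this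
    rw [slope_def_field]
    have e : Real.Gamma x = (x - 1) * Real.Gamma (x - 1) := by
      rw [← Real.Gamma_add_one (by linarith)]; ring_nf
    simp only [Function.comp]
    rw [e, Real.log_mul (by linarith) (Real.Gamma_pos_of_pos (by linarith)).ne']
    simp
  · have := Real.convexOn_log_Gamma.le_slope_of_hasDerivAt (x := x) (y := x + 1)
      (by simp; linarith) (by simp; linarith) (by linarith) hl
    refine this.trans (le_of_eq ?_)
    rw [slope_def_field]
    simp only [Function.comp]
    rw [Real.Gamma_add_one (by linarith), Real.log_mul (by linarith) hpos.ne']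
    simp

lemma digamma_asymp {s : ℂ} (hs : 2 < s.re) : ‖Complex.digamma s - Complex.log s‖ ≤ 4 / ‖s‖ := by
  set D : ℂ → ℂ := fun s => Complex.digamma s - Complex.log s + ∑' n : ℕ, hh (s + n) with hD
  set U : Set ℂ := {s | 2 < s.re} with hU
  have hUo : IsOpen U := isOpen_lt continuous_const Complex.continuous_re
  have hDd : DifferentiableOn ℂ D U := by
    have hG : DifferentiableOn ℂ (fun s => ∑' n : ℕ, hh (s + n)) U := by
      refine Complex.differentiableOn_tsum_of_summable_norm (u := fun n : ℕ => 1 / ((n:ℝ) + 1) ^ 2) ?_ ?_ hUo ?_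
      · have := (hasSum_nat_add_iff' 1).mpr hasSum_zeta_two
        simpa using this.summable
      · intro n s hs
        apply DifferentiableAt.differentiableWithinAt
        have hn0 : s + n ≠ 0 := by
          intro h; have := norm_add_nat_ge hs n; rw [h, norm_zero] at this
          have : (0:ℝ) ≤ n := Nat.cast_nonneg n
          linarith
        have hi : DifferentiableAt ℂ (fun s : ℂ => (s + n)⁻¹) s :=
          (differentiableAt_id.add_const _).inv hn0
        refine hi.sub ((hi.const_add 1).clog ?_)
        left
        have : ‖(s + n)⁻¹‖ ≤ 1/2 := by
          rw [norm_inv, one_div]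
          exact inv_anti₀ (by norm_num) (by linarith [norm_add_nat_ge hs n, (Nat.cast_nonneg n : (0:ℝ) ≤ n)])
        have h3 := Complex.abs_re_le_norm ((s + n)⁻¹)
        rw [Complex.add_re, Complex.one_re]
        linarith [neg_abs_le ((s+n)⁻¹).re]
      · intro n s hs
        have h1 := norm_add_nat_ge hs n
        have : (0:ℝ) ≤ n := Nat.cast_nonneg n
        refine (hh_bound (by linarith)).trans ?_
        gcongr; linarith
    refine DifferentiableOn.add (DifferentiableOn.sub ?_ ?_) hG
    · intro s hs
      have hs : 2 < s.re := hs
      apply DifferentiableAt.differentiableWithinAt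
      have hU2 : {s : ℂ | 0 < s.re} ∈ 𝓝 s :=
        (isOpen_lt continuous_const Complex.continuous_re).mem_nhds (by show 0 < s.re; linarith)
      have hGam : AnalyticAt ℂ Complex.Gamma s := by
        rw [Complex.analyticAt_iff_eventually_differentiableAt]
        filter_upwards [hU2] with z hz
        refine Complex.differentiableAt_Gamma z fun m h => ?_
        have hz : 0 < z.re := hz
        rw [h] at hz; simp at hz
        have : (0:ℝ) ≤ m := Nat.cast_nonneg m
        linarith
      rw [Complex.digamma_def]
      exact hGam.deriv.differentiableAt.div hGam.differentiableAt
        (Complex.Gamma_ne_zero_of_re_pos (by linarith))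
    · intro s hs
      have hs : 2 < s.re := hs
      exact (Complex.differentiableAt_log (Or.inl (by linarith))).differentiableWithinAt
  have hbd : ∀ x : ℝ, 2 < x → ‖D x‖ ≤ (rlog x - rlog (x - 1)) + 4 / x := by
    intro x hx
    obtain ⟨p, hp, hp1, hp2⟩ := real_digamma (x := x) (by linarith)
    simp only [hD]
    refine (norm_add_le _ _).trans (add_le_add ?_ ?_)
    · rw [hp, ← Complex.ofReal_log (by linarith), ← Complex.ofReal_sub, Complex.norm_real,
        Real.norm_eq_abs, abs_le]
      constructor <;> linarith
    · have := (hh_sum (s := x) (by simpa using hx)).2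
      rwa [Complex.norm_real, Real.norm_of_nonneg (by linarith)] at this
  have hper : ∀ x : ℝ, 2 < x → D ((x + 1 : ℝ)) = D x := by
    intro x hx
    simp only [hD]
    have hsum := (hh_sum (s := x) (by simpa using hx)).1
    rw [hsum.tsum_eq_zero_add]
    have e1 : ∀ n : ℕ, hh ((x:ℂ) + ((n + 1 : ℕ):ℂ)) = hh (((x + 1 : ℝ):ℂ) + n) := by
      intro n; congr 1; push_cast; ring
    simp_rw [e1]
    have e2 : Complex.digamma ((x + 1 : ℝ)) = Complex.digamma x + (x:ℂ)⁻¹ := by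
      push_cast
      apply Complex.digamma_apply_add_one
      intro m h
      have : x = -m := by exact_mod_cast h
      have : (0:ℝ) ≤ m := Nat.cast_nonneg m
      linarith
    have e3 : Complex.log (1 + (x:ℂ)⁻¹) = Complex.log ((x + 1 : ℝ)) - Complex.log x := by
      have : (1 + (x:ℂ)⁻¹) = ((1 + x⁻¹ : ℝ) : ℂ) := by push_cast; rfl
      rw [this, ← Complex.ofReal_log (by positivity), ← Complex.ofReal_log (by linarith), ← Complex.ofReal_log (by linarith),
        ← Complex.ofReal_sub, ← Real.log_div (by linarith) (by linarith)]
      congr 2; field_simp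
    rw [e2]
    simp only [Nat.cast_zero, add_zero]
    unfold hh
    rw [e3]; ring
  have hzero : ∀ x : ℝ, 2 < x → D x = 0 := by
    intro x hx
    have h1 : ∀ n : ℕ, D ((x + n : ℝ)) = D x := by
      intro n
      induction n with
      | zero => simp
      | succ n ih =>
        rw [← ih, ← hper (x + n) (by have : (0:ℝ) ≤ n := Nat.cast_nonneg n
                                     linarith)]
        congr 1; push_cast; ring
    have hlim : Tendsto (fun y : ℝ => (rlog y - rlog (y - 1)) + 4 / y) atTop (𝓝 0) := by
      have a1 : Tendsto (fun y : ℝ => 1 / (y - 1) + 4 / y) atTop (𝓝 (0 + 0)) := by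
        refine Tendsto.add ?_ ?_
        · exact tendsto_const_nhds.div_atTop (tendsto_atTop_add_const_right _ _ tendsto_id)
        · exact tendsto_const_nhds.div_atTop tendsto_id
      rw [add_zero] at a1
      refine tendsto_of_tendsto_of_tendsto_of_le_of_le' tendsto_const_nhds a1 ?_ ?_
      · filter_upwards [eventually_gt_atTop 2] with y hy
        have := Real.log_le_log (show 0 < y - 1 by linarith) (show y - 1 ≤ y by linarith)
        have : 0 ≤ 4 / y := by positivity
        linarith
      · filter_upwards [eventually_gt_atTop 2] with y hy
        have h3 : rlog y - rlog (y - 1) = rlog (y / (y - 1)) := by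
          rw [Real.log_div (by linarith) (by linarith)]
        have h4 := Real.log_le_sub_one_of_pos (show 0 < y / (y - 1) from div_pos (by linarith) (by linarith))
        have h5 : y / (y - 1) - 1 = 1 / (y - 1) := by
          have : y - 1 ≠ 0 := by linarith
          field_simp; ring
        linarith
    have hl2 : Tendsto (fun n : ℕ => x + (n:ℝ)) atTop atTop :=
      tendsto_atTop_add_const_left _ _ tendsto_natCast_atTop_atTop
    have h3 : Tendsto (fun n : ℕ => D ((x + n : ℝ))) atTop (𝓝 0) := by
      refine squeeze_zero_norm' ?_ (hlim.comp hl2)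
      filter_upwards with n
      exact hbd _ (by have : (0:ℝ) ≤ n := Nat.cast_nonneg n
                      linarith)
    simp_rw [h1] at h3
    exact tendsto_nhds_unique tendsto_const_nhds h3
  have hUc : IsPreconnected U := (convex_halfSpace_re_gt 2).isPreconnected
  have hAn : AnalyticOnNhd ℂ D U := hDd.analyticOnNhd hUo
  have h3U : (3:ℂ) ∈ U := by show 2 < (3:ℂ).re; norm_num
  have hfr : ∃ᶠ z in 𝓝[≠] (3:ℂ), D z = 0 := by
    have hc : Tendsto (fun n : ℕ => ((3 + 1 / ((n:ℝ) + 1) : ℝ) : ℂ)) atTop (𝓝[≠] 3) := by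
      rw [tendsto_nhdsWithin_iff]
      refine ⟨?_, ?_⟩
      · have h5 : Tendsto (fun n : ℕ => (3 + 1 / ((n:ℝ) + 1) : ℝ)) atTop (𝓝 (3 + 0)) :=
          tendsto_const_nhds.add tendsto_one_div_add_atTop_nhds_zero_nat
        have := (Complex.continuous_ofReal.tendsto _).comp h5
        simpa [Function.comp_def] using this
      · filter_upwards with n
        intro h
        have h6 : (3 + 1 / ((n:ℝ) + 1) : ℝ) = 3 := by
          rw [mem_singleton_iff] at h; exact_mod_cast h
        have : 0 < 1 / ((n:ℝ) + 1) := by positivity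
        linarith
    exact hc.frequently (Frequently.of_forall fun n => hzero _ (by
      have : 0 < 1 / ((n:ℝ) + 1) := by positivity
      linarith))
  have hfin := hAn.eqOn_zero_of_preconnected_of_frequently_eq_zero hUc h3U hfr hs
  have h8 : Complex.digamma s - Complex.log s = -∑' n : ℕ, hh (s + n) := by
    have : D s = 0 := hfin
    simp only [hD] at this
    linear_combination this
  rw [h8, norm_neg]
  exact (hh_sum hs).2

open scoped ArithmeticFunction

lemma logDeriv_xi_eq {s : ℂ} (hs : 1 < s.re) :
    logDeriv xi s = 1 / s + 1 / (s - 1) + (-(1/2) * (rlog rpi : ℂ) + 1/2 * Complex.digamma (s / 2))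
      + deriv riemannZeta s / riemannZeta s := by
  have hs0 : s ≠ 0 := by intro h; rw [h] at hs; simp at hs; linarith
  have hs1 : s ≠ 1 := by intro h; rw [h] at hs; simp at hs
  have hs1' : s - 1 ≠ 0 := sub_ne_zero.mpr hs1
  have hev : xi =ᶠ[𝓝 s] fun s => s * (s - 1) * (cGR s * riemannZeta s) := by
    have : {z : ℂ | 1 < z.re} ∈ 𝓝 s := (isOpen_lt continuous_const Complex.continuous_re).mem_nhds hs
    filter_upwards [this] with z hz
    have hz' : 1 < z.re := hz
    exact xi_eq' (by linarith) (by intro h; rw [h] at hz'; simp at hz')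
  have hG0 : cGR s ≠ 0 := Complex.Gammaℝ_ne_zero_of_re_pos (by linarith)
  have hz0 : riemannZeta s ≠ 0 := riemannZeta_ne_zero_of_one_lt_re hs
  have hzd := differentiableAt_riemannZeta hs1
  have hpole : ∀ m : ℕ, s / 2 ≠ -(m:ℂ) := by
    intro m h
    have := congrArg Complex.re h
    simp at this
    have h2 : (0:ℝ) ≤ m := Nat.cast_nonneg m
    linarith
  have hGd0 : DifferentiableAt ℂ Complex.Gamma (s/2) := Complex.differentiableAt_Gamma _ hpole
  have hGne : Complex.Gamma (s/2) ≠ 0 := Complex.Gamma_ne_zero hpole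
  have hpi : (rpi : ℂ) ≠ 0 := by exact_mod_cast Real.pi_ne_zero
  have hpd : HasDerivAt (fun s : ℂ => (rpi:ℂ) ^ (-s / 2)) ((rpi:ℂ) ^ (-s / 2) * Complex.log rpi * (-1/2)) s := by
    have h1 : HasDerivAt (fun s : ℂ => -s / 2) (-1/2) s := ((hasDerivAt_id s).neg.div_const 2)
    exact h1.const_cpow (Or.inl hpi)
  have hGa : HasDerivAt (fun s : ℂ => Complex.Gamma (s/2)) (deriv Complex.Gamma (s/2) * (1/2)) s := by
    have h1 : HasDerivAt (fun s : ℂ => s / 2) (1/2) s := (hasDerivAt_id s).div_const 2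
    exact hGd0.hasDerivAt.comp s h1
  have hGR : HasDerivAt cGR ((rpi:ℂ) ^ (-s / 2) * Complex.log rpi * (-1/2) * Complex.Gamma (s/2) + (rpi:ℂ) ^ (-s / 2) * (deriv Complex.Gamma (s/2) * (1/2))) s := hpd.mul hGa
  have hpn : (rpi:ℂ) ^ (-s / 2) ≠ 0 := by
    rw [Complex.cpow_def_of_ne_zero hpi]; exact Complex.exp_ne_zero _
  have h1 : logDeriv xi s = logDeriv (fun s => s * (s - 1) * (cGR s * riemannZeta s)) s := by
    simp only [logDeriv_apply]; rw [hev.deriv_eq, hev.eq_of_nhds]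
  rw [h1, logDeriv_mul (f := fun s : ℂ => s * (s-1)) (g := fun s => cGR s * riemannZeta s) s (mul_ne_zero hs0 hs1') (mul_ne_zero hG0 hz0) (by fun_prop) (hGR.differentiableAt.mul hzd),
    logDeriv_mul (f := fun s : ℂ => s) (g := fun s => s - 1) s hs0 hs1' (by fun_prop) (by fun_prop),
    logDeriv_mul s hG0 hz0 hGR.differentiableAt hzd]
  have e1 : logDeriv (fun s : ℂ => s) s = 1 / s := by simp [logDeriv_apply]
  have e2 : logDeriv (fun s : ℂ => s - 1) s = 1 / (s-1) := by simp [logDeriv_apply]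
  have e3 : logDeriv cGR s = -(1/2) * (rlog rpi : ℂ) + 1/2 * Complex.digamma (s / 2) := by
    rw [logDeriv_apply, hGR.deriv, Complex.digamma_def, logDeriv_apply, Complex.Gammaℝ_def, Complex.ofReal_log Real.pi_pos.le]
    field_simp
  rw [e1, e2, e3, logDeriv_apply]
  ring

/-- archimedean part -/
noncomputable def Bf (τ : ℝ) : ℂ :=
  logDeriv xi (3/2 + τ * cI) + LSeries (fun n => (Λ n : ℂ)) (3/2 + τ * cI)

lemma re32 (τ : ℝ) : ((3/2 : ℂ) + τ * cI).re = 3/2 := by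
  simp

lemma norm32 (τ : ℝ) : (1 + |τ|) / 2 ≤ ‖(3/2 : ℂ) + τ * cI‖ := by
  have h1 := Complex.abs_re_le_norm ((3/2 : ℂ) + τ * cI)
  have h2 := Complex.abs_im_le_norm ((3/2 : ℂ) + τ * cI)
  rw [re32] at h1
  simp at h2
  rw [abs_of_pos (by norm_num)] at h1
  linarith

lemma Bf_eq (τ : ℝ) : Bf τ = 1 / (3/2 + τ * cI) + 1 / (3/2 + τ * cI - 1) + (-(1/2) * (rlog rpi : ℂ) + 1/2 * Complex.digamma ((3/2 + τ * cI) / 2)) := by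
  have h : 1 < ((3/2 : ℂ) + τ * cI).re := by rw [re32]; norm_num
  rw [Bf, logDeriv_xi_eq h]
  have := ArithmeticFunction.LSeries_vonMangoldt_eq_deriv_riemannZeta_div h
  rw [this]
  ring

lemma Bf_cont : Continuous Bf := by
  refine logDeriv_cont.add ?_
  rw [continuous_iff_continuousAt]
  intro τ
  have h : 1 < ((3/2 : ℂ) + τ * cI).re := by rw [re32]; norm_num
  have h2 : DifferentiableAt ℂ (LSeries (fun n => (Λ n : ℂ))) (3/2 + τ * cI) := by
    refine (LSeries_hasDerivAt ?_).differentiableAt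
    refine lt_of_le_of_lt (LSeries.abscissaOfAbsConv_le_of_forall_lt_LSeriesSummable (x := 1) ?_) (by exact_mod_cast h)
    intro y hy
    exact ArithmeticFunction.LSeriesSummable_vonMangoldt (by simpa using hy)
  exact ContinuousAt.comp (f := fun τ : ℝ => (3/2 : ℂ) + τ * cI) (x := τ) h2.continuousAt (by fun_prop)

lemma Bf_err (τ : ℝ) : ‖Bf τ - (1/2 * Complex.log (11/4 + τ/2 * cI) - 1/2 * (rlog rpi : ℂ))‖
    ≤ 20 / (1 + |τ|) := by
  set s : ℂ := 3/2 + τ * cI with hs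
  have hp : 0 < 1 + |τ| := by positivity
  have hw : (11/4 + τ/2 * cI : ℂ) = s/2 + 1 + 1 := by rw [hs]; ring
  have hre : s.re = 3/2 := re32 τ
  have him : s.im = τ := by simp [hs]
  have key : ∀ z : ℂ, 1/2 ≤ |z.re| → |τ|/2 ≤ |z.im| → z ≠ 0 ∧ ‖1 / z‖ ≤ 4 / (1 + |τ|) := by
    intro z h1 h2
    have h3 := Complex.abs_re_le_norm z
    have h4 := Complex.abs_im_le_norm z
    have h5 : (1 + |τ|)/4 ≤ ‖z‖ := by linarith
    refine ⟨?_, ?_⟩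
    · rintro rfl; simp at h1; linarith
    · rw [norm_div, norm_one, div_le_div_iff₀ (by linarith) hp]; linarith
  have n1 := key s (by rw [hre]; norm_num) (by rw [him]; linarith [abs_nonneg τ])
  have n2 := key (s-1) (by simp [hre]; norm_num) (by simp [him])
  have n3 := key (s/2) (by simp [hre]; norm_num) (by simp [him, abs_div])
  have n4 := key (s/2+1) (by simp [hre]; norm_num) (by simp [him, abs_div])
  have n5 := key (s/2+1+1) (by simp [hre]; norm_num) (by simp [him, abs_div])
  have hpole : ∀ z : ℂ, 0 < z.re → ∀ m : ℕ, z ≠ -(m:ℂ) := by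
    intro z hz m h
    rw [h] at hz; simp at hz
    have h2 : (0:ℝ) ≤ m := Nat.cast_nonneg m
    linarith
  have d1 := Complex.digamma_apply_add_one (s/2) (hpole _ (by simp [hre]))
  have d2 := Complex.digamma_apply_add_one (s/2+1) (hpole _ (by simp [hre]; norm_num))
  have d3 := digamma_asymp (s := s/2+1+1) (by simp [hre]; norm_num)
  have e1 : Bf τ - (1/2 * Complex.log (11/4 + τ/2 * cI) - 1/2 * (rlog rpi : ℂ))
      = 1/s + 1/(s-1) + (-(1/2)) * (1/(s/2)) + (-(1/2)) * (1/(s/2+1)) + 1/2 * (Complex.digamma (s/2+1+1) - Complex.log (s/2+1+1)) := by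
    rw [Bf_eq, hw, d2, d1, ← hs]
    ring
  have d4 : ‖Complex.digamma (s/2+1+1) - Complex.log (s/2+1+1)‖ ≤ 16/(1+|τ|) := by
    have := n5.2
    rw [norm_div, norm_one] at this
    calc _ ≤ _ := d3
      _ = 4 * (1/‖s/2+1+1‖) := by ring
      _ ≤ 4 * (4 / (1 + |τ|)) := by linarith
      _ = _ := by ring
  rw [e1]
  have hh : ‖(-(1/2) : ℂ)‖ = 1/2 := by simp
  have hh2 : ‖((1/2) : ℂ)‖ = 1/2 := by simp
  have q : ∀ c : ℝ, c/(1+|τ|) = c * (1+|τ|)⁻¹ := fun c => div_eq_mul_inv _ _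
  have := norm_add_le (1/s + 1/(s-1) + (-(1/2)) * (1/(s/2)) + (-(1/2)) * (1/(s/2+1))) (1/2 * (Complex.digamma (s/2+1+1) - Complex.log (s/2+1+1)))
  have := norm_add_le (1/s + 1/(s-1) + (-(1/2)) * (1/(s/2))) ((-(1/2)) * (1/(s/2+1)))
  have := norm_add_le (1/s + 1/(s-1)) ((-(1/2)) * (1/(s/2)))
  have := norm_add_le (1/s) (1/(s-1))
  have m1 : ∀ x : ℂ, ‖(-(1/2)) * x‖ = 1/2 * ‖x‖ := fun x => by rw [norm_mul, hh]
  have m2 : ∀ x : ℂ, ‖(1/2) * x‖ = 1/2 * ‖x‖ := fun x => by rw [norm_mul, hh2]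
  have m3 := m1 (1/(s/2))
  have m4 := m1 (1/(s/2+1))
  have m5 := m2 (Complex.digamma (s/2+1+1) - Complex.log (s/2+1+1))
  have q4 := q 4
  have q16 := q 16
  have q20 := q 20
  linarith [n1.2, n2.2, n3.2, n4.2]

lemma w_ge (τ : ℝ) : (1 + |τ|)/4 ≤ ‖(11/4 + τ/2 * cI : ℂ)‖ := by
  have h1 := Complex.abs_re_le_norm (11/4 + τ/2 * cI : ℂ)
  have h2 := Complex.abs_im_le_norm (11/4 + τ/2 * cI : ℂ)
  have e1 : (11/4 + τ/2 * cI : ℂ).re = 11/4 := by simp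
  have e2 : (11/4 + τ/2 * cI : ℂ).im = τ/2 := by simp
  rw [e1, abs_of_pos (by norm_num)] at h1
  rw [e2, abs_div, abs_of_pos (show (0:ℝ) < 2 by norm_num)] at h2
  linarith

lemma w_le (τ : ℝ) : ‖(11/4 + τ/2 * cI : ℂ)‖ ≤ 3 * (1 + |τ|) := by
  refine (norm_add_le _ _).trans ?_
  simp
  linarith [abs_nonneg τ]

lemma logw_lip (t u : ℝ) : ‖Complex.log (11/4 + (t+u:ℝ)/2 * cI) - Complex.log (11/4 + t/2 * cI)‖
    ≤ 2 * (1 + |u|)^2 / (1 + |t|) := by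
  set f : ℝ → ℂ := fun x => Complex.log (11/4 + x/2 * cI) with hf
  have hd : ∀ x : ℝ, HasDerivAt f (1/2 * cI / (11/4 + x/2 * cI)) x := by
    intro x
    have h1 : HasDerivAt (fun x : ℝ => (11/4 + x/2 * cI : ℂ)) (1/2 * cI) x := by
      have := ((Complex.ofRealCLM.hasDerivAt (x := x)).div_const 2).mul_const cI |>.const_add (11/4 : ℂ)
      simpa using this
    exact h1.clog_real (by left; simp)
  have hb : ∀ x ∈ Set.uIcc t (t+u), ‖(1/2 * cI / (11/4 + x/2 * cI) : ℂ)‖ ≤ 2*(1+|u|)/(1+|t|) := by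
    intro x hx
    have h1 : |x - t| ≤ |u| := by
      have := Set.abs_sub_left_of_mem_uIcc hx
      simpa using this
    have h2 : |t| ≤ |x| + |u| := by
      have := abs_sub_abs_le_abs_sub t x
      rw [abs_sub_comm] at this; linarith
    have h3 := w_ge x
    have hp : 0 < (1 + |x|)/4 := by positivity
    rw [norm_div]
    simp only [norm_mul, Complex.norm_I]
    have : ‖(1/2:ℂ)‖ = 1/2 := by simp
    rw [this, div_le_div_iff₀ (by linarith) (by positivity)]
    have h4 := abs_nonneg u
    have h5 := abs_nonneg x
    calc 1/2 * 1 * (1 + |t|) ≤ 2*(1 + |u|) * ((1 + |x|)/4) := by nlinarith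
      _ ≤ _ := mul_le_mul_of_nonneg_left h3 (by positivity)
  have := Convex.norm_image_sub_le_of_norm_hasDerivWithin_le (f := f) (s := Set.uIcc t (t+u)) (x := t) (y := t + u)
    (fun x _ => (hd x).hasDerivWithinAt) hb (convex_uIcc _ _) Set.left_mem_uIcc Set.right_mem_uIcc
  refine this.trans ?_
  simp
  rw [div_mul_eq_mul_div]
  refine div_le_div_of_nonneg_right ?_ (by positivity)
  nlinarith [abs_nonneg u]

lemma Bf_lip (t u : ℝ) : ‖Bf (t+u) - Bf t‖ ≤ 60 * (1 + |u|)^2 / (1 + |t|) := by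
  have h1 := Bf_err t
  have h2 := Bf_err (t+u)
  have h3 := logw_lip t u
  have h4 : 20 / (1 + |t+u|) ≤ 20 * (1+|u|)/(1+|t|) := by
    rw [div_le_div_iff₀ (by positivity) (by positivity)]
    have := abs_sub_abs_le_abs_sub t (-u)
    rw [abs_neg, sub_neg_eq_add] at this
    nlinarith [abs_nonneg u, abs_nonneg (t+u)]
  set P := Bf (t+u)
  set Q := Bf t
  set a := Complex.log (11/4 + (t+u:ℝ)/2 * cI)
  set b := Complex.log (11/4 + t/2 * cI)
  set k := 1/2 * (rlog rpi : ℂ)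
  have e : P - Q = (P - (1/2 * a - k)) - (Q - (1/2 * b - k)) + 1/2 * (a - b) := by ring
  rw [e]
  have n1 := norm_add_le ((P - (1/2 * a - k)) - (Q - (1/2 * b - k))) (1/2 * (a - b))
  have n2 := norm_sub_le (P - (1/2 * a - k)) (Q - (1/2 * b - k))
  have n3 : ‖1/2 * (a-b)‖ = 1/2 * ‖a - b‖ := by rw [norm_mul]; simp
  have h5 : 20 * (1+|u|)/(1+|t|) ≤ 20 * (1+|u|)^2/(1+|t|) := by
    gcongr; nlinarith [abs_nonneg u]
  have h6 : 20/(1+|t|) ≤ 20 * (1+|u|)^2/(1+|t|) := by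
    gcongr; nlinarith [abs_nonneg u]
  have h7 : 60 * (1+|u|)^2/(1+|t|) = 60 * ((1+|u|)^2/(1+|t|)) := by ring
  have h8 : 20 * (1+|u|)^2/(1+|t|) = 20 * ((1+|u|)^2/(1+|t|)) := by ring
  have h10 : 2 * (1+|u|)^2/(1+|t|) = 2 * ((1+|u|)^2/(1+|t|)) := by ring
  have h9 : 0 ≤ (1+|u|)^2/(1+|t|) := by positivity
  linarith

lemma Bf_size (t : ℝ) : ‖Bf t - (1/2 * rlog (1+|t|) : ℝ)‖ ≤ 30 := by
  have h1 := Bf_err t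
  have hp : 1 ≤ 1 + |t| := by linarith [abs_nonneg t]
  have h2 : 20 / (1+|t|) ≤ 20 := div_le_self (by norm_num) hp
  have h3 : ‖Complex.log (11/4 + t/2 * cI) - (rlog (1+|t|) : ℝ)‖ ≤ 3 + rpi := by
    refine (Complex.norm_le_abs_re_add_abs_im _).trans ?_
    simp only [Complex.sub_re, Complex.sub_im, Complex.ofReal_re, Complex.ofReal_im, sub_zero, Complex.log_im, Complex.log_re]
    have := Complex.abs_arg_le_pi (11/4 + t/2 * cI)
    refine add_le_add ?_ this
    have hw := w_ge t
    have hw2 := w_le t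
    rw [← Real.log_div (by linarith) (by linarith)]
    have l3 : rlog 3 ≤ 2 := by have := Real.log_le_sub_one_of_pos (show (0:ℝ)<3 by norm_num); linarith
    have l2 : rlog 4 ≤ 3 := by have := Real.log_le_sub_one_of_pos (show (0:ℝ)<4 by norm_num); linarith
    rw [abs_le]
    constructor
    · have : rlog (1/4) ≤ rlog (‖(11/4 + t/2 * cI : ℂ)‖/(1+|t|)) := by
        apply Real.log_le_log (by norm_num)
        rw [le_div_iff₀ (by linarith)]; linarith
      rw [one_div, Real.log_inv] at this; linarith
    · have : rlog (‖(11/4 + t/2 * cI : ℂ)‖/(1+|t|)) ≤ rlog 3 := by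
        apply Real.log_le_log
        · apply div_pos <;> linarith
        · rw [div_le_iff₀ (by linarith)]; exact hw2
      linarith
  have hpi := Real.pi_le_four
  have h4 : ‖1/2 * (rlog rpi : ℂ)‖ ≤ 3/2 := by
    rw [norm_mul, Complex.norm_real, Real.norm_eq_abs, abs_of_nonneg (Real.log_nonneg (by linarith [Real.pi_gt_three]))]
    have := Real.log_le_sub_one_of_pos Real.pi_pos
    simp; linarith
  set P := Bf t
  set a := Complex.log (11/4 + t/2 * cI)
  set k := 1/2 * (rlog rpi : ℂ)
  push_cast at *
  set c := (rlog (1+|t|) : ℂ)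
  have e : P - 1/2 * c = (P - (1/2 * a - k)) + 1/2 * (a - c) - k := by ring
  rw [e]
  have n1 := norm_sub_le ((P - (1/2 * a - k)) + 1/2 * (a - c)) k
  have n2 := norm_add_le (P - (1/2 * a - k)) (1/2 * (a - c))
  have n3 : ‖1/2 * (a-c)‖ = 1/2 * ‖a - c‖ := by rw [norm_mul]; simp
  linarith

lemma LL_bound : ∃ C : ℝ, 0 ≤ C ∧ ∀ τ : ℝ, ‖LSeries (fun n => (Λ n : ℂ)) (3/2 + τ * cI)‖ ≤ C := by
  have hsum : LSeriesSummable (fun n => (Λ n : ℂ)) (3/2 : ℝ) := 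
    ArithmeticFunction.LSeriesSummable_vonMangoldt (by simp; norm_num)
  refine ⟨∑' n, ‖LSeries.term (fun n => (Λ n : ℂ)) (3/2:ℝ) n‖, tsum_nonneg fun _ => norm_nonneg _, fun τ => ?_⟩
  refine tsum_of_norm_bounded hsum.norm.hasSum fun n => ?_
  rw [LSeries.norm_term_eq, LSeries.norm_term_eq, re32]
  simp

lemma logDeriv_growth : ∃ C : ℝ, ∀ τ : ℝ, ‖logDeriv xi (3/2 + τ * cI)‖ ≤ C * (1 + |τ|) := by
  obtain ⟨C, hC0, hC⟩ := LL_bound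
  refine ⟨C + 31, fun τ => ?_⟩
  have h1 := hC τ
  have h2 := Bf_size τ
  have hp : 1 ≤ 1 + |τ| := by linarith [abs_nonneg τ]
  have h3 : rlog (1+|τ|) ≤ |τ| := by have := Real.log_le_sub_one_of_pos (show 0 < 1+|τ| by linarith); linarith
  have h4 : ‖((1/2 * rlog (1+|τ|) : ℝ) : ℂ)‖ ≤ |τ| := by
    rw [Complex.norm_real, Real.norm_eq_abs, abs_of_nonneg (by have := Real.log_nonneg hp; linarith)]
    linarith [abs_nonneg τ]
  have e : logDeriv xi (3/2 + τ * cI) = (Bf τ - (1/2 * rlog (1+|τ|) : ℝ)) + ((1/2 * rlog (1+|τ|) : ℝ) : ℂ) - LSeries (fun n => (Λ n : ℂ)) (3/2 + τ * cI) := by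
    rw [Bf]; ring
  rw [e]
  have n1 := norm_sub_le ((Bf τ - (1/2 * rlog (1+|τ|) : ℝ)) + ((1/2 * rlog (1+|τ|) : ℝ) : ℂ)) (LSeries (fun n => (Λ n : ℂ)) (3/2 + τ * cI))
  have n2 := norm_add_le (Bf τ - (1/2 * rlog (1+|τ|) : ℝ)) ((1/2 * rlog (1+|τ|) : ℝ) : ℂ)
  nlinarith [abs_nonneg τ]

noncomputable def EE (l : ℝ) (w : ℂ) : ℂ := cexp (l * w + w^2/2)
noncomputable def gg (l : ℝ) : ℝ := rexp (-l^2/2) / rsq (2 * rpi)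
noncomputable def SS (l t : ℝ) : ℂ := ∑' ρ : ℂ, (mu ρ : ℂ) * EE l (ρ - (1/2 + t * cI))
noncomputable def pp (l t : ℝ) : ℂ :=
  ∑' n : ℕ, ((Λ n * gg (l - rlog n) : ℝ) : ℂ) * cexp (-(1/2 + t * cI) * rlog n)

lemma norm_EE (l : ℝ) (w : ℂ) : ‖EE l w‖ = rexp (l * w.re + w.re^2/2 - w.im^2/2) := by
  rw [EE, Complex.norm_exp]
  congr 1
  have : (w^2/2).re = w.re^2/2 - w.im^2/2 := by
    have : (w^2/2).re = (w^2).re/2 := by simp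
    rw [this, pow_two]; simp; ring
  rw [Complex.add_re, this, Complex.re_ofReal_mul]; ring

lemma EE_diff (l : ℝ) : Differentiable ℂ (EE l) := by unfold EE; fun_prop
lemma EE_cont (l : ℝ) : Continuous (EE l) := (EE_diff l).continuous

lemma poly4 (u : ℝ) : (1 + |u|)^4 * rexp (-u^2/2) ≤ rexp 8 := by
  have h1 : 1 + |u| ≤ rexp |u| := by linarith [Real.add_one_le_exp |u|]
  calc (1+|u|)^4 * rexp (-u^2/2) ≤ (rexp |u|)^4 * rexp (-u^2/2) := by gcongr
    _ = rexp (4 * |u| - u^2/2) := by rw [← Real.exp_nat_mul, ← Real.exp_add]; congr 1; push_cast; ring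
    _ ≤ _ := by
      apply Real.exp_le_exp.mpr
      rw [← sq_abs u]; nlinarith [sq_nonneg (|u| - 4)]

lemma poly2 (u : ℝ) : (1 + |u|)^2 * rexp (-u^2/2) ≤ rexp 4 * rexp (-(1/4) * u^2) := by
  have h1 : 1 + |u| ≤ rexp |u| := by linarith [Real.add_one_le_exp |u|]
  calc (1+|u|)^2 * rexp (-u^2/2) ≤ (rexp |u|)^2 * rexp (-u^2/2) := by gcongr
    _ = rexp (2 * |u| - u^2/2) := by rw [← Real.exp_nat_mul, ← Real.exp_add]; congr 1; push_cast; ring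
    _ ≤ rexp (4 + -(1/4) * u^2) := by
      apply Real.exp_le_exp.mpr
      rw [← sq_abs u]; nlinarith [sq_nonneg (|u| - 4)]
    _ = _ := Real.exp_add _ _

lemma EE_line (l u : ℝ) : ‖EE l (1 + u * cI)‖ = rexp (l + 1/2) * rexp (-u^2/2) := by
  rw [norm_EE, ← Real.exp_add]; congr 1; simp; ring

lemma EE_decay (l t : ℝ) : ∀ s : ℂ, -1/2 ≤ s.re → s.re ≤ 3/2 →
    ‖EE l (s - (1/2 + t * cI))‖ ≤ (rexp (|l| + 1/2) * rexp 8 * (1+|t|)^4) / (1+|s.im|)^4 := by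
  intro s h1 h2
  set a := s.re - 1/2
  set u := s.im - t
  have e1 : (s - (1/2 + t * cI)).re = a := by simp [a]
  have e2 : (s - (1/2 + t * cI)).im = u := by simp [u]
  rw [norm_EE, e1, e2, le_div_iff₀ (by positivity)]
  have h3 : rexp (l*a + a^2/2 - u^2/2) ≤ rexp (|l| + 1/2) * rexp (-u^2/2) := by
    rw [← Real.exp_add]; apply Real.exp_le_exp.mpr
    have ha : |a| ≤ 1 := by rw [abs_le]; constructor <;> simp only [a] <;> linarith
    have h4 : l * a ≤ |l| := by
      calc l*a ≤ |l*a| := le_abs_self _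
        _ = |l| * |a| := abs_mul _ _
        _ ≤ |l| := by nlinarith [abs_nonneg l]
    have : a^2 ≤ 1 := by rw [← sq_abs]; nlinarith [abs_nonneg a]
    linarith
  have h5 : 1 + |s.im| ≤ (1+|t|) * (1+|u|) := by
    have : |s.im| ≤ |t| + |u| := by
      have := abs_add_le t u; simpa [u] using this
    nlinarith [abs_nonneg t, abs_nonneg u]
  calc _ ≤ (rexp (|l| + 1/2) * rexp (-u^2/2)) * ((1+|t|) * (1+|u|))^4 := by gcongr
    _ = rexp (|l| + 1/2) * (1+|t|)^4 * ((1+|u|)^4 * rexp (-u^2/2)) := by ring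
    _ ≤ rexp (|l| + 1/2) * (1+|t|)^4 * rexp 8 := by gcongr; exact poly4 u
    _ = _ := by ring

noncomputable def RR (l t : ℝ) : ℂ :=
  (1 / (2 * rpi)) * ∫ τ : ℝ, logDeriv xi (3/2 + τ * cI) * EE l (1 + (τ - t) * cI)

lemma SS_RR (l t : ℝ) : SS l t = RR l t + RR (-l) (-t) := by
  obtain ⟨C, hC⟩ := logDeriv_growth
  have := explicit_formula (H := fun s => EE l (s - (1/2 + t * cI)))
    ((EE_diff l).comp (by fun_prop)) (by positivity) (EE_decay l t) hC
  rw [SS, this, RR, RR, mul_add]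
  congr 3
  · ext τ; congr 2; push_cast; ring
  · ext τ; congr 1; unfold EE; congr 1; push_cast; ring

lemma gauss_int (l t x : ℝ) : (1 / (2 * rpi)) * ∫ u : ℝ, cexp (-(3/2 + (t+u:ℝ) * cI) * x) * EE l (1 + u * cI)
    = gg (l - x) * cexp (-(1/2 + t * cI) * x) := by
  have h1 : ∀ u : ℝ, cexp (-(3/2 + (t+u:ℝ) * cI) * x) * EE l (1 + u * cI) =
      cexp ((-1/2) * (u:ℂ)^2 + ((l+1-x) * cI) * u + (-(3/2 + t * cI) * x + l + 1/2)) := by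
    intro u
    rw [EE, ← Complex.exp_add]; congr 1
    push_cast
    linear_combination (1/2 * (u:ℂ)^2) * Complex.I_sq
  simp_rw [h1]
  rw [integral_cexp_quadratic (by norm_num)]
  have h2 : (-(3/2 + t * cI) * x + l + 1/2 : ℂ) - ((l+1-x) * cI)^2/(4 * (-1/2)) = (-(l-x)^2/2 : ℝ) + (-(1/2 + t * cI) * x) := by
    push_cast
    linear_combination (1/2 * (l+1-x:ℂ)^2) * Complex.I_sq
  rw [h2, Complex.exp_add, gg]
  have h3 : ((rpi:ℂ) / -(-1/2)) ^ (1/2 : ℂ) = (rsq (2 * rpi) : ℝ) := by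
    rw [Real.sqrt_eq_rpow, Complex.ofReal_cpow (by positivity)]
    congr 1
    · push_cast; ring
    · push_cast; rfl
  rw [h3]
  have h4 : (rsq (2*rpi) : ℂ) ≠ 0 := by
    exact_mod_cast (Real.sqrt_pos.mpr (by positivity : (0:ℝ) < 2 * rpi)).ne'
  have h5 : (rsq (2*rpi) : ℂ) * (rsq (2*rpi) : ℂ) = 2 * rpi := by
    rw [← Complex.ofReal_mul, Real.mul_self_sqrt (by positivity)]; push_cast; ring
  push_cast
  rw [← h5]
  field_simp

lemma gint : Integrable (fun u : ℝ => rexp (-(1/4) * u^2)) := integrable_exp_neg_mul_sq (by norm_num)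

lemma int_Bf (l t : ℝ) : Integrable (fun u : ℝ => (Bf (t+u) - Bf t) * EE l (1 + u * cI)) ∧
    ‖∫ u : ℝ, (Bf (t+u) - Bf t) * EE l (1 + u * cI)‖ ≤
      (60 * rexp 5 * ∫ u : ℝ, rexp (-(1/4) * u^2)) * rexp l / (1+|t|) := by
  have hb : ∀ u : ℝ, ‖(Bf (t+u) - Bf t) * EE l (1 + u * cI)‖ ≤ (60 * rexp 5 * rexp l / (1+|t|)) * rexp (-(1/4) * u^2) := by
    intro u
    rw [norm_mul, EE_line]
    calc _ ≤ (60 * (1 + |u|)^2 / (1 + |t|)) * (rexp (l+1/2) * rexp (-u^2/2)) := by gcongr; exact Bf_lip t u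
      _ = (60 * rexp (l+1/2) / (1+|t|)) * ((1+|u|)^2 * rexp (-u^2/2)) := by ring
      _ ≤ (60 * rexp (l+1/2) / (1+|t|)) * (rexp 4 * rexp (-(1/4) * u^2)) :=
          mul_le_mul_of_nonneg_left (poly2 u) (by positivity)
      _ = (60 * rexp (4 + (l+1/2)) / (1+|t|)) * rexp (-(1/4) * u^2) := by rw [Real.exp_add 4]; ring
      _ ≤ (60 * rexp (5 + l) / (1+|t|)) * rexp (-(1/4) * u^2) := by
          have : rexp (4 + (l+1/2)) ≤ rexp (5 + l) := Real.exp_le_exp.mpr (by linarith)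
          gcongr ?_ / _ * _
          linarith
      _ = _ := by rw [Real.exp_add 5]; ring
  have hi := gint.const_mul (60 * rexp 5 * rexp l / (1+|t|))
  refine ⟨?_, ?_⟩
  · refine hi.mono' ?_ (Eventually.of_forall hb)
    have h1 := Bf_cont
    have h2 := EE_cont l
    exact Continuous.aestronglyMeasurable (by fun_prop)
  · refine (norm_integral_le_of_norm_le hi (Eventually.of_forall hb)).trans (le_of_eq ?_)
    rw [integral_const_mul]; ring

lemma int_EE (l : ℝ) : Integrable (fun u : ℝ => EE l (1 + u * cI)) := by
  have hi : Integrable (fun u : ℝ => rexp (l+1/2) * rexp (-(1/2) * u^2)) := (integrable_exp_neg_mul_sq (by norm_num)).const_mul _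
  refine hi.mono' ?_ (Eventually.of_forall fun u => ?_)
  · have h2 := EE_cont l
    exact Continuous.aestronglyMeasurable (by fun_prop)
  · rw [EE_line]; apply le_of_eq; congr 2; ring

lemma term_eq (s : ℂ) (n : ℕ) : LSeries.term (fun n => (Λ n : ℂ)) s n = (Λ n : ℂ) * cexp (-s * rlog n) := by
  rcases Nat.eq_zero_or_pos n with rfl | hn
  · simp
  · rw [LSeries.term_of_ne_zero hn.ne', Complex.cpow_def_of_ne_zero (by exact_mod_cast hn.ne'), div_eq_mul_inv, ← Complex.exp_neg]
    congr 2
    rw [Complex.ofReal_log (Nat.cast_nonneg n)]; push_cast; ring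

lemma int_prime (l t : ℝ) :
    Integrable (fun u : ℝ => LSeries (fun n => (Λ n : ℂ)) (3/2 + (t+u:ℝ) * cI) * EE l (1 + u * cI)) ∧
    HasSum (fun n : ℕ => ((Λ n * gg (l - rlog n) : ℝ) : ℂ) * cexp (-(1/2 + t * cI) * rlog n))
    ((1 / (2 * rpi)) * ∫ u : ℝ, LSeries (fun n => (Λ n : ℂ)) (3/2 + (t+u:ℝ) * cI) * EE l (1 + u * cI)) := by
  have hsum : LSeriesSummable (fun n => (Λ n : ℂ)) (3/2 : ℝ) :=
    ArithmeticFunction.LSeriesSummable_vonMangoldt (by simp; norm_num)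
  set b : ℕ → ℝ := fun n => ‖LSeries.term (fun n => (Λ n : ℂ)) (3/2:ℝ) n‖ with hb
  have hsb : Summable b := hsum.norm
  set F : ℕ → ℝ → ℂ := fun n u => LSeries.term (fun n => (Λ n : ℂ)) (3/2 + (t+u:ℝ) * cI) n * EE l (1 + u * cI) with hF
  have hn : ∀ n u, ‖F n u‖ = b n * ‖EE l (1 + u * cI)‖ := by
    intro n u
    simp only [hF, hb]
    rw [norm_mul, LSeries.norm_term_eq, LSeries.norm_term_eq, re32]
    simp
  have hE := int_EE l
  have hFi : ∀ n, Integrable (F n) := by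
    intro n
    refine (hE.norm.const_mul (b n)).mono' ?_ (Eventually.of_forall fun u => (hn n u).le)
    have h2 := EE_cont l
    simp only [hF, term_eq]
    exact Continuous.aestronglyMeasurable (by fun_prop)
  have hFs : Summable fun n => ∫ u, ‖F n u‖ := by
    simp_rw [hn, integral_const_mul]
    exact hsb.mul_right _
  have h1 := hasSum_integral_of_summable_integral_norm hFi hFs
  have h2 : ∀ u : ℝ, ∑' n, F n u = LSeries (fun n => (Λ n : ℂ)) (3/2 + (t+u:ℝ) * cI) * EE l (1 + u * cI) := by
    intro u; simp only [hF]; rw [tsum_mul_right]; rfl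
  simp_rw [h2] at h1
  refine ⟨?_, ?_⟩
  · obtain ⟨C, hC0, hC⟩ := LL_bound
    refine (hE.norm.const_mul C).mono' ?_ (Eventually.of_forall fun u => ?_)
    · have h3 := EE_cont l
      have h4 : Continuous fun τ : ℝ => LSeries (fun n => (Λ n : ℂ)) (3/2 + τ * cI) := by
        have := Bf_cont.sub logDeriv_cont
        refine this.congr fun τ => ?_
        simp only [Bf, Pi.sub_apply, add_sub_cancel_left]
      have h5 : Continuous fun u : ℝ => LSeries (fun n => (Λ n : ℂ)) (3/2 + (t+u:ℝ) * cI) := h4.comp (by fun_prop)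
      exact Continuous.aestronglyMeasurable (h5.mul (by fun_prop))
    · rw [norm_mul]; gcongr; exact hC _
  · have h4 : ∀ n : ℕ, ((Λ n * gg (l - rlog n) : ℝ) : ℂ) * cexp (-(1/2 + t * cI) * rlog n) = (1 / (2 * rpi) : ℂ) * ∫ a, F n a := by
      intro n
      have h3 := gauss_int l t (rlog n)
      simp only [hF, term_eq, mul_assoc]
      rw [integral_const_mul]
      rw [mul_left_comm, h3]
      push_cast; ring
    simp_rw [h4]
    exact h1.mul_left _

lemma RR_eval : ∃ C : ℝ, 0 ≤ C ∧ ∀ l t : ℝ, ‖RR l t - (gg l * Bf t - pp l t)‖ ≤ C * rexp l / (1+|t|) := by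
  refine ⟨(60 * rexp 5 * ∫ u : ℝ, rexp (-(1/4) * u^2)), ?_, fun l t => ?_⟩
  · have : 0 ≤ ∫ u : ℝ, rexp (-(1/4) * u^2) := integral_nonneg fun u => (Real.exp_pos _).le
    positivity
  obtain ⟨i1, h1⟩ := int_Bf l t
  obtain ⟨i2, h2⟩ := int_prime l t
  have i3 := int_EE l
  have e1 : ∫ τ : ℝ, logDeriv xi (3/2 + τ * cI) * EE l (1 + (τ - t) * cI)
      = ∫ u : ℝ, logDeriv xi (3/2 + (t+u:ℝ) * cI) * EE l (1 + u * cI) := by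
    rw [← integral_add_left_eq_self _ t]
    congr 1; ext u; congr 2; push_cast; ring
  have e2 : ∀ u : ℝ, logDeriv xi (3/2 + (t+u:ℝ) * cI) * EE l (1 + u * cI)
      = (Bf (t+u) - Bf t) * EE l (1 + u * cI) + Bf t * EE l (1 + u * cI) -
        LSeries (fun n => (Λ n : ℂ)) (3/2 + (t+u:ℝ) * cI) * EE l (1 + u * cI) := by
    intro u; simp only [Bf]; ring
  have g0 := gauss_int l t 0
  simp only [Complex.ofReal_zero, mul_zero, Complex.exp_zero, one_mul, sub_zero, mul_one] at g0
  have e3 : RR l t - (gg l * Bf t - pp l t) = (1 / (2 * rpi)) * ∫ u : ℝ, (Bf (t+u) - Bf t) * EE l (1 + u * cI) := by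
    rw [RR, e1]
    simp_rw [e2]
    rw [integral_sub (Integrable.fun_add i1 (i3.const_mul (Bf t))) i2, integral_add i1 (i3.const_mul (Bf t)), integral_const_mul, pp, h2.tsum_eq, ← g0]
    ring
  rw [e3, norm_mul]
  have : ‖(1 / (2 * rpi) : ℂ)‖ ≤ 1 := by
    rw [norm_div, norm_one, norm_mul, Complex.norm_real, Real.norm_eq_abs, abs_of_pos Real.pi_pos]
    rw [div_le_one (by simp; positivity)]
    simp; linarith [Real.pi_gt_three]
  calc _ ≤ 1 * _ := mul_le_mul_of_nonneg_right this (norm_nonneg _)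
    _ ≤ _ := by rw [one_mul]; exact h1

lemma gg_pos (l : ℝ) : 0 < gg l := by unfold gg; positivity
lemma gg_even (l : ℝ) : gg (-l) = gg l := by unfold gg; simp

lemma gg_le_one (l : ℝ) : gg l ≤ 1 := by
  unfold gg
  rw [div_le_one (by positivity)]
  calc rexp (-l^2/2) ≤ 1 := Real.exp_le_one_iff.mpr (by nlinarith [sq_nonneg l])
    _ ≤ _ := by rw [Real.le_sqrt (by norm_num) (by positivity)]; linarith [Real.pi_gt_three]

lemma pp_term_norm (l t : ℝ) (n : ℕ) : ‖((Λ n * gg (l - rlog n) : ℝ) : ℂ) * cexp (-(1/2 + t * cI) * rlog n)‖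
    = Λ n * gg (l - rlog n) * rexp (-(1/2) * rlog n) := by
  rw [norm_mul, Complex.norm_real, Complex.norm_exp, Real.norm_eq_abs, abs_of_nonneg (mul_nonneg ArithmeticFunction.vonMangoldt_nonneg (gg_pos _).le)]
  congr 2
  have : (-(1/2 + t * cI) * (rlog n : ℂ)).re = (-(1/2 + t * cI)).re * rlog n := Complex.re_mul_ofReal _ _
  rw [this]; simp

lemma pp_summable (l : ℝ) : Summable fun n : ℕ => Λ n * gg (l - rlog n) * rexp (-(1/2) * rlog n) := by
  have := (int_prime l 0).2.summable.norm
  refine this.congr fun n => pp_term_norm l 0 n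

/-- bound for the small prime sum -/
lemma pp_neg_bound : ∃ C : ℝ, 0 ≤ C ∧ ∀ l t : ℝ, 0 ≤ l → ‖pp (-l) t‖ ≤ C * gg l := by
  have hs := (pp_summable 0).mul_left (rsq (2 * rpi))
  refine ⟨∑' n : ℕ, rsq (2 * rpi) * (Λ n * gg (0 - rlog n) * rexp (-(1/2) * rlog n)), tsum_nonneg fun n => ?_, fun l t hl => ?_⟩
  rotate_left 1
  · rw [← tsum_mul_right (a := gg l)]
    refine tsum_of_norm_bounded (hs.mul_right (gg l)).hasSum fun n => ?_
    rw [pp_term_norm]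
    have h1 : gg (-l - rlog n) ≤ rsq (2 * rpi) * gg (0 - rlog n) * gg l := by
      unfold gg
      have hp : 0 < rsq (2 * rpi) := by positivity
      rw [show rsq (2 * rpi) * (rexp (-(0 - rlog n)^2/2) / rsq (2 * rpi)) * (rexp (-l^2/2) / rsq (2 * rpi)) = (rexp (-(0 - rlog n)^2/2) * rexp (-l^2/2)) / rsq (2 * rpi) by field_simp]
      rw [← Real.exp_add]
      have : 0 ≤ rlog n := Real.log_natCast_nonneg n
      gcongr
      nlinarith [mul_nonneg hl this]
    have h2 : 0 ≤ Λ n * rexp (-(1/2) * rlog n) := mul_nonneg ArithmeticFunction.vonMangoldt_nonneg (Real.exp_pos _).le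
    calc _ = (Λ n * rexp (-(1/2) * rlog n)) * gg (-l - rlog n) := by ring
      _ ≤ (Λ n * rexp (-(1/2) * rlog n)) * (rsq (2 * rpi) * gg (0 - rlog n) * gg l) := by gcongr
      _ = _ := by ring
  · have := gg_pos (0 - rlog n)
    have h2 : 0 ≤ Λ n := ArithmeticFunction.vonMangoldt_nonneg
    positivity

/-- Main evaluation of `SS`. -/
lemma SS_eval : ∃ C : ℝ, 0 ≤ C ∧ ∀ l t : ℝ, 0 ≤ l →
    ‖SS l t - ((gg l * rlog (1+|t|) : ℝ) - pp l t)‖ ≤ C * gg l + C * rexp l / (1+|t|) := by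
  obtain ⟨C1, hC1, h1⟩ := RR_eval
  obtain ⟨C2, hC2, h2⟩ := pp_neg_bound
  refine ⟨2 * C1 + C2 + 60, by positivity, fun l t hl => ?_⟩
  have a1 := h1 l t
  have a2 := h1 (-l) (-t)
  have a3 := h2 l (-t) hl
  have b1 := Bf_size t
  have b2 := Bf_size (-t)
  rw [abs_neg] at a2 b2
  rw [gg_even] at a2
  have hg := gg_pos l
  have e : SS l t - ((gg l * rlog (1+|t|) : ℝ) - pp l t) = (RR l t - (gg l * Bf t - pp l t)) + (RR (-l) (-t) - (gg l * Bf (-t) - pp (-l) (-t)))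
      + gg l * (Bf t - (1/2 * rlog (1+|t|) : ℝ)) + gg l * (Bf (-t) - (1/2 * rlog (1+|t|) : ℝ)) - pp (-l) (-t) := by
    rw [SS_RR]; push_cast; ring
  have a4 : C1 * rexp (-l) / (1+|t|) ≤ C1 * rexp l / (1+|t|) := by
    gcongr; linarith
  have m1 : ∀ z : ℂ, ‖z‖ ≤ 30 → ‖(gg l : ℂ) * z‖ ≤ 30 * gg l := by
    intro z hz
    rw [norm_mul, Complex.norm_real, Real.norm_eq_abs, abs_of_pos hg]; nlinarith
  have c1 := m1 _ b1
  have c2 := m1 _ b2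
  have hE : 0 ≤ rexp l / (1+|t|) := by positivity
  rw [e]
  refine (norm_sub_le _ _).trans ?_
  refine (add_le_add_left (norm_add_le _ _) _).trans ?_
  refine (add_le_add_left (add_le_add_left (norm_add_le _ _) _) _).trans ?_
  refine (add_le_add_left (add_le_add_left (add_le_add_left (norm_add_le _ _) _) _) _).trans ?_
  have q1 : C1 * rexp l / (1+|t|) = C1 * (rexp l / (1+|t|)) := by ring
  have q2 : (2 * C1 + C2 + 60) * rexp l / (1+|t|) = (2 * C1 + C2 + 60) * (rexp l / (1+|t|)) := by ring
  rw [q2]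
  nlinarith [mul_nonneg hC2 hE, mul_nonneg hC1 hg.le]

lemma SS_neg (l t : ℝ) : SS (-l) t = SS l (-t) := by
  rw [SS_RR, SS_RR, neg_neg, add_comm]; simp

lemma gsum : ∃ K : ℝ, 0 ≤ K ∧ ∀ t : ℝ, Summable (fun ρ : ℂ => (mu ρ : ℝ) * rexp (-(ρ.im - t)^2/4)) ∧
    ∑' ρ : ℂ, (mu ρ : ℝ) * rexp (-(ρ.im - t)^2/4) ≤ K * (1+|t|)^3 := by
  have hs := mu_summable
  refine ⟨rexp 9 * ∑' ρ : ℂ, (mu ρ:ℝ)/(1+|ρ.im|)^3, ?_, fun t => ?_⟩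
  · exact mul_nonneg (Real.exp_pos _).le (tsum_nonneg fun ρ => by positivity)
  have hb : ∀ ρ : ℂ, (mu ρ : ℝ) * rexp (-(ρ.im - t)^2/4) ≤ (rexp 9 * (1+|t|)^3) * ((mu ρ:ℝ)/(1+|ρ.im|)^3) := by
    intro ρ
    set u := ρ.im - t
    have h1 : 1 + |u| ≤ rexp |u| := by linarith [Real.add_one_le_exp |u|]
    have h2 : (1+|u|)^3 * rexp (-u^2/4) ≤ rexp 9 := by
      calc _ ≤ (rexp |u|)^3 * rexp (-u^2/4) := by gcongr
        _ = rexp (3 * |u| - u^2/4) := by rw [← Real.exp_nat_mul, ← Real.exp_add]; congr 1; push_cast; ring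
        _ ≤ _ := by
          apply Real.exp_le_exp.mpr
          rw [← sq_abs u]; nlinarith [sq_nonneg (|u| - 6)]
    have h5 : 1 + |ρ.im| ≤ (1+|t|) * (1+|u|) := by
      have : |ρ.im| ≤ |t| + |u| := by
        have := abs_add_le t u; simpa [u] using this
      nlinarith [abs_nonneg t, abs_nonneg u]
    have h6 : rexp (-u^2/4) ≤ (rexp 9 * (1+|t|)^3) / (1+|ρ.im|)^3 := by
      rw [le_div_iff₀ (by positivity)]
      calc _ ≤ rexp (-u^2/4) * ((1+|t|) * (1+|u|))^3 := by gcongr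
        _ = (1+|t|)^3 * ((1+|u|)^3 * rexp (-u^2/4)) := by ring
        _ ≤ (1+|t|)^3 * rexp 9 := by gcongr
        _ = _ := by ring
    calc _ ≤ (mu ρ : ℝ) * ((rexp 9 * (1+|t|)^3) / (1+|ρ.im|)^3) := by gcongr
      _ = _ := by ring
  have hs2 := hs.mul_left (rexp 9 * (1+|t|)^3)
  have hsum := hs2.of_nonneg_of_le (fun ρ => by positivity) hb
  refine ⟨hsum, ?_⟩
  refine (hsum.tsum_le_tsum hb hs2).trans (le_of_eq ?_)
  rw [tsum_mul_left]; ring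

lemma band_finite (T : ℝ) : (zeroBand T).Finite := by
  refine (zeros_finite 0 (1 + 2 * |T|)).subset ?_
  rintro ρ ⟨h1, h2, h3⟩
  refine ⟨xi_zero_iff.mpr h1, ?_⟩
  rw [sub_zero]
  have hT : 0 ≤ T := by linarith
  refine (Complex.norm_le_abs_re_add_abs_im _).trans ?_
  rw [abs_of_pos h1.2.1, abs_of_pos (by linarith), abs_of_nonneg hT]
  linarith [h1.2.2]

noncomputable def bd (T : ℝ) : Finset ℂ := (band_finite T).toFinset
lemma mem_bd {T : ℝ} {ρ : ℂ} : ρ ∈ bd T ↔ ρ ∈ zeroBand T := by simp [bd]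
noncomputable def NN (T : ℝ) : ℝ := ∑ ρ ∈ bd T, (mu ρ : ℝ)
noncomputable def Sloc (T l t : ℝ) : ℂ := ∑ ρ ∈ bd T, (mu ρ : ℂ) * EE l (ρ - (1/2 + t * cI))

def Box (T : ℝ) : Prop := (∀ ρ, IsNontrivialZero ρ → T/2 < ρ.im → ρ.im ≤ 4 * T → |ρ.re - 1/2| ≤ 0.001 / rlog T) ∧
  ∀ ρ ∈ bd T, |ρ.re - 1/2| ≤ 0.001 / (2 * rlog T)

lemma box_ev (hbox : ∀ᶠ T in atTop, ∀ ρ ∈ zeroBand T, |ρ.re - 1/2| < 0.001 / (2 * rlog T)) :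
    ∀ᶠ T in atTop, Box T := by
  obtain ⟨T0, h0⟩ := eventually_atTop.mp hbox
  filter_upwards [eventually_ge_atTop (2 * T0), eventually_ge_atTop T0, eventually_ge_atTop 4] with T h1 h2 h3
  have hl : rlog T / 2 ≤ rlog (T/2) := by
    rw [← Real.log_sqrt (by linarith)]
    apply Real.log_le_log (by positivity)
    rw [Real.sqrt_le_left (by linarith)]
    nlinarith
  have hL : 0 < rlog T := Real.log_pos (by linarith)
  have hmono : ∀ T' ρ, T/2 ≤ T' → ρ ∈ zeroBand T' → |ρ.re - 1/2| ≤ 0.001 / rlog T := by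
    intro T' ρ hT' hρ
    refine (h0 T' (by linarith) ρ hρ).le.trans ?_
    have : rlog (T/2) ≤ rlog T' := Real.log_le_log (by linarith) hT'
    gcongr; linarith
  refine ⟨fun ρ hρ h4 h5 => ?_, fun ρ hρ => (h0 T h2 ρ (mem_bd.mp hρ)).le⟩
  rcases le_or_gt ρ.im T with h6 | h6
  · exact hmono (T/2) ρ le_rfl ⟨hρ, h4, by linarith⟩
  rcases le_or_gt ρ.im (2*T) with h7 | h7
  · exact hmono T ρ (by linarith) ⟨hρ, h6, by linarith⟩
  · exact hmono (2*T) ρ (by linarith) ⟨hρ, h7, by linarith⟩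

lemma tiny (K : ℝ) : ∀ᶠ T : ℝ in atTop, K * rexp (20 * rlog T - (rlog T)^2/4) ≤ 1 / T := by
  filter_upwards [Real.tendsto_log_atTop.eventually_ge_atTop 100, Real.tendsto_log_atTop.eventually_ge_atTop K, eventually_gt_atTop 0] with T h1 h2 h3
  have h4 : K ≤ rexp (rlog T) := by linarith [Real.add_one_le_exp (rlog T)]
  have h5 : 1 / T = rexp (-rlog T) := by rw [Real.exp_neg, Real.exp_log h3, one_div]
  calc _ ≤ rexp (rlog T) * rexp (20 * rlog T - (rlog T)^2/4) := by gcongr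
    _ = rexp (rlog T + (20 * rlog T - (rlog T)^2/4)) := by rw [Real.exp_add]
    _ ≤ _ := by rw [h5]; apply Real.exp_le_exp.mpr; nlinarith

lemma half_quarter {u L : ℝ} (hL : 0 ≤ L) (h : L ≤ |u|) : rexp (-u^2/2) ≤ rexp (-L^2/4) * rexp (-u^2/4) := by
  rw [← Real.exp_add]; apply Real.exp_le_exp.mpr
  rw [← sq_abs u]; nlinarith

lemma sub_re_im (ρ : ℂ) (t : ℝ) : (ρ - (1/2 + t * cI)).re = ρ.re - 1/2 ∧ (ρ - (1/2 + t * cI)).im = ρ.im - t := by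
  constructor <;> simp

lemma SS_summable (l t : ℝ) : Summable fun ρ : ℂ => (mu ρ : ℂ) * EE l (ρ - (1/2 + t * cI)) := by
  obtain ⟨K, hK, h⟩ := gsum
  refine Summable.of_norm_bounded (((h t).1).mul_left (rexp (|l|/2 + 1/8))) fun ρ => ?_
  rcases Nat.eq_zero_or_pos (mu ρ) with h0 | h0
  · simp [h0]
  have hz := mu_pos_iff.mp h0
  obtain ⟨e1, e2⟩ := sub_re_im ρ t
  rw [norm_mul, norm_EE, e1, e2, Complex.norm_natCast]
  have hv : |ρ.re - 1/2| ≤ 1/2 := by rw [abs_le]; constructor <;> linarith [hz.2.1, hz.2.2]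
  have : rexp (l * (ρ.re - 1/2) + (ρ.re - 1/2)^2/2 - (ρ.im - t)^2/2) ≤ rexp (|l|/2 + 1/8) * rexp (-(ρ.im - t)^2/4) := by
    rw [← Real.exp_add]; apply Real.exp_le_exp.mpr
    have h1 : l * (ρ.re - 1/2) ≤ |l| * |ρ.re - 1/2| := by rw [← abs_mul]; exact le_abs_self _
    have h2 : (ρ.re - 1/2)^2 ≤ 1/4 := by rw [← sq_abs]; nlinarith [abs_nonneg (ρ.re - 1/2)]
    nlinarith [abs_nonneg l, sq_nonneg (ρ.im - t)]
  calc _ ≤ (mu ρ : ℝ) * (rexp (|l|/2 + 1/8) * rexp (-(ρ.im - t)^2/4)) := by gcongr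
    _ = _ := by ring

lemma EE_tail {l t L : ℝ} (hL : 0 ≤ L) {ρ : ℂ} (hz : IsNontrivialZero ρ) (hu : L ≤ |ρ.im - t|) :
    ‖EE l (ρ - (1/2 + t * cI))‖ ≤ rexp (|l|/2 + 1/8 - L^2/4) * rexp (-(ρ.im - t)^2/4) := by
  obtain ⟨e1, e2⟩ := sub_re_im ρ t
  rw [norm_EE, e1, e2]
  have hv : |ρ.re - 1/2| ≤ 1/2 := by rw [abs_le]; constructor <;> linarith [hz.2.1, hz.2.2]
  rw [← Real.exp_add]; apply Real.exp_le_exp.mpr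
  have h1 : l * (ρ.re - 1/2) ≤ |l| * |ρ.re - 1/2| := by rw [← abs_mul]; exact le_abs_self _
  have h2 : (ρ.re - 1/2)^2 ≤ 1/4 := by rw [← sq_abs]; nlinarith [abs_nonneg (ρ.re - 1/2)]
  have h3 : L^2 ≤ (ρ.im - t)^2 := by rw [← sq_abs (ρ.im - t)]; gcongr
  nlinarith [abs_nonneg l]

lemma mid_close : ∀ᶠ T : ℝ in atTop, ∀ l t : ℝ, |l| ≤ rlog T → T + rlog T ≤ t → t ≤ 2 * T - rlog T →
    ‖SS l t - Sloc T l t‖ ≤ 1 / T := by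
  obtain ⟨K, hK, h⟩ := gsum
  filter_upwards [tiny (27 * K * rexp (1/8)), eventually_ge_atTop 3] with T h1 h2 l t hl ht1 ht2
  have hL : 0 < rlog T := Real.log_pos (by linarith)
  refine le_trans ?_ h1
  set c := rexp (|l|/2 + 1/8 - (rlog T)^2/4)
  have e1 : SS l t - Sloc T l t = ∑' ρ : ℂ, ((mu ρ : ℂ) * EE l (ρ - (1/2 + t * cI)) - (if ρ ∈ bd T then (mu ρ : ℂ) * EE l (ρ - (1/2 + t * cI)) else 0)) := by
    rw [(SS_summable l t).tsum_sub (summable_of_hasFiniteSupport ?_)]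
    · congr 1
      rw [tsum_eq_sum (s := bd T)]
      · exact Finset.sum_congr rfl fun ρ hρ => by simp [hρ]
      · intro ρ hρ; simp [hρ]
    · refine (bd T).finite_toSet.subset fun ρ hρ => ?_
      by_contra hc
      have : ρ ∉ bd T := hc
      simp [this] at hρ
  rw [e1]
  have hb : ‖∑' ρ : ℂ, ((mu ρ : ℂ) * EE l (ρ - (1/2 + t * cI)) - (if ρ ∈ bd T then (mu ρ : ℂ) * EE l (ρ - (1/2 + t * cI)) else 0))‖
      ≤ c * ∑' ρ : ℂ, (mu ρ : ℝ) * rexp (-(ρ.im - t)^2/4) := by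
    refine tsum_of_norm_bounded ((h t).1.hasSum.mul_left c) fun ρ => ?_
    split_ifs with hρ
    · simp; positivity
    rw [sub_zero, norm_mul, Complex.norm_natCast]
    rcases Nat.eq_zero_or_pos (mu ρ) with h0 | h0
    · simp [h0]
    have hz := mu_pos_iff.mp h0
    have hu : rlog T ≤ |ρ.im - t| := by
      by_contra hc
      push Not at hc
      rw [abs_lt] at hc
      exact hρ (mem_bd.mpr ⟨hz, by linarith, by linarith⟩)
    have := EE_tail (l := l) hL.le hz hu
    calc _ ≤ (mu ρ : ℝ) * (c * rexp (-(ρ.im - t)^2/4)) := by gcongr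
      _ = _ := by ring
  refine hb.trans ?_
  have h3 := (h t).2
  have ht : |t| ≤ 2 * T := by rw [abs_of_nonneg (by linarith)]; linarith
  calc _ ≤ c * (K * (1 + 2*T)^3) := by
        apply mul_le_mul_of_nonneg_left _ (Real.exp_pos _).le
        refine h3.trans ?_
        gcongr
    _ ≤ c * (K * (3*T)^3) := by gcongr; linarith
    _ = (27 * K) * (T^3 * c) := by ring
    _ = (27 * K) * (rexp (3 * rlog T + (|l|/2 + 1/8 - (rlog T)^2/4))) := by
        rw [Real.exp_add, show 3 * rlog T = (3:ℕ) * rlog T by norm_num, Real.exp_nat_mul, Real.exp_log (by linarith)]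
    _ ≤ (27 * K) * (rexp (1/8 + (20 * rlog T - (rlog T)^2/4))) := by
        gcongr ?_ * ?_
        apply Real.exp_le_exp.mpr
        linarith
    _ = _ := by rw [Real.exp_add]; ring

lemma SS0 : ∃ C : ℝ, 0 ≤ C ∧ ∀ t : ℝ, ‖SS 0 t - (gg 0 * rlog (1+|t|) : ℝ)‖ ≤ C := by
  obtain ⟨C1, hC1, h1⟩ := SS_eval
  obtain ⟨C2, hC2, h2⟩ := pp_neg_bound
  refine ⟨2 * C1 + C2, by positivity, fun t => ?_⟩
  have a1 := h1 0 t le_rfl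
  have a2 := h2 0 t le_rfl
  rw [neg_zero] at a2
  have g1 := gg_le_one 0
  have e : SS 0 t - (gg 0 * rlog (1+|t|) : ℝ) = (SS 0 t - ((gg 0 * rlog (1+|t|) : ℝ) - pp 0 t)) - pp 0 t := by ring
  rw [e]
  refine (norm_sub_le _ _).trans ?_
  have : C1 * rexp 0 / (1+|t|) ≤ C1 := by
    rw [Real.exp_zero, mul_one]; exact div_le_self hC1 (by linarith [abs_nonneg t])
  nlinarith [gg_pos 0]

lemma W_sum (t : ℝ) : Summable (fun ρ : ℂ => (mu ρ : ℝ) * rexp (-(ρ.im - t)^2/2)) := by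
  obtain ⟨K, hK, h⟩ := gsum
  refine (h t).1.of_nonneg_of_le (fun ρ => by positivity) fun ρ => ?_
  gcongr ?_ * ?_
  apply Real.exp_le_exp.mpr
  nlinarith [sq_nonneg (ρ.im - t)]

lemma re_EE0 (w : ℂ) : (EE 0 w).re = rexp (w.re^2/2 - w.im^2/2) * Real.cos (w.re * w.im) := by
  rw [EE, Complex.exp_re]
  have h1 : ((0:ℝ) * w + w^2/2 : ℂ).re = w.re^2/2 - w.im^2/2 := by
    have : ((0:ℝ) * w + w^2/2 : ℂ).re = (w^2).re/2 := by simp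
    rw [this, pow_two]; simp; ring
  have h2 : ((0:ℝ) * w + w^2/2 : ℂ).im = w.re * w.im := by
    have : ((0:ℝ) * w + w^2/2 : ℂ).im = (w^2).im/2 := by simp
    rw [this, pow_two]; simp; ring
  rw [h1, h2]

lemma W_bound (hbox : ∀ᶠ T in atTop, Box T) : ∃ C : ℝ, 0 ≤ C ∧ ∀ᶠ T : ℝ in atTop, ∀ t : ℝ, 3*T/4 ≤ t → t ≤ 3 * T →
    ∑' ρ : ℂ, (mu ρ : ℝ) * rexp (-(ρ.im - t)^2/2) ≤ C * rlog T := by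
  obtain ⟨K, hK, h⟩ := gsum
  obtain ⟨C, hC, hS⟩ := SS0
  refine ⟨2 * C + 14, by positivity, ?_⟩
  filter_upwards [hbox, tiny (3 * 64 * K), eventually_ge_atTop 4, Real.tendsto_log_atTop.eventually_ge_atTop 1,
    Real.isLittleO_log_id_atTop.def (show (0:ℝ) < 1/8 by norm_num)] with T hB h1 h2 hL h4 t ht1 ht2
  have hLT : rlog T ≤ T/8 := by
    simp only [id, Real.norm_eq_abs] at h4
    rw [abs_of_pos (by linarith), abs_of_pos (by linarith)] at h4; linarith
  set L := rlog T
  have hre : ∀ ρ : ℂ, 1/2 * ((mu ρ : ℝ) * rexp (-(ρ.im - t)^2/2)) - 3 * rexp (-L^2/4) * ((mu ρ : ℝ) * rexp (-(ρ.im - t)^2/4))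
      ≤ ((mu ρ : ℂ) * EE 0 (ρ - (1/2 + t * cI))).re := by
    intro ρ
    rcases Nat.eq_zero_or_pos (mu ρ) with h0 | h0
    · simp [h0]
    have hz := mu_pos_iff.mp h0
    obtain ⟨e1, e2⟩ := sub_re_im ρ t
    have e3 : ((mu ρ : ℂ) * EE 0 (ρ - (1/2 + t * cI))).re = (mu ρ : ℝ) * (EE 0 (ρ - (1/2 + t * cI))).re := by
      rw [← Complex.ofReal_natCast, Complex.re_ofReal_mul]
    rw [e3, re_EE0, e1, e2]
    set u := ρ.im - t with hu
    set v := ρ.re - 1/2 with hv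
    have hv2 : |v| ≤ 1/2 := by rw [abs_le]; constructor <;> linarith [hz.2.1, hz.2.2]
    have key : 1/2 * rexp (-u^2/2) - 3 * rexp (-L^2/4) * rexp (-u^2/4) ≤ rexp (v^2/2 - u^2/2) * Real.cos (v * u) := by
      rcases le_or_gt |u| L with hc | hc
      · have hc' := abs_le.mp hc
        have hbv := hB.1 ρ hz (by linarith) (by linarith)
        have h5 : |v * u| ≤ 1 := by
          rw [abs_mul]
          calc |v| * |u| ≤ (0.001 / L) * L := by gcongr
            _ = 0.001 := by field_simp
            _ ≤ 1 := by norm_num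
        have h6 : 1/2 ≤ Real.cos (v*u) := by
          have := Real.one_sub_sq_div_two_le_cos (x := v*u)
          have : (v*u)^2 ≤ 1 := by rw [← sq_abs]; nlinarith [abs_nonneg (v*u)]
          linarith
        have h7 : rexp (-u^2/2) ≤ rexp (v^2/2 - u^2/2) := Real.exp_le_exp.mpr (by nlinarith [sq_nonneg v])
        have h8 : 0 ≤ 3 * rexp (-L^2/4) * rexp (-u^2/4) := by positivity
        nlinarith [Real.exp_pos (-u^2/2)]
      · have h5 := half_quarter (by linarith : 0 ≤ L) hc.le
        have h6 : rexp (v^2/2 - u^2/2) ≤ 2 * rexp (-u^2/2) := by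
          have : rexp (v^2/2 - u^2/2) = rexp (v^2/2) * rexp (-u^2/2) := by rw [← Real.exp_add]; congr 1; ring
          rw [this]
          gcongr
          have hh : v^2/2 ≤ 1/8 := by
            have : v^2 ≤ 1/4 := by rw [← sq_abs]; nlinarith [abs_nonneg v]
            linarith
          calc rexp (v^2/2) ≤ rexp (1/8) := Real.exp_le_exp.mpr hh
            _ ≤ 1/(1 - 1/8) := Real.exp_bound_div_one_sub_of_interval (by norm_num) (by norm_num)
            _ ≤ 2 := by norm_num
        have h7 := Real.neg_one_le_cos (v*u)
        nlinarith [Real.exp_pos (v^2/2 - u^2/2)]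
    have hm : (0:ℝ) ≤ mu ρ := Nat.cast_nonneg _
    nlinarith
  have hsr := (Complex.hasSum_re (SS_summable 0 t).hasSum)
  have hg := h t
  have hs1 := ((W_sum t).mul_left (1/2)).sub (hg.1.mul_left (3 * rexp (-L^2/4)))
  have h5 := hs1.tsum_le_tsum hre hsr.summable
  rw [hsr.tsum_eq, ((W_sum t).mul_left (1/2)).tsum_sub (hg.1.mul_left _), tsum_mul_left, tsum_mul_left] at h5
  have h6 : (∑' ρ : ℂ, (mu ρ : ℂ) * EE 0 (ρ - (1/2 + t * cI))).re ≤ rlog (1+|t|) + C := by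
    have a1 := hS t
    have a2 := Complex.abs_re_le_norm (SS 0 t - (gg 0 * rlog (1+|t|) : ℝ))
    rw [Complex.sub_re, Complex.ofReal_re] at a2
    have a3 := (abs_le.mp (a2.trans a1)).2
    have a4 : 0 ≤ rlog (1+|t|) := Real.log_nonneg (by linarith [abs_nonneg t])
    have a5 := gg_le_one 0
    change (SS 0 t).re ≤ _
    nlinarith
  have ht : |t| ≤ 3 * T := by rw [abs_of_nonneg (by linarith)]; linarith
  have h7 : rlog (1+|t|) ≤ 3 * L := by
    have : 1 + |t| ≤ T^2 := by nlinarith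
    calc _ ≤ rlog (T^2) := Real.log_le_log (by positivity) this
      _ = 2 * L := by rw [Real.log_pow]; norm_num; rfl
      _ ≤ _ := by linarith
  have h8 : 3 * rexp (-L^2/4) * ∑' ρ : ℂ, (mu ρ : ℝ) * rexp (-(ρ.im - t)^2/4) ≤ 1 := by
    calc _ ≤ 3 * rexp (-L^2/4) * (K * (1 + 3*T)^3) := by
          apply mul_le_mul_of_nonneg_left _ (by positivity)
          refine hg.2.trans ?_
          gcongr
      _ ≤ 3 * rexp (-L^2/4) * (K * (4*T)^3) := by gcongr; linarith
      _ = (3 * 64 * K) * (T^3 * rexp (-L^2/4)) := by ring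
      _ = (3 * 64 * K) * (rexp (3 * L + (-L^2/4))) := by
        rw [Real.exp_add, show 3 * L = (3:ℕ) * rlog T by norm_num; rfl, Real.exp_nat_mul, Real.exp_log (by linarith)]
      _ ≤ (3 * 64 * K) * (rexp (20 * L - L^2/4)) := by
        gcongr ?_ * ?_
        apply Real.exp_le_exp.mpr
        linarith
      _ ≤ 1 / T := h1
      _ ≤ 1 := by rw [div_le_one (by linarith)]; linarith
  nlinarith

lemma NN_nonneg (T : ℝ) : 0 ≤ NN T := Finset.sum_nonneg fun _ _ => Nat.cast_nonneg _

lemma NN_crude : ∃ K : ℝ, 0 ≤ K ∧ ∀ T : ℝ, 1 ≤ T → NN T ≤ K * T^3 := by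
  refine ⟨27 * ∑' ρ : ℂ, (mu ρ:ℝ)/(1+|ρ.im|)^3, ?_, fun T hT => ?_⟩
  · have : 0 ≤ ∑' ρ : ℂ, (mu ρ:ℝ)/(1+|ρ.im|)^3 := tsum_nonneg fun ρ => by positivity
    linarith
  have h1 : ∑ ρ ∈ bd T, (mu ρ:ℝ)/(1+|ρ.im|)^3 ≤ ∑' ρ : ℂ, (mu ρ:ℝ)/(1+|ρ.im|)^3 :=
    mu_summable.sum_le_tsum _ fun ρ _ => by positivity
  have h2 : NN T ≤ (27 * T^3) * ∑ ρ ∈ bd T, (mu ρ:ℝ)/(1+|ρ.im|)^3 := by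
    rw [NN, Finset.mul_sum]
    refine Finset.sum_le_sum fun ρ hρ => ?_
    obtain ⟨hz, ha, hb⟩ := mem_bd.mp hρ
    have h3 : (1 + |ρ.im|)^3 ≤ 27 * T^3 := by
      have : 1 + |ρ.im| ≤ 3 * T := by rw [abs_of_pos (by linarith)]; linarith
      calc _ ≤ (3*T)^3 := by gcongr
        _ = _ := by ring
    rw [mul_div_assoc', le_div_iff₀ (by positivity)]
    nlinarith [(Nat.cast_nonneg (mu ρ) : (0:ℝ) ≤ mu ρ)]
  nlinarith [pow_pos (by linarith : 0 < T) 3]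

lemma gauss_half (γ : ℝ) : Integrable (fun t : ℝ => rexp (-(γ - t)^2/2)) ∧ ∫ t : ℝ, rexp (-(γ - t)^2/2) = rsq (2 * rpi) := by
  have h1 : ∀ t : ℝ, rexp (-(γ - t)^2/2) = (fun x : ℝ => rexp (-(1/2) * x^2)) (γ - t) := by
    intro t; simp only; congr 1; ring
  simp_rw [h1]
  refine ⟨(integrable_exp_neg_mul_sq (by norm_num : (0:ℝ) < 1/2)).comp_sub_left γ, ?_⟩
  rw [integral_sub_left_eq_self (fun x : ℝ => rexp (-(1/2) * x^2)) volume γ, integral_gaussian]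
  congr 1; ring

lemma N_lower (hbox : ∀ᶠ T in atTop, Box T) : ∃ C : ℝ, ∀ᶠ T : ℝ in atTop, T * rlog T / (2 * rpi) - C * T ≤ NN T := by
  obtain ⟨C, hC, hS⟩ := SS0
  set q := rsq (2 * rpi) with hq
  have hqp : 0 < q := by positivity
  have hq2 : q * q = 2 * rpi := Real.mul_self_sqrt (by positivity)
  have hg0 : gg 0 = 1 / q := by simp [gg, hq]
  refine ⟨(C+1) * q / (2 * rpi) + 2, ?_⟩
  filter_upwards [hbox, mid_close, eventually_ge_atTop 4, Real.tendsto_log_atTop.eventually_ge_atTop 1,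
    Real.tendsto_log_atTop.eventually_ge_atTop ((C+1) * q),
    (Real.isLittleO_pow_log_id_atTop (n := 2)).def (show (0:ℝ) < 1/8 by norm_num)] with T hB hmid h2 hL hLC h4
  have hLT : rlog T^2 ≤ T/8 := by
    simp only [id, Real.norm_eq_abs] at h4
    rw [abs_of_pos (by positivity), abs_of_pos (by linarith)] at h4; linarith
  set L := rlog T with hLdef
  have hLT1 : L ≤ T/8 := by nlinarith
  have hab : T + L ≤ 2 * T - L := by linarith
  have hlow : ∀ t ∈ Icc (T+L) (2*T-L), L / q - (C+1) ≤ (Sloc T 0 t).re := by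
    rintro t ⟨ht1, ht2⟩
    have a1 := hS t
    have a2 := hmid 0 t (by rw [abs_zero]; linarith) ht1 ht2
    have a3 := (abs_le.mp ((Complex.abs_re_le_norm _).trans a1)).1
    have a4 := (abs_le.mp ((Complex.abs_re_le_norm _).trans a2)).2
    rw [Complex.sub_re] at a3 a4
    rw [Complex.ofReal_re, hg0] at a3
    have a5 : L ≤ rlog (1+|t|) := by
      apply Real.log_le_log (by linarith)
      rw [abs_of_pos (by linarith)]; linarith
    have a6 : 1 / T ≤ 1 := by rw [div_le_one (by linarith)]; linarith
    have a7 : L / q ≤ 1 / q * rlog (1+|t|) := by rw [div_mul_eq_mul_div, one_mul]; gcongr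
    linarith
  have hup : ∀ t : ℝ, (Sloc T 0 t).re ≤ ∑ ρ ∈ bd T, (mu ρ : ℝ) * ((1 + 1/L) * rexp (-(ρ.im - t)^2/2)) := by
    intro t
    rw [Sloc, Complex.re_sum]
    refine Finset.sum_le_sum fun ρ hρ => ?_
    refine (Complex.re_le_norm _).trans ?_
    rw [norm_mul, Complex.norm_natCast, norm_EE, (sub_re_im ρ t).1, (sub_re_im ρ t).2]
    gcongr
    have hv := hB.2 ρ hρ
    have hv2 : (ρ.re - 1/2)^2/2 ≤ 1/(2*L) := by
      have : 0.001 / (2 * rlog T) ≤ 1/(2*L) := by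
        rw [← hLdef]; gcongr; norm_num
      have h6 : |ρ.re - 1/2| ≤ 1/(2*L) := hv.trans this
      have h7 : 1/(2*L) ≤ 1 := by rw [div_le_one (by linarith)]; linarith
      rw [← sq_abs]; nlinarith [abs_nonneg (ρ.re - 1/2)]
    have h8 : 0 * (ρ.re - 1/2) + (ρ.re - 1/2)^2/2 - (ρ.im - t)^2/2 ≤ 1/(2*L) + -(ρ.im-t)^2/2 := by linarith
    calc _ ≤ rexp (1/(2*L) + -(ρ.im-t)^2/2) := Real.exp_le_exp.mpr h8
      _ = rexp (1/(2*L)) * rexp (-(ρ.im-t)^2/2) := Real.exp_add _ _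
      _ ≤ _ := by
        gcongr
        have h9 : 0 ≤ 1/(2*L) := by positivity
        have h10 : 1/(2*L) ≤ 1/2 := by rw [div_le_div_iff₀ (by linarith) (by norm_num)]; linarith
        refine (Real.exp_bound_div_one_sub_of_interval h9 (by linarith)).trans ?_
        rw [div_le_iff₀ (by linarith), show 1/L = 2 * (1/(2*L)) by field_simp]
        nlinarith
  have hint : IntegrableOn (fun t => ∑ ρ ∈ bd T, (mu ρ : ℝ) * ((1 + 1/L) * rexp (-(ρ.im - t)^2/2))) (Icc (T+L) (2*T-L)) :=
    (integrable_finsetSum _ fun ρ _ => ((gauss_half ρ.im).1.const_mul _).const_mul _).integrableOn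
  have h5 : (T - 2*L) * (L/q - (C+1)) ≤ NN T * ((1+1/L) * q) := by
    calc (T - 2*L) * (L/q - (C+1)) = ∫ t in Icc (T+L) (2*T-L), (L/q - (C+1)) := by
          rw [setIntegral_const]; simp [Measure.real, Real.volume_Icc, ENNReal.toReal_ofReal (by linarith : 0 ≤ 2*T-L-(T+L))]; left; ring
      _ ≤ ∫ t in Icc (T+L) (2*T-L), ∑ ρ ∈ bd T, (mu ρ : ℝ) * ((1 + 1/L) * rexp (-(ρ.im - t)^2/2)) := by
          refine setIntegral_mono_on (by simp) hint measurableSet_Icc fun t ht => (hlow t ht).trans (hup t)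
      _ ≤ ∫ t, ∑ ρ ∈ bd T, (mu ρ : ℝ) * ((1 + 1/L) * rexp (-(ρ.im - t)^2/2)) := by
          refine setIntegral_le_integral (integrable_finsetSum _ fun ρ _ => ((gauss_half ρ.im).1.const_mul _).const_mul _) ?_
          refine Eventually.of_forall fun t => Finset.sum_nonneg fun ρ _ => ?_
          positivity
      _ = _ := by
          rw [integral_finsetSum _ fun ρ _ => ((gauss_half ρ.im).1.const_mul _).const_mul _]
          simp_rw [integral_const_mul, (gauss_half _).2]
          rw [← Finset.sum_mul]; rfl
  have hN := NN_nonneg T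
  have h6 : (T - 2*L) * (L - (C+1) * q) ≤ NN T * (1+1/L) * (2 * rpi) := by
    have : (T - 2*L) * (L - (C+1) * q) = ((T - 2*L) * (L/q - (C+1))) * q := by field_simp
    rw [this, ← hq2]; nlinarith
  have h7 : (T - 2*L) * (L - (C+1) * q) * (1 - 1/L) ≤ NN T * (2 * rpi) := by
    have h8 : 0 ≤ 1 - 1/L := by rw [sub_nonneg, div_le_one (by linarith)]; exact hL
    have h9 : (1 + 1/L) * (1 - 1/L) ≤ 1 := by nlinarith [sq_nonneg (1/L)]
    calc _ ≤ (NN T * (1+1/L) * (2 * rpi)) * (1 - 1/L) := by gcongr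
      _ = NN T * (2 * rpi) * ((1 + 1/L) * (1 - 1/L)) := by ring
      _ ≤ NN T * (2 * rpi) * 1 := by gcongr
      _ = _ := by ring
  have h8 : T * L - T * ((C+1)*q) - 2 * T ≤ (T - 2*L) * (L - (C+1) * q) * (1 - 1/L) := by
    have hc : 0 ≤ (C+1) * q := by positivity
    have e : (T - 2*L) * (L - (C+1) * q) * (1 - 1/L) = (T - 2*L) * (L - (C+1) * q) - (T - 2*L) * (1 - (C+1) * q * (1/L)) := by
      field_simp
    have h9 : 0 ≤ (C+1) * q * (1/L) := by positivity
    rw [e]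
    nlinarith
  have hpi := Real.pi_gt_three
  have h9 : (T * L - T * ((C+1)*q) - 2 * T) / (2 * rpi) ≤ NN T := by
    rw [div_le_iff₀ (by positivity)]; linarith
  refine le_trans (le_of_eq_of_le ?_ (sub_le_self _ (?_ : 0 ≤ (2 - 2/(2*rpi)) * T))) h9
  · field_simp; ring
  · have : 2/(2*rpi) ≤ 1 := by rw [div_le_one (by positivity)]; linarith
    nlinarith

lemma pair_aux (m n : ℕ) (hm : 1 ≤ m) (hmn : m < n) (c d : ℝ) (hc : 0 ≤ c) (hd : 0 ≤ d) :
    (c * rexp (-(1/2) * rlog m)) * (d * rexp (-(1/2) * rlog n)) * (2 / |rlog m - rlog n|) ≤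
      2 * ((c * rexp (-(1/2) * rlog m)) * (d * rexp (-(1/2) * rlog n))) +
      (c^2 * rexp ((1/10) * rlog m) + d^2 * rexp ((1/10) * rlog n)) * |(((m:ℤ)-(n:ℤ) : ℤ) : ℝ)| ^ (-(11/10) : ℝ) := by
  have hm0 : (0:ℝ) < m := by exact_mod_cast hm
  have hmn' : (m:ℝ) < n := by exact_mod_cast hmn
  have hn0 : (0:ℝ) < n := hm0.trans hmn'
  set x := rlog m with hx
  set y := rlog n with hy
  have hxy : x < y := Real.log_lt_log hm0 hmn'
  have ex : rexp x = m := Real.exp_log hm0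
  have ey : rexp y = n := Real.exp_log hn0
  set k : ℝ := n - m with hk
  have hk0 : 0 < k := by simp only [hk]; linarith
  have ek : |(((m:ℤ)-(n:ℤ) : ℤ) : ℝ)| = k := by
    push_cast; rw [abs_of_neg (by linarith)]; simp only [hk]; ring
  rw [ek, abs_of_neg (by linarith : x - y < 0)]
  have hpow : k ^ (-(11/10) : ℝ) = rexp (-(1/10) * rlog k) / k := by
    rw [Real.rpow_def_of_pos hk0, show rlog k * (-(11/10)) = -(1/10) * rlog k - rlog k by ring, Real.exp_sub, Real.exp_log hk0]
  have hlk : rlog k ≤ y := Real.log_le_log hk0 (by simp only [hk]; linarith)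
  have h1 : 2 / -(x-y) ≤ 2 + 2 * rexp x / k := by
    have h2 : k / n ≤ y - x := by
      have := Real.one_sub_inv_le_log_of_pos (div_pos hn0 hm0)
      rw [Real.log_div hn0.ne' hm0.ne', inv_div] at this
      have e : k / n = 1 - m/n := by simp only [hk]; field_simp
      rw [e]; exact this
    have h3 : 2 / -(x-y) ≤ 2 / (k/n) := by
      apply div_le_div_of_nonneg_left (by norm_num) (by positivity); linarith
    have e : 2 / (k/n) = 2 + 2 * rexp x / k := by
      rw [ex]; field_simp; simp only [hk]; ring
    linarith
  have h4 : (c * rexp (-(1/2)*x)) * (d * rexp (-(1/2)*y)) * (2 * rexp x / k) ≤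
      (c^2 * rexp ((1/10)*x) + d^2 * rexp ((1/10)*y)) * (rexp (-(1/10) * rlog k) / k) := by
    have e1 : (c * rexp (-(1/2)*x)) * (d * rexp (-(1/2)*y)) * (2 * rexp x / k) =
        2 * (c * d * rexp (x/2 - y/2)) / k := by
      rw [show x/2-y/2 = -(1/2)*x + -(1/2)*y + x by ring, Real.exp_add, Real.exp_add]; ring
    have e2 : rexp (x/2-y/2) ≤ rexp (x/20) * rexp (y/20) * rexp (-(1/10) * rlog k) := by
      rw [← Real.exp_add, ← Real.exp_add]; apply Real.exp_le_exp.mpr; linarith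
    have e3 : 2 * (c * rexp (x/20)) * (d * rexp (y/20)) ≤ c^2 * rexp ((1/10)*x) + d^2 * rexp ((1/10)*y) := by
      rw [show (1/10)*x = x/20+x/20 by ring, show (1/10)*y = y/20+y/20 by ring, Real.exp_add, Real.exp_add]
      nlinarith [sq_nonneg (c * rexp (x/20) - d * rexp (y/20))]
    rw [e1, mul_div_assoc']
    apply div_le_div_of_nonneg_right _ hk0.le
    calc 2 * (c * d * rexp (x/2 - y/2)) ≤ 2 * (c * d * (rexp (x/20) * rexp (y/20) * rexp (-(1/10) * rlog k))) := by
          gcongr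
      _ = (2 * (c * rexp (x/20)) * (d * rexp (y/20))) * rexp (-(1/10) * rlog k) := by ring
      _ ≤ _ := by gcongr
  rw [hpow]
  calc _ ≤ (c * rexp (-(1/2)*x)) * (d * rexp (-(1/2)*y)) * (2 + 2 * rexp x / k) := by gcongr
    _ = 2 * ((c * rexp (-(1/2)*x)) * (d * rexp (-(1/2)*y))) + (c * rexp (-(1/2)*x)) * (d * rexp (-(1/2)*y)) * (2 * rexp x / k) := by ring
    _ ≤ _ := by linarith

lemma pair_bound (c : ℕ → ℝ) (hc : ∀ n, 0 ≤ c n) (h0 : c 0 = 0) (m n : ℕ) (hmn : m ≠ n) :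
    (c m * rexp (-(1/2) * rlog m)) * (c n * rexp (-(1/2) * rlog n)) * (2 / |rlog m - rlog n|) ≤
      2 * ((c m * rexp (-(1/2) * rlog m)) * (c n * rexp (-(1/2) * rlog n))) +
      ((c m)^2 * rexp ((1/10) * rlog m) + (c n)^2 * rexp ((1/10) * rlog n)) * |(((m:ℤ)-(n:ℤ) : ℤ) : ℝ)| ^ (-(11/10) : ℝ) := by
  rcases Nat.eq_zero_or_pos m with rfl | hm
  · rw [h0]; simp; positivity
  rcases Nat.eq_zero_or_pos n with rfl | hn
  · rw [h0]; simp; positivity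
  rcases lt_or_gt_of_ne hmn with h | h
  · exact pair_aux m n hm h _ _ (hc _) (hc _)
  · have := pair_aux n m hn h _ _ (hc n) (hc m)
    rw [abs_sub_comm] at this
    rw [show |(((m:ℤ)-(n:ℤ) : ℤ) : ℝ)| = |(((n:ℤ)-(m:ℤ) : ℤ) : ℝ)| by push_cast; rw [abs_sub_comm]]
    calc _ = (c n * rexp (-(1/2) * rlog n)) * (c m * rexp (-(1/2) * rlog m)) * (2 / |rlog m - rlog n|) := by ring
      _ ≤ _ := this
      _ = _ := by ring

lemma cos_int (a b d : ℝ) (hd : d ≠ 0) : ∫ t in a..b, Real.cos (t * d) ≤ 2 / |d| := by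
  rw [intervalIntegral.integral_comp_mul_right (fun x => Real.cos x) hd, integral_cos, smul_eq_mul]
  calc _ ≤ |d⁻¹ * (Real.sin (b*d) - Real.sin (a*d))| := le_abs_self _
    _ = |d|⁻¹ * |Real.sin (b*d) - Real.sin (a*d)| := by rw [abs_mul, abs_inv]
    _ ≤ |d|⁻¹ * 2 := by
      gcongr
      have h1 := abs_le.mp (Real.abs_sin_le_one (b*d)); have h2 := abs_le.mp (Real.abs_sin_le_one (a*d))
      rw [abs_le]; constructor <;> linarith
    _ = _ := by ring

lemma norm_sq_expand (s : Finset ℕ) (c : ℕ → ℝ) (t : ℝ) :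
    ‖∑ n ∈ s, ((c n : ℝ) : ℂ) * cexp (-(1/2 + t * cI) * (rlog n))‖^2 =
      ∑ m ∈ s, ∑ n ∈ s, (c m * rexp (-(1/2) * rlog m)) * (c n * rexp (-(1/2) * rlog n)) * Real.cos (t * (rlog m - rlog n)) := by
  have h : ∀ n : ℕ, ((c n : ℝ) : ℂ) * cexp (-(1/2 + t * cI) * (rlog n)) =
      (((c n * rexp (-(1/2) * rlog n)) * Real.cos (t * rlog n) : ℝ) : ℂ) -
      (((c n * rexp (-(1/2) * rlog n)) * Real.sin (t * rlog n) : ℝ) : ℂ) * cI := by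
    intro n
    rw [show (-(1/2 + t * cI) * (rlog n) : ℂ) = ((-(1/2) * rlog n : ℝ) : ℂ) + ((-(t * rlog n) : ℝ) : ℂ) * cI by push_cast; ring,
      Complex.exp_add, Complex.exp_mul_I]
    rw [← Complex.ofReal_cos, ← Complex.ofReal_sin, ← Complex.ofReal_exp, Real.cos_neg, Real.sin_neg]
    push_cast; ring
  simp_rw [h]
  rw [Finset.sum_sub_distrib, ← Finset.sum_mul, ← Complex.ofReal_sum, ← Complex.ofReal_sum, ← Complex.normSq_eq_norm_sq, Complex.normSq_apply]
  simp only [Complex.sub_re, Complex.sub_im, Complex.ofReal_re, Complex.ofReal_im, Complex.mul_re, Complex.mul_im, Complex.I_re, Complex.I_im, mul_zero, mul_one, sub_zero, zero_sub, add_zero]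
  rw [neg_mul_neg, Finset.sum_mul_sum, Finset.sum_mul_sum, ← Finset.sum_add_distrib]
  refine Finset.sum_congr rfl fun m _ => ?_
  rw [← Finset.sum_add_distrib]
  refine Finset.sum_congr rfl fun n _ => ?_
  rw [mul_sub, Real.cos_sub]; ring

lemma mv_finite : ∃ Z : ℝ, 0 ≤ Z ∧ ∀ (s : Finset ℕ) (c : ℕ → ℝ), (∀ n, 0 ≤ c n) → c 0 = 0 → ∀ a b : ℝ, a ≤ b →
    ∫ t in a..b, ‖∑ n ∈ s, ((c n : ℝ) : ℂ) * cexp (-(1/2 + t * cI) * (rlog n))‖^2 ≤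
      (b - a) * ∑ n ∈ s, (c n * rexp (-(1/2) * rlog n))^2 + 2 * (∑ n ∈ s, c n * rexp (-(1/2) * rlog n))^2 +
      Z * ∑ n ∈ s, (c n)^2 * rexp ((1/10) * rlog n) := by
  have hsZ : Summable (fun n : ℤ => |(n:ℝ)| ^ (-(11/10) : ℝ)) := Real.summable_abs_int_rpow (by norm_num)
  set Y := ∑' n : ℤ, |(n:ℝ)| ^ (-(11/10) : ℝ) with hY
  have hY0 : 0 ≤ Y := tsum_nonneg fun n => by positivity
  refine ⟨2 * Y, by positivity, fun s c hc h0 a b hab => ?_⟩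
  set A : ℕ → ℝ := fun n => c n * rexp (-(1/2) * rlog n) with hA
  have hA0 : ∀ n, 0 ≤ A n := fun n => mul_nonneg (hc n) (Real.exp_pos _).le
  set B : ℕ → ℝ := fun n => (c n)^2 * rexp ((1/10) * rlog n) with hB
  have hB0 : ∀ n, 0 ≤ B n := fun n => by positivity
  set f : ℕ → ℕ → ℝ := fun m n => |(((m:ℤ)-(n:ℤ) : ℤ) : ℝ)| ^ (-(11/10) : ℝ) with hf
  have hf0 : ∀ m n, 0 ≤ f m n := fun m n => by positivity
  have hfs : ∀ m n, f m n = f n m := fun m n => by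
    simp only [hf]; push_cast; rw [abs_sub_comm]
  have hsum : ∀ m, ∑ n ∈ s, f m n ≤ Y := by
    intro m
    have inj : Function.Injective (fun n : ℕ => (m:ℤ) - (n:ℤ)) := by
      intro x y h; simpa using h
    have h1 := hsZ.comp_injective inj
    calc ∑ n ∈ s, f m n ≤ ∑' n : ℕ, f m n := h1.sum_le_tsum s (fun n _ => hf0 m n)
      _ ≤ Y := tsum_comp_le_tsum_of_inj hsZ (fun n => by positivity) inj
  simp_rw [norm_sq_expand]
  rw [intervalIntegral.integral_finsetSum (fun m _ => (Continuous.intervalIntegrable (by fun_prop) _ _))]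
  have hin : ∀ m : ℕ, ∫ t in a..b, ∑ n ∈ s, (c m * rexp (-(1/2) * rlog m)) * (c n * rexp (-(1/2) * rlog n)) * Real.cos (t * (rlog m - rlog n)) =
      ∑ n ∈ s, A m * A n * ∫ t in a..b, Real.cos (t * (rlog m - rlog n)) := by
    intro m
    rw [intervalIntegral.integral_finsetSum (fun n _ => (Continuous.intervalIntegrable (by fun_prop) _ _))]
    simp_rw [intervalIntegral.integral_const_mul]; rfl
  simp_rw [hin]
  have key : ∀ m ∈ s, ∀ n ∈ s, A m * A n * ∫ t in a..b, Real.cos (t * (rlog m - rlog n)) ≤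
      (if m = n then (b-a) * (A m)^2 else 0) + 2 * (A m * A n) + (B m + B n) * f m n := by
    intro m _ n _
    by_cases hmn : m = n
    · subst hmn
      simp only [sub_self, mul_zero, Real.cos_zero, if_true, intervalIntegral.integral_const, smul_eq_mul, mul_one]
      have := mul_nonneg (add_nonneg (hB0 m) (hB0 m)) (hf0 m m)
      nlinarith [mul_nonneg (hA0 m) (hA0 m)]
    · rw [if_neg hmn, zero_add]
      have hpb := pair_bound c hc h0 m n hmn
      refine le_trans ?_ hpb
      by_cases hz : A m * A n = 0
      · rw [hz]; simp
      have hl : rlog m - rlog n ≠ 0 := by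
        intro h
        have hm : m ≠ 0 := by rintro rfl; simp [hA, h0] at hz
        have hn : n ≠ 0 := by rintro rfl; simp [hA, h0] at hz
        have := Real.log_injOn_pos (by simp; omega : (m:ℝ) ∈ Ioi 0) (by simp; omega : (n:ℝ) ∈ Ioi 0) (sub_eq_zero.mp h)
        exact hmn (by exact_mod_cast this)
      exact mul_le_mul_of_nonneg_left (cos_int a b _ hl) (mul_nonneg (hA0 m) (hA0 n))
  refine (Finset.sum_le_sum fun m hm => Finset.sum_le_sum fun n hn => key m hm n hn).trans ?_
  simp_rw [Finset.sum_add_distrib]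
  have e1 : ∑ m ∈ s, ∑ n ∈ s, (if m = n then (b-a) * (A m)^2 else 0) = (b-a) * ∑ n ∈ s, (A n)^2 := by
    rw [Finset.mul_sum]; refine Finset.sum_congr rfl fun m hm => ?_
    simp [hm]
  have e2 : ∑ m ∈ s, ∑ n ∈ s, 2 * (A m * A n) = 2 * (∑ n ∈ s, A n)^2 := by
    rw [pow_two, Finset.sum_mul_sum, Finset.mul_sum]
    exact Finset.sum_congr rfl fun m _ => (Finset.mul_sum _ _ _).symm
  have e3 : ∑ m ∈ s, ∑ n ∈ s, (B m + B n) * f m n = 2 * ∑ m ∈ s, B m * ∑ n ∈ s, f m n := by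
    simp_rw [add_mul, Finset.sum_add_distrib]
    have : ∑ m ∈ s, ∑ n ∈ s, B n * f m n = ∑ m ∈ s, ∑ n ∈ s, B m * f m n := by
      rw [Finset.sum_comm]
      exact Finset.sum_congr rfl fun m _ => Finset.sum_congr rfl fun n _ => by rw [hfs]
    rw [this, ← two_mul]
    simp_rw [Finset.mul_sum]
  rw [e1, e2, e3]
  have : ∑ m ∈ s, B m * ∑ n ∈ s, f m n ≤ ∑ m ∈ s, B m * Y :=
    Finset.sum_le_sum fun m _ => mul_le_mul_of_nonneg_left (hsum m) (hB0 m)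
  rw [← Finset.sum_mul] at this
  linarith

lemma gg_exp (a y : ℝ) : gg y ≤ rexp (a^2/2 + a*y) := by
  have h1 : (1:ℝ) ≤ rsq (2*rpi) := by
    rw [Real.one_le_sqrt]; linarith [Real.pi_gt_three]
  unfold gg
  calc _ ≤ rexp (-y^2/2) := div_le_self (Real.exp_pos _).le h1
    _ ≤ _ := Real.exp_le_exp.mpr (by nlinarith [sq_nonneg (y+a)])

lemma Lam_bd (n : ℕ) : (Λ n)^2 ≤ 1600 * rexp ((1/20) * rlog n) ∧ Λ n ≤ 40 * rexp ((1/40) * rlog n) := by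
  have h0 : (0:ℝ) ≤ Λ n := ArithmeticFunction.vonMangoldt_nonneg
  have h1 : Λ n ≤ rlog n := ArithmeticFunction.vonMangoldt_le_log
  have h2 : Λ n ≤ 40 * rexp ((1/40) * rlog n) := by
    linarith [Real.add_one_le_exp ((1/40) * rlog n)]
  refine ⟨?_, h2⟩
  calc (Λ n)^2 ≤ (40 * rexp ((1/40) * rlog n))^2 := by gcongr
    _ = 1600 * (rexp ((1/40) * rlog n) * rexp ((1/40) * rlog n)) := by ring
    _ = _ := by rw [← Real.exp_add]; ring_nf

lemma summable_exp_log (b : ℝ) (hb : 1 < b) : Summable (fun n : ℕ => rexp (-b * rlog n)) := by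
  have h := (Real.summable_nat_rpow (p := -b)).mpr (by linarith)
  refine (summable_nat_add_iff 1).mp ?_
  refine ((summable_nat_add_iff 1).mpr h).congr fun n => ?_
  rw [Real.rpow_def_of_pos (by positivity)]; ring_nf

lemma LamS : Summable (fun n : ℕ => Λ n * rexp (-(11/10) * rlog n)) ∧ Summable (fun n : ℕ => (Λ n)^2 * rexp (-(11/10) * rlog n)) := by
  have h0 : ∀ n : ℕ, (0:ℝ) ≤ Λ n := fun n => ArithmeticFunction.vonMangoldt_nonneg
  constructor
  · refine ((summable_exp_log (43/40) (by norm_num)).mul_left 40).of_nonneg_of_le (fun n => mul_nonneg (h0 n) (Real.exp_pos _).le) fun n => ?_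
    calc _ ≤ (40 * rexp ((1/40) * rlog n)) * rexp (-(11/10) * rlog n) := by gcongr; exact (Lam_bd n).2
      _ = _ := by rw [mul_assoc, ← Real.exp_add]; ring_nf
  · refine ((summable_exp_log (21/20) (by norm_num)).mul_left 1600).of_nonneg_of_le (fun n => by positivity) fun n => ?_
    calc _ ≤ (1600 * rexp ((1/20) * rlog n)) * rexp (-(11/10) * rlog n) := by gcongr; exact (Lam_bd n).1
      _ = _ := by rw [mul_assoc, ← Real.exp_add]; ring_nf

noncomputable def DD (l : ℝ) : ℝ := ∑' n : ℕ, (Λ n * gg (l - rlog n) * rexp (-(1/2) * rlog n))^2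

lemma sq_term (l x : ℝ) (n : ℕ) (a : ℝ) : (Λ n * gg (l - x))^2 ≤ (Λ n)^2 * rexp (a^2 + 2*a*l - 2*a*x) := by
  rw [mul_pow]
  refine mul_le_mul_of_nonneg_left ?_ (sq_nonneg _)
  calc (gg (l-x))^2 ≤ (rexp (a^2/2 + a*(l-x)))^2 := by
        have := gg_pos (l-x)
        gcongr; exact gg_exp a _
    _ = _ := by rw [← Real.exp_nat_mul]; congr 1; push_cast; ring

lemma DD_term (l : ℝ) (n : ℕ) : (Λ n * gg (l - rlog n) * rexp (-(1/2) * rlog n))^2 ≤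
    rexp (1 + l/10) * ((Λ n)^2 * rexp (-(11/10) * rlog n)) := by
  rw [mul_pow]
  calc _ ≤ (Λ n)^2 * rexp ((1/20)^2 + 2*(1/20)*l - 2*(1/20)*rlog n) * (rexp (-(1/2) * rlog n))^2 := by
        gcongr; exact sq_term l _ n _
    _ = (Λ n)^2 * rexp ((1/20)^2 + l/10 + -(11/10) * rlog n) := by
        rw [← Real.exp_nat_mul, mul_assoc, ← Real.exp_add]; congr 2; push_cast; ring
    _ ≤ (Λ n)^2 * rexp (1 + l/10 + -(11/10) * rlog n) := by gcongr; norm_num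
    _ = _ := by rw [Real.exp_add _ (-(11/10) * rlog n)]; ring

lemma DD_summable (l : ℝ) : Summable (fun n : ℕ => (Λ n * gg (l - rlog n) * rexp (-(1/2) * rlog n))^2) :=
  (LamS.2.mul_left _).of_nonneg_of_le (fun n => sq_nonneg _) (DD_term l)

lemma DD_nonneg (l : ℝ) : 0 ≤ DD l := tsum_nonneg fun n => sq_nonneg _

lemma DD_crude : ∃ C : ℝ, 0 ≤ C ∧ ∀ l, DD l ≤ C * rexp (l/10) := by
  refine ⟨rexp 1 * ∑' n : ℕ, (Λ n)^2 * rexp (-(11/10) * rlog n), by positivity, fun l => ?_⟩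
  refine ((DD_summable l).tsum_le_tsum (DD_term l) (LamS.2.mul_left _)).trans (le_of_eq ?_)
  rw [tsum_mul_left, Real.exp_add]; ring

lemma gg_cont : Continuous gg := by unfold gg; fun_prop

lemma DD_cont : Continuous DD := by
  rw [continuous_iff_continuousAt]
  intro x
  have hc : ContinuousOn DD (Iio (x+1)) := by
    unfold DD
    refine continuousOn_tsum (u := fun n : ℕ => rexp (1 + (x+1)/10) * ((Λ n)^2 * rexp (-(11/10) * rlog n))) (fun n => ?_) (LamS.2.mul_left _) fun n l hl => ?_
    · have := gg_cont
      exact Continuous.continuousOn (by fun_prop)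
    · rw [Real.norm_of_nonneg (sq_nonneg _)]
      refine (DD_term l n).trans ?_
      have : l ≤ x+1 := le_of_lt hl
      gcongr
  exact hc.continuousAt (Iio_mem_nhds (by linarith))

lemma pp_mv : ∃ C : ℝ, 0 ≤ C ∧ ∀ l a b : ℝ, a ≤ b → ∫ t in a..b, ‖pp l t‖^2 ≤ (b-a) * DD l + C * rexp ((6/5)*l) := by
  obtain ⟨Z, hZ, hmv⟩ := mv_finite
  set K1 := ∑' n : ℕ, Λ n * rexp (-(11/10) * rlog n) with hK1
  set K2 := ∑' n : ℕ, (Λ n)^2 * rexp (-(11/10) * rlog n) with hK2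
  have h0 : ∀ n : ℕ, (0:ℝ) ≤ Λ n := fun n => ArithmeticFunction.vonMangoldt_nonneg
  have hK10 : 0 ≤ K1 := tsum_nonneg fun n => mul_nonneg (h0 n) (Real.exp_pos _).le
  have hK20 : 0 ≤ K2 := tsum_nonneg fun n => by positivity
  refine ⟨2 * (rexp 1 * K1)^2 + Z * (rexp 1 * K2), by positivity, fun l a b hab => ?_⟩
  set c : ℕ → ℝ := fun n => Λ n * gg (l - rlog n) with hc
  have hc0 : ∀ n, 0 ≤ c n := fun n => mul_nonneg (h0 n) (gg_pos _).le
  have hcz : c 0 = 0 := by simp [hc]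
  have b1 : ∀ s : Finset ℕ, ∑ n ∈ s, (c n * rexp (-(1/2) * rlog n))^2 ≤ DD l := fun s =>
    (DD_summable l).sum_le_tsum s fun n _ => sq_nonneg _
  have b2 : ∀ s : Finset ℕ, ∑ n ∈ s, c n * rexp (-(1/2) * rlog n) ≤ rexp (3/5*l) * (rexp 1 * K1) := by
    intro s
    have hh : ∀ n : ℕ, c n * rexp (-(1/2) * rlog n) ≤ rexp (3/5*l) * rexp 1 * (Λ n * rexp (-(11/10) * rlog n)) := by
      intro n
      calc _ ≤ Λ n * rexp ((3/5)^2/2 + (3/5)*(l - rlog n)) * rexp (-(1/2) * rlog n) := by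
            simp only [hc]; gcongr
            exact gg_exp _ _
        _ = Λ n * rexp ((3/5)^2/2 + 3/5*l + -(11/10) * rlog n) := by
            rw [mul_assoc, ← Real.exp_add]; ring_nf
        _ ≤ Λ n * rexp (3/5*l + 1 + -(11/10) * rlog n) := by
            refine mul_le_mul_of_nonneg_left (Real.exp_le_exp.mpr ?_) (h0 n); linarith
        _ = _ := by rw [Real.exp_add, Real.exp_add]; ring
    refine (Finset.sum_le_sum fun n _ => hh n).trans ?_
    rw [← Finset.mul_sum, ← mul_assoc]
    exact mul_le_mul_of_nonneg_left (LamS.1.sum_le_tsum s fun n _ => mul_nonneg (h0 n) (Real.exp_pos _).le) (by positivity)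
  have b3 : ∀ s : Finset ℕ, ∑ n ∈ s, (c n)^2 * rexp ((1/10) * rlog n) ≤ rexp ((6/5)*l) * (rexp 1 * K2) := by
    intro s
    have hh : ∀ n : ℕ, (c n)^2 * rexp ((1/10) * rlog n) ≤ rexp ((6/5)*l) * rexp 1 * ((Λ n)^2 * rexp (-(11/10) * rlog n)) := by
      intro n
      calc _ ≤ (Λ n)^2 * rexp ((3/5)^2 + 2*(3/5)*l - 2*(3/5)*rlog n) * rexp ((1/10) * rlog n) := by
            gcongr; exact sq_term l _ n _
        _ = (Λ n)^2 * rexp ((3/5)^2 + (6/5)*l + -(11/10) * rlog n) := by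
            rw [mul_assoc, ← Real.exp_add]; ring_nf
        _ ≤ (Λ n)^2 * rexp ((6/5)*l + 1 + -(11/10) * rlog n) := by
            refine mul_le_mul_of_nonneg_left (Real.exp_le_exp.mpr ?_) (sq_nonneg _); linarith
        _ = _ := by rw [Real.exp_add, Real.exp_add]; ring
    refine (Finset.sum_le_sum fun n _ => hh n).trans ?_
    rw [← Finset.mul_sum, ← mul_assoc]
    exact mul_le_mul_of_nonneg_left (LamS.2.sum_le_tsum s fun n _ => by positivity) (by positivity)
  have hfin : ∀ N : ℕ, ∫ t in a..b, ‖∑ n ∈ Finset.range N, ((c n : ℝ) : ℂ) * cexp (-(1/2 + t * cI) * (rlog n))‖^2 ≤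
      (b-a) * DD l + (2 * (rexp 1 * K1)^2 + Z * (rexp 1 * K2)) * rexp ((6/5)*l) := by
    intro N
    refine (hmv (Finset.range N) c hc0 hcz a b hab).trans ?_
    have i1 := mul_le_mul_of_nonneg_left (b1 (Finset.range N)) (sub_nonneg.mpr hab)
    have i2 : (∑ n ∈ Finset.range N, c n * rexp (-(1/2) * rlog n))^2 ≤ (rexp 1 * K1)^2 * rexp ((6/5)*l) := by
      have hn : 0 ≤ ∑ n ∈ Finset.range N, c n * rexp (-(1/2) * rlog n) :=
        Finset.sum_nonneg fun n _ => mul_nonneg (hc0 n) (Real.exp_pos _).le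
      calc _ ≤ (rexp (3/5*l) * (rexp 1 * K1))^2 := by gcongr; exact b2 _
        _ = (rexp 1 * K1)^2 * (rexp (3/5*l) * rexp (3/5*l)) := by ring
        _ = _ := by rw [← Real.exp_add]; ring_nf
    have i3 := mul_le_mul_of_nonneg_left (b3 (Finset.range N)) hZ
    linarith
  have hn := pp_summable l
  set M := ∑' n : ℕ, Λ n * gg (l - rlog n) * rexp (-(1/2) * rlog n) with hM
  have hlim : Tendsto (fun N : ℕ => ∫ t in a..b, ‖∑ n ∈ Finset.range N, ((c n : ℝ) : ℂ) * cexp (-(1/2 + t * cI) * (rlog n))‖^2) atTop (𝓝 (∫ t in a..b, ‖pp l t‖^2)) := by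
    refine intervalIntegral.tendsto_integral_filter_of_dominated_convergence (fun _ => M^2) (Eventually.of_forall fun N => ?_) (Eventually.of_forall fun N => ?_) ?_ ?_
    · exact Continuous.aestronglyMeasurable (by fun_prop)
    · refine Eventually.of_forall fun t _ => ?_
      rw [Real.norm_of_nonneg (sq_nonneg _)]
      have : ‖∑ n ∈ Finset.range N, ((c n : ℝ) : ℂ) * cexp (-(1/2 + t * cI) * (rlog n))‖ ≤ M := by
        refine (norm_sum_le _ _).trans ?_
        simp only [hc, pp_term_norm]
        exact hn.sum_le_tsum _ fun n _ => mul_nonneg (hc0 n) (Real.exp_pos _).le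
      gcongr
    · simp
    · refine Eventually.of_forall fun t _ => ?_
      have h2 : HasSum (fun n : ℕ => ((c n : ℝ) : ℂ) * cexp (-(1/2 + t * cI) * (rlog n))) (pp l t) := by
        have : Summable (fun n : ℕ => ((c n : ℝ) : ℂ) * cexp (-(1/2 + t * cI) * (rlog n))) := by
          apply Summable.of_norm
          refine hn.congr fun n => (pp_term_norm l t n).symm
        exact this.hasSum
      exact (h2.tendsto_sum_nat.norm).pow 2
  exact le_of_tendsto hlim (Eventually.of_forall hfin)

lemma log_succ_diff (N : ℕ) (hN : 1 ≤ N) : rlog N ≤ rlog (N+1:ℕ) ∧ N * (rlog (N+1:ℕ) - rlog N) ≤ 1 := by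
  have h0 : (0:ℝ) < N := by exact_mod_cast hN
  have h1 : (0:ℝ) < (N+1:ℕ) := by positivity
  constructor
  · exact Real.log_le_log h0 (by push_cast; linarith)
  · rw [← Real.log_div h1.ne' h0.ne']
    have := Real.log_le_sub_one_of_pos (div_pos h1 h0)
    calc _ ≤ (N:ℝ) * (((N+1:ℕ):ℝ)/N - 1) := by gcongr
      _ = 1 := by push_cast; field_simp; ring

lemma sum_log_bounds (N : ℕ) (hN : 1 ≤ N) : N * rlog N - N ≤ ∑ n ∈ Finset.Ioc 0 N, rlog n ∧
    ∑ n ∈ Finset.Ioc 0 N, rlog n ≤ N * rlog N := by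
  constructor
  · induction N, hN using Nat.le_induction with
    | base => simp
    | succ N hN ih =>
      rw [Finset.sum_Ioc_succ_top (by omega)]
      have := (log_succ_diff N hN).2
      push_cast at *
      nlinarith
  · calc _ ≤ ∑ n ∈ Finset.Ioc 0 N, rlog N := Finset.sum_le_sum fun n hn => by
          rw [Finset.mem_Ioc] at hn
          exact Real.log_le_log (by exact_mod_cast hn.1) (by exact_mod_cast hn.2)
      _ = _ := by simp

lemma sum_log_eq (N : ℕ) : ∑ n ∈ Finset.Ioc 0 N, rlog n = ∑ n ∈ Finset.Ioc 0 N, Λ n * ((N / n : ℕ) : ℝ) := by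
  rw [← ArithmeticFunction.sum_Ioc_mul_zeta_eq_sum, ArithmeticFunction.vonMangoldt_mul_zeta]
  rfl

lemma mertens1 : ∃ C : ℝ, 0 ≤ C ∧ ∀ N : ℕ, 1 ≤ N → rlog N - 1 ≤ ∑ n ∈ Finset.Ioc 0 N, Λ n / n ∧
    ∑ n ∈ Finset.Ioc 0 N, Λ n / n ≤ rlog N + C := by
  refine ⟨rlog 4 + 4, by have := Real.log_nonneg (by norm_num : (1:ℝ) ≤ 4); linarith, fun N hN => ?_⟩
  have h0 : (0:ℝ) < N := by exact_mod_cast hN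
  obtain ⟨h1, h2⟩ := sum_log_bounds N hN
  rw [sum_log_eq] at h1 h2
  have hΛ : ∀ n : ℕ, (0:ℝ) ≤ Λ n := fun n => ArithmeticFunction.vonMangoldt_nonneg
  have hpsi := Chebyshev.psi_le_const_mul_self h0.le
  have hpe : Chebyshev.psi N = ∑ n ∈ Finset.Ioc 0 N, Λ n := by simp [Chebyshev.psi]
  rw [hpe] at hpsi
  constructor
  · have : ∑ n ∈ Finset.Ioc 0 N, Λ n * ((N / n : ℕ) : ℝ) ≤ N * ∑ n ∈ Finset.Ioc 0 N, Λ n / n := by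
      rw [Finset.mul_sum]
      refine Finset.sum_le_sum fun n _ => ?_
      calc _ ≤ Λ n * ((N:ℝ)/n) := mul_le_mul_of_nonneg_left Nat.cast_div_le (hΛ n)
        _ = _ := by ring
    have h3 : N * (rlog N - 1) ≤ N * ∑ n ∈ Finset.Ioc 0 N, Λ n / n := by linarith
    exact le_of_mul_le_mul_left h3 h0
  · have : N * ∑ n ∈ Finset.Ioc 0 N, Λ n / n - ∑ n ∈ Finset.Ioc 0 N, Λ n ≤ ∑ n ∈ Finset.Ioc 0 N, Λ n * ((N / n : ℕ) : ℝ) := by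
      rw [Finset.mul_sum, ← Finset.sum_sub_distrib]
      refine Finset.sum_le_sum fun n hn => ?_
      rw [Finset.mem_Ioc] at hn
      have hn0 : (0:ℝ) < n := by exact_mod_cast hn.1
      have : (N:ℝ)/n - 1 ≤ ((N/n:ℕ):ℝ) := by
        have h := Nat.lt_div_mul_add (a := N) hn.1
        have h' : (N:ℝ) < (N/n:ℕ) * n + n := by exact_mod_cast h
        rw [sub_le_iff_le_add, div_le_iff₀ hn0]; linarith
      calc _ = Λ n * ((N:ℝ)/n - 1) := by ring
        _ ≤ _ := mul_le_mul_of_nonneg_left this (hΛ n)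
    have h3 : N * ∑ n ∈ Finset.Ioc 0 N, Λ n / n ≤ N * (rlog N + (rlog 4 + 4)) := by linarith
    exact le_of_mul_le_mul_left h3 h0

lemma mertens2 : ∃ C : ℝ, 0 ≤ C ∧ ∀ N : ℕ, 1 ≤ N → ∑ n ∈ Finset.Ioc 0 N, (Λ n)^2 / n ≤ (rlog N)^2/2 + C * rlog N := by
  obtain ⟨C, hC, h⟩ := mertens1
  have key : ∀ N : ℕ, 1 ≤ N → ∑ n ∈ Finset.Ioc 0 N, Λ n / n * rlog n ≤
      (∑ n ∈ Finset.Ioc 0 N, Λ n / n) * rlog N - (rlog N)^2/2 + 3/2 * rlog N := by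
    intro N hN
    induction N, hN using Nat.le_induction with
    | base => simp
    | succ N hN ih =>
      rw [Finset.sum_Ioc_succ_top (by omega), Finset.sum_Ioc_succ_top (by omega)]
      obtain ⟨h1, h2⟩ := log_succ_diff N hN
      have h3 := (h N hN).1
      set M := ∑ n ∈ Finset.Ioc 0 N, Λ n / n
      set x := rlog N
      set y := rlog (N+1:ℕ)
      have h4 : y - x ≤ 1 := by
        have : (1:ℝ) ≤ N := by exact_mod_cast hN
        nlinarith
      nlinarith [mul_nonneg (sub_nonneg.mpr h1) (by linarith : 0 ≤ M - x + 3/2 - (y-x)/2)]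
  refine ⟨C + 3/2, by linarith, fun N hN => ?_⟩
  have hl : 0 ≤ rlog N := Real.log_natCast_nonneg N
  calc _ ≤ ∑ n ∈ Finset.Ioc 0 N, Λ n / n * rlog n := Finset.sum_le_sum fun n _ => by
        have h1 : Λ n ≤ rlog n := ArithmeticFunction.vonMangoldt_le_log
        have h0 : (0:ℝ) ≤ Λ n := ArithmeticFunction.vonMangoldt_nonneg
        calc _ = Λ n / n * Λ n := by ring
          _ ≤ _ := by gcongr
    _ ≤ _ := key N hN
    _ ≤ (rlog N + C) * rlog N - (rlog N)^2/2 + 3/2 * rlog N := by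
        have := mul_le_mul_of_nonneg_right (h N hN).2 hl
        linarith
    _ = _ := by ring

lemma gg_sq_eq (l : ℝ) : (gg l)^2 = (1/(2*rpi)) * rexp (-1 * l^2) := by
  unfold gg
  rw [div_pow, Real.sq_sqrt (by positivity), ← Real.exp_nat_mul]
  rw [show ((2:ℕ):ℝ) * (-l^2/2) = -1 * l^2 by push_cast; ring]; ring

lemma gg_sq_int : Integrable (fun l => (gg l)^2) ∧ ∫ l, (gg l)^2 = 1/(2*rsq rpi) := by
  simp_rw [gg_sq_eq]
  refine ⟨(integrable_exp_neg_mul_sq (by norm_num)).const_mul _, ?_⟩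
  rw [integral_const_mul, integral_gaussian, div_one]
  have h : rsq rpi ≠ 0 := (Real.sqrt_pos.mpr Real.pi_pos).ne'
  have h2 : rpi = rsq rpi * rsq rpi := (Real.mul_self_sqrt Real.pi_pos.le).symm
  set q := rsq rpi
  rw [h2]; field_simp

lemma DD_tail_term (l b : ℝ) (n : ℕ) (hb : 0 ≤ b) (hl : b ≤ rlog n - l) : (Λ n * gg (l - rlog n) * rexp (-(1/2) * rlog n))^2 ≤
    rexp (1 + l/10 - b^2/2) * ((Λ n)^2 * rexp (-(11/10) * rlog n)) := by
  rw [mul_pow, mul_pow, gg_sq_eq, ← Real.exp_nat_mul]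
  have hp : 1/(2*rpi) ≤ 1 := by
    rw [div_le_one (by positivity)]; linarith [Real.pi_gt_three]
  set x := rlog n
  have h1 : rexp (-1*(l-x)^2) ≤ rexp (1 + l/10 - b^2/2 - x/10) := by
    apply Real.exp_le_exp.mpr
    nlinarith [sq_nonneg (x-l-1/10), mul_self_le_mul_self hb hl]
  calc _ ≤ (Λ n)^2 * (1 * rexp (1 + l/10 - b^2/2 - x/10)) * rexp ((2:ℕ) * (-(1/2)*x)) := by gcongr
    _ = (Λ n)^2 * (rexp (1 + l/10 - b^2/2 - x/10) * rexp ((2:ℕ) * (-(1/2)*x))) := by ring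
    _ = (Λ n)^2 * rexp ((1 + l/10 - b^2/2) + -(11/10)*x) := by rw [← Real.exp_add]; congr 2; push_cast; ring
    _ = _ := by rw [Real.exp_add]; ring

lemma DD_int : ∃ C : ℝ, 0 ≤ C ∧ ∀ v b : ℝ, 0 ≤ v → 0 ≤ b →
    ∫ l in (0:ℝ)..v, DD l ≤ 1/(2*rsq rpi) * ((v+b)^2/2 + C*(v+b)) + C * (v * rexp (v/10 - b^2/2)) := by
  obtain ⟨C, hC, hm⟩ := mertens2
  set K2 := ∑' n : ℕ, (Λ n)^2 * rexp (-(11/10) * rlog n) with hK2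
  have hK20 : 0 ≤ K2 := tsum_nonneg fun n => by positivity
  refine ⟨C + rexp 1 * K2, by positivity, fun v b hv hb => ?_⟩
  set N := ⌊rexp (v+b)⌋₊ with hN
  have hN1 : 1 ≤ N := by
    rw [hN, Nat.one_le_floor_iff]; exact Real.one_le_exp (by linarith)
  set E := rexp (1 + v/10 - b^2/2) * K2 with hE
  have hpt : ∀ l ∈ Icc 0 v, DD l ≤ ∑ n ∈ Finset.Ioc 0 N, ((Λ n)^2/n) * (gg (l - rlog n))^2 + E := by
    intro l hl
    have hs1 : Summable (fun n : ℕ => if n ∈ Finset.Ioc 0 N then ((Λ n)^2/n) * (gg (l - rlog n))^2 else 0) := by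
      apply summable_of_finite_support
      exact (Finset.Ioc 0 N).finite_toSet.subset fun n hn => by
        by_contra h; exact hn (if_neg h)
    have he : ∑' n : ℕ, (if n ∈ Finset.Ioc 0 N then ((Λ n)^2/n) * (gg (l - rlog n))^2 else 0) = ∑ n ∈ Finset.Ioc 0 N, ((Λ n)^2/n) * (gg (l - rlog n))^2 := by
      rw [tsum_eq_sum (s := Finset.Ioc 0 N) (fun n hn => if_neg hn)]
      exact Finset.sum_congr rfl fun n hn => if_pos hn
    have hs2 := LamS.2.mul_left (rexp (1 + v/10 - b^2/2))
    rw [← he, hE, hK2, ← tsum_mul_left, ← hs1.tsum_add hs2]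
    refine (DD_summable l).tsum_le_tsum (fun n => ?_) (hs1.add hs2)
    by_cases hn : n ∈ Finset.Ioc 0 N
    · rw [if_pos hn]
      rw [Finset.mem_Ioc] at hn
      have hn0 : (0:ℝ) < n := by exact_mod_cast hn.1
      have e : (Λ n * gg (l - rlog n) * rexp (-(1/2) * rlog n))^2 = ((Λ n)^2/n) * (gg (l - rlog n))^2 := by
        rw [mul_pow, mul_pow, ← Real.exp_nat_mul, show ((2:ℕ):ℝ) * (-(1/2) * rlog n) = - rlog n by push_cast; ring, Real.exp_neg, Real.exp_log hn0]
        field_simp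
      rw [e]
      have : 0 ≤ rexp (1 + v/10 - b^2/2) * ((Λ n)^2 * rexp (-(11/10) * rlog n)) := by positivity
      linarith
    · rw [if_neg hn, zero_add]
      rcases Nat.eq_zero_or_pos n with rfl | hn1
      · simp
      have hn2 : N < n := by simp [Finset.mem_Ioc] at hn; exact hn hn1
      have hn3 : rexp (v+b) < n := (Nat.floor_lt (Real.exp_pos _).le).mp hn2
      have hn4 : v + b ≤ rlog n := by
        rw [Real.le_log_iff_exp_le (by exact_mod_cast hn1)]; exact hn3.le
      refine (DD_tail_term l b n hb (by linarith [hl.2])).trans ?_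
      have := hl.2
      gcongr
  have hgi : ∀ x : ℝ, ∫ l in (0:ℝ)..v, (gg (l - x))^2 ≤ 1/(2*rsq rpi) := by
    intro x
    rw [intervalIntegral.integral_of_le hv, ← gg_sq_int.2, ← integral_sub_right_eq_self (fun l => (gg l)^2) x]
    exact setIntegral_le_integral (gg_sq_int.1.comp_sub_right x) (Eventually.of_forall fun l => sq_nonneg _)
  have hgc := gg_cont
  have hlog : rlog N ≤ v + b := by
    rw [Real.log_le_iff_le_exp (by exact_mod_cast hN1)]
    exact Nat.floor_le (Real.exp_pos _).le
  have hl0 : 0 ≤ rlog N := Real.log_natCast_nonneg N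
  calc _ ≤ ∫ l in (0:ℝ)..v, (∑ n ∈ Finset.Ioc 0 N, ((Λ n)^2/n) * (gg (l - rlog n))^2 + E) :=
        intervalIntegral.integral_mono_on hv (DD_cont.intervalIntegrable _ _) (Continuous.intervalIntegrable (by fun_prop) _ _) hpt
    _ = (∑ n ∈ Finset.Ioc 0 N, ((Λ n)^2/n) * ∫ l in (0:ℝ)..v, (gg (l - rlog n))^2) + v * E := by
        rw [intervalIntegral.integral_add (Continuous.intervalIntegrable (by fun_prop) _ _) (by simp), intervalIntegral.integral_finsetSum (fun n _ => Continuous.intervalIntegrable (by fun_prop) _ _)]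
        simp
    _ ≤ (∑ n ∈ Finset.Ioc 0 N, ((Λ n)^2/n) * (1/(2*rsq rpi))) + v * E := by
        gcongr; exact hgi _
    _ = 1/(2*rsq rpi) * (∑ n ∈ Finset.Ioc 0 N, ((Λ n)^2/n)) + v * E := by rw [← Finset.sum_mul]; ring
    _ ≤ 1/(2*rsq rpi) * ((v+b)^2/2 + C * (v+b)) + v * E := by
        have := hm N hN1
        have h2 : (rlog N)^2/2 + C * rlog N ≤ (v+b)^2/2 + C*(v+b) := by gcongr
        gcongr; linarith
    _ ≤ _ := by
        have e : v * E = (rexp 1 * K2) * (v * rexp (v/10 - b^2/2)) := by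
          rw [hE, show 1 + v/10 - b^2/2 = 1 + (v/10-b^2/2) by ring, Real.exp_add]; ring
        rw [e]
        have h5 : 0 ≤ C * (v * rexp (v/10 - b^2/2)) := by positivity
        have h6 : C * (v+b) ≤ (C + rexp 1 * K2) * (v+b) := by
          gcongr; have : 0 ≤ rexp 1 * K2 := by positivity
          linarith
        have h7 : 1/(2*rsq rpi) * ((v+b)^2/2 + C * (v+b)) ≤ 1/(2*rsq rpi) * ((v+b)^2/2 + (C + rexp 1 * K2) * (v+b)) := by
          gcongr
        linarith

noncomputable def kap (a : ℝ) : ℝ := 1 - (11/10)*a + (1/10)*a^2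

lemma kap_nonneg (a : ℝ) (h1 : a ≤ 1) : 0 ≤ kap a := by
  unfold kap; nlinarith
lemma kap_cont : Continuous kap := by unfold kap; fun_prop

noncomputable def KK (Y : ℂ) : ℂ := ∫ a in (0:ℝ)..1, (kap a : ℂ) * Complex.cosh (a * Y)

lemma KK_eq (Y : ℂ) (hY : Y ≠ 0) : KK Y = ((9/10) * Complex.cosh Y - 11/10 + (1/5) * (Complex.sinh Y / Y)) / Y^2 := by
  have hd : ∀ a : ℝ, HasDerivAt (fun x : ℝ => (kap x : ℂ) * Complex.sinh (x*Y) / Y - (-(11/10) + (1/5)*(x:ℂ)) * Complex.cosh (x*Y) / Y^2 + (1/5) * Complex.sinh (x*Y) / Y^3)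
      ((kap a : ℂ) * Complex.cosh (a * Y)) a := by
    intro a
    have e : HasDerivAt (fun z : ℂ => (1 - (11/10)*z + (1/10)*z^2) * Complex.sinh (z*Y) / Y - (-(11/10) + (1/5)*z) * Complex.cosh (z*Y) / Y^2 + (1/5) * Complex.sinh (z*Y) / Y^3)
        ((1 - (11/10)*(a:ℂ) + (1/10)*(a:ℂ)^2) * Complex.cosh (a * Y)) (a:ℂ) := by
      have h1 : HasDerivAt (fun z : ℂ => Complex.sinh (z*Y)) (Complex.cosh (a*Y) * Y) (a:ℂ) := by
        have := HasDerivAt.csinh ((hasDerivAt_id (a:ℂ)).mul_const Y)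
        exact this.congr_deriv (by simp)
      have h2 : HasDerivAt (fun z : ℂ => Complex.cosh (z*Y)) (Complex.sinh (a*Y) * Y) (a:ℂ) := by
        have := HasDerivAt.ccosh ((hasDerivAt_id (a:ℂ)).mul_const Y)
        exact this.congr_deriv (by simp)
      have h3 : HasDerivAt (fun z : ℂ => 1 - (11/10)*z + (1/10)*z^2) (-(11/10) + (1/5)*(a:ℂ)) (a:ℂ) := by
        have := (((hasDerivAt_id (a:ℂ)).const_mul (11/10)).const_sub 1).add (((hasDerivAt_id (a:ℂ)).pow 2).const_mul (1/10))
        refine this.congr_deriv ?_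
        simp; ring
      have h4 : HasDerivAt (fun z : ℂ => -(11/10) + (1/5)*z) (1/5) (a:ℂ) := by
        have := ((hasDerivAt_id (a:ℂ)).const_mul (1/5)).const_add (-(11/10))
        exact this.congr_deriv (by simp)
      refine ((((h3.mul h1).div_const Y).sub ((h4.mul h2).div_const (Y^2))).add ((h1.const_mul (1/5)).div_const (Y^3))).congr_deriv ?_
      field_simp; ring
    have h := e.comp_ofReal
    have ek : ((kap a : ℝ) : ℂ) = 1 - (11/10)*(a:ℂ) + (1/10)*(a:ℂ)^2 := by unfold kap; push_cast; ring
    have ekx : ∀ x : ℝ, ((kap x : ℝ) : ℂ) = 1 - (11/10)*(x:ℂ) + (1/10)*(x:ℂ)^2 := by intro x; unfold kap; push_cast; ring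
    simp_rw [ekx]; exact h
  have hk := kap_cont
  rw [KK, intervalIntegral.integral_eq_sub_of_hasDerivAt (fun a _ => hd a) (Continuous.intervalIntegrable (by fun_prop) _ _)]
  simp [kap]
  field_simp; ring

lemma X0_lower (y : ℝ) (hy : 1 ≤ |y|) : 1/10 ≤ 11/10 - (9/10) * Real.cos y - (1/5) * (Real.sin y / y) := by
  have hs : Real.sin y / y ≤ 1 / |y| := by
    calc _ ≤ |Real.sin y / y| := le_abs_self _
      _ = |Real.sin y| / |y| := abs_div _ _
      _ ≤ _ := by gcongr; exact Real.abs_sin_le_one y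
  rcases le_total 2 |y| with h | h
  · have : 1/|y| ≤ 1/2 := by gcongr
    linarith [Real.cos_le_one y]
  · have : 1/|y| ≤ 1 := by rw [div_le_one (by linarith)]; exact hy
    have hc : Real.cos y ≤ 5/9 := by
      rw [← Real.cos_abs]
      refine le_trans (Real.cos_le_cos_of_nonneg_of_le_pi (by norm_num) (by linarith [Real.pi_gt_three]) hy) Real.cos_one_le
    linarith

lemma hyp_small (c : ℝ) (hc : |c| ≤ 1/1000) : |Real.cosh c - 1| ≤ 1/500 ∧ |Real.sinh c| ≤ 1/500 := by
  have h1 := Real.abs_exp_sub_one_le (x := c) (by linarith)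
  have h2 := Real.abs_exp_sub_one_le (x := -c) (by rw [abs_neg]; linarith)
  rw [abs_neg] at h2
  rw [Real.cosh_eq, Real.sinh_eq]
  rw [abs_le] at h1 h2
  rw [abs_le, abs_le]
  refine ⟨⟨?_, ?_⟩, ⟨?_, ?_⟩⟩ <;> linarith [h1.1, h1.2, h2.1, h2.2]

lemma re_cosh (ζ c y : ℝ) : (cexp (ζ * cI) * Complex.cosh (c + y * cI)).re =
    Real.cos ζ * (Real.cosh c * Real.cos y) - Real.sin ζ * (Real.sinh c * Real.sin y) := by
  rw [Complex.cosh_add, Complex.cosh_mul_I, Complex.sinh_mul_I, Complex.exp_mul_I, ← Complex.ofReal_cosh, ← Complex.ofReal_sinh, ← Complex.ofReal_cos, ← Complex.ofReal_sin, ← Complex.ofReal_cos, ← Complex.ofReal_sin]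
  simp only [Complex.mul_re, Complex.add_re, Complex.add_im, Complex.mul_im, Complex.ofReal_re, Complex.ofReal_im, Complex.I_re, Complex.I_im]; ring

lemma KK_re (ζ c y : ℝ) : (cexp (ζ * cI) * KK (c + y * cI)).re =
    ∫ a in (0:ℝ)..1, kap a * (Real.cos ζ * (Real.cosh (a*c) * Real.cos (a*y)) - Real.sin ζ * (Real.sinh (a*c) * Real.sin (a*y))) := by
  have hk := kap_cont
  rw [KK, ← intervalIntegral.integral_const_mul]
  have h := (Complex.reCLM.intervalIntegral_comp_comm (f := fun a : ℝ => cexp (ζ * cI) * ((kap a : ℂ) * Complex.cosh (a * (c + y * cI)))) (a := 0) (b := 1) (μ := volume) (Continuous.intervalIntegrable (by fun_prop) _ _)).symm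
  simp only [Complex.reCLM_apply] at h
  rw [h]
  congr 1; ext a
  rw [← re_cosh ζ (a*c) (a*y), ← Complex.re_ofReal_mul]
  congr 1; push_cast; rw [show (a:ℂ) * (c + y * cI) = a*c + a*y*cI by ring]; ring

lemma kern_pos (c y ζ : ℝ) (hc : |c| ≤ 1/1000) (hζ : |ζ| ≤ 1/2000) :
    0 ≤ (cexp (ζ * cI) * KK (c + y * cI)).re := by
  rcases le_total |y| 1 with hy | hy
  · rw [KK_re]
    refine intervalIntegral.integral_nonneg (by norm_num) fun a ha => mul_nonneg (kap_nonneg a ha.2) ?_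
    have hay : |a*y| ≤ 1 := by rw [abs_mul, abs_of_nonneg ha.1]; nlinarith [ha.1, ha.2, abs_nonneg y]
    have hac : |a*c| ≤ 1/1000 := by rw [abs_mul, abs_of_nonneg ha.1]; nlinarith [ha.1, ha.2, abs_nonneg c]
    have h1 : 1/2 ≤ Real.cos (a*y) := by
      have := Real.one_sub_sq_div_two_le_cos (x := a*y)
      have h2 : (a*y)^2 ≤ 1 := by rw [← sq_abs]; nlinarith [abs_nonneg (a*y)]
      linarith
    have h2 : 1/2 ≤ Real.cos ζ := by
      have := Real.one_sub_sq_div_two_le_cos (x := ζ)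
      have h2 : ζ^2 ≤ 1 := by rw [← sq_abs]; nlinarith [abs_nonneg ζ]
      linarith
    have h3 := Real.one_le_cosh (a*c)
    have h4 : 1/4 ≤ Real.cos ζ * (Real.cosh (a*c) * Real.cos (a*y)) := by
      have : 1/2 ≤ Real.cosh (a*c) * Real.cos (a*y) := by nlinarith
      nlinarith
    have h5 : |Real.sin ζ * (Real.sinh (a*c) * Real.sin (a*y))| ≤ 1 * (1/500 * 1) := by
      rw [abs_mul, abs_mul]
      have i1 := Real.abs_sin_le_one ζ
      have i2 := Real.abs_sin_le_one (a*y)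
      have i3 := (hyp_small _ hac).2
      gcongr
    linarith [(abs_le.mp h5).2]
  · set Y : ℂ := c + y * cI with hYd
    have hy0 : y ≠ 0 := by rintro rfl; simp at hy; linarith
    have him : Y.im = y := by simp [hYd]
    have hY : Y ≠ 0 := by intro h; rw [h] at him; simp at him; exact hy0 him.symm
    have hYn : |y| ≤ ‖Y‖ := by rw [← him]; exact Complex.abs_im_le_norm Y
    have hyc : (y:ℂ) ≠ 0 := by exact_mod_cast hy0
    set p := cexp (ζ * cI) with hp
    have hp1 : ‖p - 1‖ ≤ 1/2000 := by
      have := Real.norm_exp_I_mul_ofReal_sub_one_le (x := ζ)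
      rw [mul_comm cI, Real.norm_eq_abs] at this
      exact this.trans hζ
    set q : ℂ := -p * y^2 / Y^2 with hq
    have hy2 : (y:ℝ)^2 = |y|^2 := (sq_abs y).symm
    have hq1 : ‖q - 1‖ ≤ 3/1000 := by
      have e : q - 1 = (-(y:ℂ)^2 * (p - 1) - c^2 - 2*c*y*cI) / Y^2 := by
        rw [hq, eq_div_iff (pow_ne_zero 2 hY), sub_mul, div_mul_cancel₀ _ (pow_ne_zero 2 hY), hYd]
        linear_combination (-(y:ℂ)^2) * Complex.I_sq
      rw [e, norm_div, norm_pow, div_le_iff₀ (by positivity)]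
      have hn : ‖-(y:ℂ)^2 * (p - 1) - c^2 - 2*c*y*cI‖ ≤ |y|^2 * (1/2000) + (1/1000)^2 + 2 * (1/1000) * |y| := by
        refine (norm_sub_le _ _).trans (add_le_add ((norm_sub_le _ _).trans (add_le_add ?_ ?_)) ?_)
        · rw [norm_mul, norm_neg, norm_pow, Complex.norm_real, Real.norm_eq_abs]; gcongr
        · rw [norm_pow, Complex.norm_real, Real.norm_eq_abs]; gcongr
        · simp only [norm_mul, Complex.norm_real, Real.norm_eq_abs, Complex.norm_I, mul_one, Complex.norm_ofNat]; gcongr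
      have : |y|^2 ≤ ‖Y‖^2 := by gcongr
      nlinarith
    set X : ℝ := 11/10 - (9/10) * Real.cos y - (1/5) * (Real.sin y / y) with hX
    have hX1 := X0_lower y hy
    obtain ⟨k1, k2⟩ := hyp_small c hc
    have hcosh : ‖Complex.cosh Y - Real.cos y‖ ≤ 1/250 := by
      have e : Complex.cosh Y - Real.cos y = (((Real.cosh c - 1) * Real.cos y : ℝ) : ℂ) + ((Real.sinh c * Real.sin y : ℝ) : ℂ) * cI := by
        rw [hYd, Complex.cosh_add, Complex.cosh_mul_I, Complex.sinh_mul_I]; push_cast; ring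
      rw [e]
      refine (norm_add_le _ _).trans ?_
      rw [norm_mul, Complex.norm_I, mul_one, Complex.norm_real, Complex.norm_real, Real.norm_eq_abs, Real.norm_eq_abs, abs_mul, abs_mul]
      have i1 := Real.abs_sin_le_one y
      have i2 := Real.abs_cos_le_one y
      have j1 := mul_le_mul k1 i2 (abs_nonneg _) (by norm_num)
      have j2 := mul_le_mul k2 i1 (abs_nonneg _) (by norm_num)
      linarith
    have hsinh : ‖Complex.sinh Y - Real.sin y * cI‖ ≤ 1/250 := by
      have e : Complex.sinh Y - Real.sin y * cI = ((Real.sinh c * Real.cos y : ℝ) : ℂ) + (((Real.cosh c - 1) * Real.sin y : ℝ) : ℂ) * cI := by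
        rw [hYd, Complex.sinh_add, Complex.cosh_mul_I, Complex.sinh_mul_I]; push_cast; ring
      rw [e]
      refine (norm_add_le _ _).trans ?_
      rw [norm_mul, Complex.norm_I, mul_one, Complex.norm_real, Complex.norm_real, Real.norm_eq_abs, Real.norm_eq_abs, abs_mul, abs_mul]
      have i1 := Real.abs_sin_le_one y
      have i2 := Real.abs_cos_le_one y
      have j1 := mul_le_mul k2 i2 (abs_nonneg _) (by norm_num)
      have j2 := mul_le_mul k1 i1 (abs_nonneg _) (by norm_num)
      linarith
    have hsq : ‖Complex.sinh Y / Y - ((Real.sin y / y : ℝ) : ℂ)‖ ≤ 1/200 := by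
      have e : Complex.sinh Y / Y - ((Real.sin y / y : ℝ) : ℂ) = (y * (Complex.sinh Y - Real.sin y * cI) - c * Real.sin y) / (Y * y) := by
        rw [eq_div_iff (mul_ne_zero hY hyc)]; push_cast; field_simp; rw [hYd]; ring
      rw [e, norm_div, norm_mul, Complex.norm_real, Real.norm_eq_abs, div_le_iff₀ (by positivity)]
      have hn : ‖y * (Complex.sinh Y - Real.sin y * cI) - c * Real.sin y‖ ≤ |y| * (1/250) + 1/1000 * 1 := by
        refine (norm_sub_le _ _).trans (add_le_add ?_ ?_)
        · rw [norm_mul, Complex.norm_real, Real.norm_eq_abs]; gcongr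
        · rw [norm_mul, Complex.norm_real, Real.norm_eq_abs, Complex.norm_real, Real.norm_eq_abs]
          have := Real.abs_sin_le_one y
          gcongr
      have : |y| * |y| ≤ ‖Y‖ * |y| := by gcongr
      nlinarith
    set H : ℂ := (9/10) * Complex.cosh Y - 11/10 + (1/5) * (Complex.sinh Y / Y) with hH
    have hHX : ‖-H - X‖ ≤ 1/200 := by
      have e : -H - X = -((9/10) * (Complex.cosh Y - Real.cos y)) - (1/5) * (Complex.sinh Y / Y - ((Real.sin y / y : ℝ) : ℂ)) := by
        rw [hH, hX]; push_cast; ring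
      rw [e]
      refine (norm_sub_le _ _).trans ?_
      rw [norm_neg, norm_mul, norm_mul]
      have n1 : ‖(9/10:ℂ)‖ = 9/10 := by norm_num
      have n2 : ‖(1/5:ℂ)‖ = 1/5 := by norm_num
      rw [n1, n2]; linarith
    have hX2 : |X| ≤ 3 := by
      have : |Real.sin y / y| ≤ 1 := by
        rw [abs_div, div_le_one (by positivity)]; exact (Real.abs_sin_le_one y).trans hy
      rw [abs_le] at this ⊢
      constructor <;> linarith [Real.neg_one_le_cos y, Real.cos_le_one y]
    have e : p * KK Y = (-H) * q / (y^2 : ℝ) := by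
      rw [KK_eq Y hY, ← hH, hq]; push_cast; field_simp
    rw [e, Complex.div_ofReal_re]
    refine div_nonneg ?_ (sq_nonneg y)
    have e2 : -H * q = X + ((-H - X) * q + X * (q - 1)) := by ring
    have hqn : ‖q‖ ≤ 2 := by
      calc ‖q‖ = ‖(q-1) + 1‖ := by ring_nf
        _ ≤ ‖q-1‖ + 1 := by simpa using norm_add_le (q-1) 1
        _ ≤ _ := by linarith
    have hn : ‖(-H - X) * q + X * (q - 1)‖ ≤ 1/200 * 2 + 3 * (3/1000) := by
      refine (norm_add_le _ _).trans (add_le_add ?_ ?_)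
      · rw [norm_mul]; gcongr
      · rw [norm_mul, Complex.norm_real, Real.norm_eq_abs]; gcongr
    rw [e2, Complex.add_re, Complex.ofReal_re]
    have := (abs_le.mp ((Complex.abs_re_le_norm _).trans hn)).1
    linarith

lemma kern_diag (c : ℝ) : 29/60 ≤ (KK c).re := by
  have h := KK_re 0 c 0
  simp only [Complex.ofReal_zero, zero_mul, Complex.exp_zero, one_mul, add_zero, mul_zero, Real.cos_zero, Real.sin_zero, mul_one, sub_zero] at h
  rw [h]
  have e : ∫ a in (0:ℝ)..1, kap a = 29/60 := by
    unfold kap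
    rw [intervalIntegral.integral_add (Continuous.intervalIntegrable (by fun_prop) _ _) (Continuous.intervalIntegrable (by fun_prop) _ _),
      intervalIntegral.integral_sub (Continuous.intervalIntegrable (by fun_prop) _ _) (Continuous.intervalIntegrable (by fun_prop) _ _)]
    rw [intervalIntegral.integral_const_mul, intervalIntegral.integral_const_mul, integral_id, integral_pow]; norm_num
  rw [← e]
  have hk := kap_cont
  refine intervalIntegral.integral_mono_on (by norm_num) (hk.intervalIntegrable _ _) (Continuous.intervalIntegrable (by fun_prop) _ _) fun a ha => ?_
  nlinarith [Real.one_le_cosh (a*c), kap_nonneg a ha.2]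

noncomputable def ww (ρ ρ' : ℂ) : ℂ := ρ + cJ ρ' - 1
noncomputable def FF (T l : ℝ) : ℝ := ∫ t : ℝ, ‖Sloc T l t‖^2

lemma Sloc_cont (T l : ℝ) : Continuous (Sloc T l) := by
  have := EE_cont l
  unfold Sloc; fun_prop

lemma EE_pair (l t : ℝ) (ρ ρ' : ℂ) : EE l (ρ - (1/2 + t * cI)) * cJ (EE l (ρ' - (1/2 + t * cI))) =
    cexp ((-1) * (t:ℂ)^2 + (-(ρ - cJ ρ') * cI) * t + (l * ww ρ ρ' + ((ρ-1/2)^2 + (cJ ρ' - 1/2)^2)/2)) := by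
  unfold EE ww
  rw [← Complex.exp_conj, ← Complex.exp_add]
  congr 1
  simp only [map_add, map_mul, map_div₀, map_pow, map_sub, Complex.conj_ofReal, Complex.conj_I, map_one, map_ofNat]
  linear_combination ((t:ℂ)^2) * Complex.I_sq

lemma norm_Sloc (T l t : ℝ) : ((‖Sloc T l t‖^2 : ℝ) : ℂ) = ∑ ρ ∈ bd T, ∑ ρ' ∈ bd T, ((mu ρ : ℂ) * mu ρ') *
    cexp ((-1) * (t:ℂ)^2 + (-(ρ - cJ ρ') * cI) * t + (l * ww ρ ρ' + ((ρ-1/2)^2 + (cJ ρ' - 1/2)^2)/2)) := by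
  have h : ((‖Sloc T l t‖^2 : ℝ) : ℂ) = Sloc T l t * cJ (Sloc T l t) := by
    rw [Complex.mul_conj, Complex.normSq_eq_norm_sq]
  rw [h, Sloc, map_sum, Finset.sum_mul_sum]
  refine Finset.sum_congr rfl fun ρ _ => Finset.sum_congr rfl fun ρ' _ => ?_
  rw [← EE_pair, map_mul, Complex.conj_natCast]; ring

lemma FF_eq (T l : ℝ) : Integrable (fun t : ℝ => ‖Sloc T l t‖^2) ∧
    FF T l = rsq rpi * ∑ ρ ∈ bd T, ∑ ρ' ∈ bd T, ((mu ρ : ℝ) * mu ρ') * (cexp (l * ww ρ ρ' + (ww ρ ρ')^2/4)).re := by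
  have hint : ∀ ρ ρ' : ℂ, Integrable (fun t : ℝ => ((mu ρ : ℂ) * mu ρ') *
    cexp ((-1) * (t:ℂ)^2 + (-(ρ - cJ ρ') * cI) * t + (l * ww ρ ρ' + ((ρ-1/2)^2 + (cJ ρ' - 1/2)^2)/2))) := by
    intro ρ ρ'
    exact (integrable_cexp_quadratic' (by norm_num) _ _).const_mul _
  have hI : Integrable (fun t : ℝ => ((‖Sloc T l t‖^2 : ℝ) : ℂ)) := by
    simp_rw [norm_Sloc]
    exact integrable_finsetSum _ fun ρ _ => integrable_finsetSum _ fun ρ' _ => hint ρ ρ'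
  refine ⟨by have h := hI.re; simpa only [RCLike.re_to_complex, Complex.ofReal_re] using h, ?_⟩
  have hE : ((FF T l : ℝ) : ℂ) = ((rsq rpi : ℝ) : ℂ) * ∑ ρ ∈ bd T, ∑ ρ' ∈ bd T, ((mu ρ : ℂ) * mu ρ') * cexp (l * ww ρ ρ' + (ww ρ ρ')^2/4) := by
    rw [FF, ← integral_complex_ofReal]
    simp_rw [norm_Sloc]
    rw [integral_finsetSum _ fun ρ _ => integrable_finsetSum _ fun ρ' _ => hint ρ ρ', Finset.mul_sum]
    refine Finset.sum_congr rfl fun ρ _ => ?_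
    rw [integral_finsetSum _ fun ρ' _ => hint ρ ρ', Finset.mul_sum]
    refine Finset.sum_congr rfl fun ρ' _ => ?_
    rw [integral_const_mul, integral_cexp_quadratic (by norm_num)]
    have h3 : ((rpi:ℂ) / -(-1)) ^ (1/2 : ℂ) = (rsq rpi : ℝ) := by
      rw [Real.sqrt_eq_rpow, Complex.ofReal_cpow (by positivity)]
      congr 1
      · push_cast; ring
      · push_cast; rfl
    rw [h3]
    have : (l * ww ρ ρ' + ((ρ-1/2)^2 + (cJ ρ' - 1/2)^2)/2) - (-(ρ - cJ ρ') * cI)^2 / (4 * -1) = l * ww ρ ρ' + (ww ρ ρ')^2/4 := by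
      unfold ww
      linear_combination ((ρ - cJ ρ')^2/4) * Complex.I_sq
    rw [this]; ring
  have := congrArg Complex.re hE
  rw [Complex.ofReal_re, Complex.re_ofReal_mul, Complex.re_sum] at this
  rw [this]; congr 1
  refine Finset.sum_congr rfl fun ρ _ => ?_
  rw [Complex.re_sum]
  refine Finset.sum_congr rfl fun ρ' _ => ?_
  rw [← Complex.ofReal_natCast, ← Complex.ofReal_natCast, ← Complex.ofReal_mul, Complex.re_ofReal_mul]

lemma FF_cont (T : ℝ) : Continuous (FF T) := by
  have : FF T = fun l => _ := funext fun l => (FF_eq T l).2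
  rw [this]; fun_prop

noncomputable def QQ (T V : ℝ) : ℝ := ∫ l in (0:ℝ)..V, kap (l/V) * (FF T l + FF T (-l))

lemma pair_int (V : ℝ) (hV : 0 < V) (w : ℂ) :
    ∫ l in (0:ℝ)..V, kap (l/V) * ((cexp (l * w + w^2/4)).re + (cexp ((-l:ℝ) * w + w^2/4)).re) = 2 * V * (cexp (w^2/4) * KK (V * w)).re := by
  have hk := kap_cont
  have h1 : ∀ l : ℝ, kap (l/V) * ((cexp (l * w + w^2/4)).re + (cexp ((-l:ℝ) * w + w^2/4)).re) =
      (fun a : ℝ => 2 * (cexp (w^2/4) * ((kap a : ℂ) * Complex.cosh (a * (V*w)))).re) (l/V) := by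
    intro l
    have e : (l:ℂ) * w = ((l/V:ℝ):ℂ) * (V * w) := by
      push_cast
      have : (V:ℂ) ≠ 0 := by exact_mod_cast hV.ne'
      field_simp
    simp only
    rw [← Complex.add_re, Complex.ofReal_neg, neg_mul, e, Complex.exp_add, Complex.exp_add, Complex.cosh]
    rw [← Complex.re_ofReal_mul, ← Complex.re_ofReal_mul]
    congr 1; push_cast; ring
  simp_rw [h1]
  rw [intervalIntegral.integral_comp_div (fun a : ℝ => 2 * (cexp (w^2/4) * ((kap a : ℂ) * Complex.cosh (a * (V*w)))).re) hV.ne', zero_div, div_self hV.ne', smul_eq_mul, intervalIntegral.integral_const_mul]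
  have h := (Complex.reCLM.intervalIntegral_comp_comm (f := fun a : ℝ => cexp (w^2/4) * ((kap a : ℂ) * Complex.cosh (a * (V*w)))) (a := 0) (b := 1) (μ := volume) (Continuous.intervalIntegrable (by fun_prop) _ _))
  simp only [Complex.reCLM_apply] at h
  rw [h, intervalIntegral.integral_const_mul, KK]; ring

lemma QQ_eq (T V : ℝ) (hV : 0 < V) : QQ T V = rsq rpi * ∑ ρ ∈ bd T, ∑ ρ' ∈ bd T, ((mu ρ : ℝ) * mu ρ') * (2 * V * (cexp ((ww ρ ρ')^2/4) * KK (V * ww ρ ρ')).re) := by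
  have hk := kap_cont
  have h1 : ∀ l : ℝ, kap (l/V) * (FF T l + FF T (-l)) = rsq rpi * ∑ ρ ∈ bd T, ∑ ρ' ∈ bd T, ((mu ρ : ℝ) * mu ρ') *
      (kap (l/V) * ((cexp (l * ww ρ ρ' + (ww ρ ρ')^2/4)).re + (cexp ((-l:ℝ) * ww ρ ρ' + (ww ρ ρ')^2/4)).re)) := by
    intro l
    rw [(FF_eq T l).2, (FF_eq T (-l)).2, ← mul_add, ← Finset.sum_add_distrib, mul_left_comm, Finset.mul_sum]
    congr 1
    refine Finset.sum_congr rfl fun ρ _ => ?_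
    rw [← Finset.sum_add_distrib, Finset.mul_sum]
    refine Finset.sum_congr rfl fun ρ' _ => ?_
    ring
  rw [QQ]
  simp_rw [h1]
  rw [intervalIntegral.integral_const_mul, intervalIntegral.integral_finsetSum (fun ρ _ => Continuous.intervalIntegrable (by fun_prop) _ _)]
  congr 1
  refine Finset.sum_congr rfl fun ρ _ => ?_
  rw [intervalIntegral.integral_finsetSum (fun ρ _ => Continuous.intervalIntegrable (by fun_prop) _ _)]
  refine Finset.sum_congr rfl fun ρ' _ => ?_
  rw [intervalIntegral.integral_const_mul, pair_int V hV]

lemma norm_KK (Y : ℂ) (h : |Y.re| ≤ 1/1000) : ‖KK Y‖ ≤ 2 := by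
  have : ∀ a ∈ Set.uIoc (0:ℝ) 1, ‖(kap a : ℂ) * Complex.cosh (a * Y)‖ ≤ 2 := by
    intro a ha
    rw [Set.uIoc_of_le (by norm_num)] at ha
    have h1 : |kap a| ≤ 1 := by
      rw [abs_of_nonneg (kap_nonneg a ha.2)]; unfold kap; nlinarith [ha.1, ha.2]
    have h2 : ‖Complex.cosh (a*Y)‖ ≤ 2 := by
      have hb : ∀ z : ℂ, z.re ≤ 1/1000 → ‖cexp z‖ ≤ 2 := by
        intro z hz
        rw [Complex.norm_exp]
        have := Real.abs_exp_sub_one_le (x := 1/1000) (by norm_num)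
        rw [abs_of_pos (by norm_num : (0:ℝ) < 1/1000)] at this
        have h3 := (abs_le.mp this).2
        have h4 := Real.exp_le_exp.mpr hz
        linarith
      have hr : |(a*Y).re| ≤ 1/1000 := by
        rw [Complex.re_ofReal_mul, abs_mul, abs_of_pos ha.1]; nlinarith [ha.1, ha.2, abs_nonneg Y.re]
      rw [abs_le] at hr
      rw [Complex.cosh, norm_div, Complex.norm_ofNat]
      have i1 := hb (a*Y) hr.2
      have i2 := hb (-(a*Y)) (by rw [Complex.neg_re]; linarith)
      have := norm_add_le (cexp (a*Y)) (cexp (-(a*Y)))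
      linarith
    rw [norm_mul, Complex.norm_real, Real.norm_eq_abs]
    nlinarith [abs_nonneg (kap a), norm_nonneg (Complex.cosh (a*Y))]
  have := intervalIntegral.norm_integral_le_of_norm_le_const this
  simpa [KK] using this

lemma pair_lower (T : ℝ) (hT : 3 ≤ T) (hb : Box T) (ρ ρ' : ℂ) (h1 : ρ ∈ bd T) (h2 : ρ' ∈ bd T) :
    (if ρ.im = ρ'.im then (29/60:ℝ) else 0) - 4 * rexp (-(rlog T)^2/4) ≤
      (cexp ((ww ρ ρ')^2/4) * KK ((4/5 * rlog T : ℝ) * ww ρ ρ')).re := by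
  set L := rlog T with hL
  have hL1 : 1 ≤ L := by
    rw [hL, Real.le_log_iff_exp_le (by linarith)]
    linarith [Real.exp_one_lt_d9]
  set r := (ρ.re - 1/2) + (ρ'.re - 1/2) with hr
  set u := ρ.im - ρ'.im with hu
  have hw : ww ρ ρ' = r + u * cI := by
    apply Complex.ext <;> simp [ww, hr, hu] <;> ring
  have hrb : |r| ≤ 1/1000 / L := by
    have a1 := hb.2 ρ h1; have a2 := hb.2 ρ' h2
    have := abs_add_le (ρ.re - 1/2) (ρ'.re - 1/2)
    rw [← hL] at a1 a2
    have e : 0.001 / (2*L) + 0.001/(2*L) = 1/1000/L := by field_simp; norm_num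
    linarith
  have hrL : |r| * L ≤ 1/1000 := by rwa [le_div_iff₀ (by linarith)] at hrb
  have e1 : ((4/5 * L : ℝ) : ℂ) * ww ρ ρ' = ((4/5*L*r : ℝ) : ℂ) + ((4/5*L*u : ℝ) : ℂ) * cI := by
    rw [hw]; push_cast; ring
  have hc : |4/5*L*r| ≤ 1/1000 := by
    rw [abs_mul, abs_of_pos (by linarith)]; nlinarith [abs_nonneg r]
  have e2 : cexp ((ww ρ ρ')^2/4) = ((rexp ((r^2-u^2)/4) : ℝ) : ℂ) * cexp ((r*u/2 : ℝ) * cI) := by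
    rw [hw, Complex.ofReal_exp, ← Complex.exp_add]; congr 1; push_cast
    linear_combination ((u:ℂ)^2/4) * Complex.I_sq
  have e3 : (cexp ((ww ρ ρ')^2/4) * KK ((4/5 * L : ℝ) * ww ρ ρ')).re = rexp ((r^2-u^2)/4) * (cexp ((r*u/2 : ℝ) * cI) * KK (((4/5*L*r : ℝ) : ℂ) + ((4/5*L*u : ℝ) : ℂ) * cI)).re := by
    rw [e1, e2, mul_assoc, Complex.re_ofReal_mul]
  have hE0 := Real.exp_pos (-L^2/4)
  rw [e3]
  by_cases h0 : ρ.im = ρ'.im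
  · rw [if_pos h0]
    have hu0 : u = 0 := by rw [hu, h0, sub_self]
    rw [hu0]
    have hd := kern_diag (4/5*L*r)
    simp only [mul_zero, zero_div, Complex.ofReal_zero, zero_mul, Complex.exp_zero, one_mul, add_zero, ne_eq, OfNat.ofNat_ne_zero, not_false_eq_true, zero_pow, sub_zero]
    have : 1 ≤ rexp (r^2/4) := Real.one_le_exp (by positivity)
    nlinarith
  · rw [if_neg h0]
    rcases le_total |u| L with hul | hul
    · have hz : |r*u/2| ≤ 1/2000 := by
        rw [abs_div, abs_mul, abs_two]
        nlinarith [abs_nonneg r, mul_le_mul_of_nonneg_left hul (abs_nonneg r)]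
      have := mul_nonneg (Real.exp_pos ((r^2-u^2)/4)).le (kern_pos (4/5*L*r) (4/5*L*u) (r*u/2) hc hz)
      linarith
    · have hn : ‖cexp ((r*u/2 : ℝ) * cI) * KK (((4/5*L*r : ℝ) : ℂ) + ((4/5*L*u : ℝ) : ℂ) * cI)‖ ≤ 2 := by
        rw [norm_mul, Complex.norm_exp_ofReal_mul_I, one_mul]
        exact norm_KK _ (by simpa using hc)
      have h3 := (abs_le.mp ((Complex.abs_re_le_norm _).trans hn)).1
      have h4 : rexp ((r^2-u^2)/4) ≤ 2 * rexp (-L^2/4) := by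
        have hr1 : r^2 ≤ 1 := by
          rw [← sq_abs]
          have : |r| ≤ 1 := by nlinarith [abs_nonneg r]
          nlinarith [abs_nonneg r]
        have hu1 : L^2 ≤ u^2 := by rw [← sq_abs u]; gcongr
        calc _ ≤ rexp (1/4 + -L^2/4) := Real.exp_le_exp.mpr (by linarith)
          _ = rexp (1/4) * rexp (-L^2/4) := Real.exp_add _ _
          _ ≤ _ := by
            gcongr
            have := Real.abs_exp_sub_one_le (x := 1/4) (by rw [abs_of_pos] <;> norm_num)
            rw [abs_of_pos (by norm_num : (0:ℝ) < 1/4)] at this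
            linarith [(abs_le.mp this).2]
      nlinarith [Real.exp_pos ((r^2-u^2)/4)]

noncomputable def PP (T : ℝ) : ℝ := ∑ ρ ∈ bd T, ∑ ρ' ∈ bd T, ((mu ρ : ℝ) * mu ρ') * (if ρ.im = ρ'.im then 1 else 0)

lemma QQ_lower (T : ℝ) (hT : 3 ≤ T) (hb : Box T) :
    rsq rpi * (2 * (4/5 * rlog T)) * (29/60 * PP T - 4 * rexp (-(rlog T)^2/4) * (NN T)^2) ≤ QQ T (4/5 * rlog T) := by
  have hL : 0 < rlog T := Real.log_pos (by linarith)
  rw [QQ_eq T _ (by positivity), mul_assoc]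
  refine mul_le_mul_of_nonneg_left ?_ (Real.sqrt_nonneg _)
  have e : 2 * (4/5 * rlog T) * (29/60 * PP T - 4 * rexp (-(rlog T)^2/4) * (NN T)^2) =
      ∑ ρ ∈ bd T, ∑ ρ' ∈ bd T, ((mu ρ : ℝ) * mu ρ') * (2 * (4/5 * rlog T) * ((if ρ.im = ρ'.im then (29/60:ℝ) else 0) - 4 * rexp (-(rlog T)^2/4))) := by
    have eN : (NN T)^2 = ∑ ρ ∈ bd T, ∑ ρ' ∈ bd T, ((mu ρ : ℝ) * mu ρ') := by
      rw [pow_two, NN, Finset.sum_mul_sum]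
    rw [eN, PP, mul_sub, Finset.mul_sum, Finset.mul_sum, Finset.mul_sum, Finset.mul_sum, ← Finset.sum_sub_distrib]
    refine Finset.sum_congr rfl fun ρ _ => ?_
    rw [Finset.mul_sum, Finset.mul_sum, Finset.mul_sum, Finset.mul_sum, ← Finset.sum_sub_distrib]
    refine Finset.sum_congr rfl fun ρ' _ => ?_
    split_ifs <;> ring
  rw [e]
  refine Finset.sum_le_sum fun ρ h1 => Finset.sum_le_sum fun ρ' h2 => ?_
  have := pair_lower T hT hb ρ ρ' h1 h2
  gcongr

lemma pp_cont (l : ℝ) : Continuous (pp l) := by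
  unfold pp
  refine continuous_tsum (fun n => by fun_prop) (pp_summable l) fun n t => (pp_term_norm l t n).le

lemma gauss_quarter (γ : ℝ) : Integrable (fun t : ℝ => rexp (-(γ - t)^2/4)) ∧ ∫ t : ℝ, rexp (-(γ - t)^2/4) = rsq (4 * rpi) := by
  have h1 : ∀ t : ℝ, rexp (-(γ - t)^2/4) = (fun x : ℝ => rexp (-(1/4) * x^2)) (γ - t) := by
    intro t; simp only; congr 1; ring
  simp_rw [h1]
  refine ⟨(integrable_exp_neg_mul_sq (by norm_num : (0:ℝ) < 1/4)).comp_sub_left γ, ?_⟩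
  rw [integral_sub_left_eq_self (fun x : ℝ => rexp (-(1/4) * x^2)), integral_gaussian]
  congr 1; ring

lemma Sloc_tail (T l t : ℝ) (hL : 0 ≤ rlog T) (ht : ∀ ρ ∈ bd T, rlog T ≤ |ρ.im - t|) :
    ‖Sloc T l t‖^2 ≤ rexp (|l| + 1/4 - (rlog T)^2/2) * NN T * ∑ ρ ∈ bd T, (mu ρ : ℝ) * rexp (-(ρ.im - t)^2/4) := by
  set c := rexp (|l|/2 + 1/8 - (rlog T)^2/4) with hc
  set G := ∑ ρ ∈ bd T, (mu ρ : ℝ) * rexp (-(ρ.im - t)^2/4) with hG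
  have h1 : ‖Sloc T l t‖ ≤ c * G := by
    unfold Sloc
    refine (norm_sum_le _ _).trans ?_
    rw [hG, Finset.mul_sum]
    refine Finset.sum_le_sum fun ρ hρ => ?_
    rw [norm_mul, Complex.norm_natCast]
    have := EE_tail (l := l) hL (mem_bd.mp hρ).1 (ht ρ hρ)
    calc _ ≤ (mu ρ : ℝ) * (c * rexp (-(ρ.im - t)^2/4)) := by gcongr
      _ = _ := by ring
  have h2 : G ≤ NN T := by
    refine Finset.sum_le_sum fun ρ _ => ?_
    have : rexp (-(ρ.im - t)^2/4) ≤ 1 := by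
      rw [Real.exp_le_one_iff]; nlinarith [sq_nonneg (ρ.im - t)]
    exact mul_le_of_le_one_right (Nat.cast_nonneg _) this
  have h3 : 0 ≤ G := Finset.sum_nonneg fun ρ _ => by positivity
  have h4 : c * c = rexp (|l| + 1/4 - (rlog T)^2/2) := by
    rw [hc, ← Real.exp_add]; congr 1; ring
  rw [← h4]
  have hcp : 0 < c := Real.exp_pos _
  calc _ ≤ (c * G)^2 := by gcongr
    _ = c * c * G * G := by ring
    _ ≤ _ := by gcongr

lemma tail_ev : ∀ᶠ T : ℝ in atTop, ∀ l : ℝ, |l| ≤ rlog T →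
    ∫ t in (Icc (T - rlog T) (2 * T + rlog T))ᶜ, ‖Sloc T l t‖^2 ≤ 1 := by
  obtain ⟨K, hK, h⟩ := NN_crude
  filter_upwards [tiny (rexp (1/4) * K^2 * rsq (4*rpi)), eventually_ge_atTop 3] with T h1 h2 l hl
  have hL : 0 < rlog T := Real.log_pos (by linarith)
  set c := rexp (|l| + 1/4 - (rlog T)^2/2) with hc
  have hi : Integrable (fun t : ℝ => c * NN T * ∑ ρ ∈ bd T, (mu ρ : ℝ) * rexp (-(ρ.im - t)^2/4)) :=
    (integrable_finsetSum _ fun ρ _ => (gauss_quarter ρ.im).1.const_mul _).const_mul _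
  have hNN := NN_nonneg T
  have e1 : ∫ t in (Icc (T - rlog T) (2 * T + rlog T))ᶜ, ‖Sloc T l t‖^2 ≤
      ∫ t in (Icc (T - rlog T) (2 * T + rlog T))ᶜ, c * NN T * ∑ ρ ∈ bd T, (mu ρ : ℝ) * rexp (-(ρ.im - t)^2/4) := by
    refine setIntegral_mono_on (FF_eq T l).1.integrableOn hi.integrableOn measurableSet_Icc.compl fun t ht => ?_
    refine Sloc_tail T l t hL.le fun ρ hρ => ?_
    obtain ⟨_, a, b⟩ := mem_bd.mp hρ
    by_contra hcon
    push Not at hcon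
    rw [abs_lt] at hcon
    exact ht ⟨by linarith, by linarith⟩
  have e2 := setIntegral_le_integral (s := (Icc (T - rlog T) (2 * T + rlog T))ᶜ) hi (Eventually.of_forall fun t => by
    have : 0 ≤ ∑ ρ ∈ bd T, (mu ρ : ℝ) * rexp (-(ρ.im - t)^2/4) := Finset.sum_nonneg fun ρ _ => by positivity
    simp only [Pi.zero_apply]; positivity)
  refine e1.trans (e2.trans ?_)
  rw [integral_const_mul, integral_finsetSum _ fun ρ _ => (gauss_quarter ρ.im).1.const_mul _]
  simp_rw [integral_const_mul, (gauss_quarter _).2]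
  rw [← Finset.sum_mul]
  change c * NN T * (NN T * rsq (4*rpi)) ≤ 1
  have hT1 : 1 / T ≤ 1 := by rw [div_le_one (by linarith)]; linarith
  refine le_trans ?_ (h1.trans hT1)
  have h6 : NN T ≤ K * rexp (3 * rlog T) := by
    rw [show 3 * rlog T = (3:ℕ) * rlog T by norm_num, Real.exp_nat_mul, Real.exp_log (by linarith)]
    exact h T (by linarith)
  calc _ = c * rsq (4*rpi) * (NN T)^2 := by ring
    _ ≤ c * rsq (4*rpi) * (K * rexp (3 * rlog T))^2 := by gcongr
    _ = K^2 * rsq (4*rpi) * (c * (rexp (3 * rlog T) * rexp (3 * rlog T))) := by ring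
    _ ≤ K^2 * rsq (4*rpi) * rexp (1/4 + (20 * rlog T - (rlog T)^2/4)) := by
        refine mul_le_mul_of_nonneg_left ?_ (by positivity)
        rw [hc, ← Real.exp_add, ← Real.exp_add]
        apply Real.exp_le_exp.mpr
        nlinarith
    _ = _ := by rw [Real.exp_add]; ring

lemma edge_ev (hbox : ∀ᶠ T in atTop, Box T) : ∃ C : ℝ, 0 ≤ C ∧ ∀ᶠ T : ℝ in atTop, ∀ l t : ℝ, |l| ≤ rlog T → 3*T/4 ≤ t → t ≤ 3*T →
    ‖Sloc T l t‖ ≤ C * rlog T := by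
  obtain ⟨C, hC, h⟩ := W_bound hbox
  refine ⟨2*C, by positivity, ?_⟩
  filter_upwards [h, hbox, eventually_ge_atTop 3] with T h1 hB h2 l t hl ht1 ht2
  have hL : 0 < rlog T := Real.log_pos (by linarith)
  have hL1 : 1 ≤ rlog T := by
    rw [Real.le_log_iff_exp_le (by linarith)]; linarith [Real.exp_one_lt_d9]
  have a1 := h1 t ht1 ht2
  have a2 : ∑ ρ ∈ bd T, (mu ρ : ℝ) * rexp (-(ρ.im - t)^2/2) ≤ C * rlog T :=
    ((W_sum t).sum_le_tsum _ fun ρ _ => by positivity).trans a1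
  have a3 : ‖Sloc T l t‖ ≤ 2 * ∑ ρ ∈ bd T, (mu ρ : ℝ) * rexp (-(ρ.im - t)^2/2) := by
    unfold Sloc
    refine (norm_sum_le _ _).trans ?_
    rw [Finset.mul_sum]
    refine Finset.sum_le_sum fun ρ hρ => ?_
    obtain ⟨e1, e2⟩ := sub_re_im ρ t
    rw [norm_mul, Complex.norm_natCast, norm_EE, e1, e2]
    have hx := hB.2 ρ hρ
    set x := ρ.re - 1/2
    have b1 : l * x ≤ 0.001 := by
      calc l * x ≤ |l * x| := le_abs_self _
        _ = |l| * |x| := abs_mul _ _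
        _ ≤ rlog T * (0.001 / (2 * rlog T)) := by gcongr
        _ ≤ 0.001 := by field_simp; norm_num
    have b2 : |x| ≤ 0.001 := by
      refine hx.trans ?_
      rw [div_le_iff₀ (by positivity)]; nlinarith
    have b3 : x^2 ≤ 0.001^2 := by rw [← sq_abs]; gcongr
    have b4 : rexp (l * x + x^2/2 - (ρ.im - t)^2/2) ≤ 2 * rexp (-(ρ.im - t)^2/2) := by
      have : l * x + x^2/2 - (ρ.im - t)^2/2 = (l*x + x^2/2) + (-(ρ.im - t)^2/2) := by ring
      rw [this, Real.exp_add]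
      refine mul_le_mul_of_nonneg_right ?_ (Real.exp_pos _).le
      calc rexp (l*x+x^2/2) ≤ rexp (rlog 2) := by
            apply Real.exp_le_exp.mpr; linarith [Real.log_two_gt_d9]
        _ = 2 := Real.exp_log (by norm_num)
    calc _ ≤ (mu ρ : ℝ) * (2 * rexp (-(ρ.im - t)^2/2)) := by gcongr
      _ = _ := by ring
  linarith

lemma FF_core (hbox : ∀ᶠ T in atTop, Box T) : ∀ᶠ T : ℝ in atTop, ∀ (l A : ℝ) (P : ℝ → ℝ), |l| ≤ rlog T → 0 ≤ A → Continuous P → (∀ t, 0 ≤ P t) →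
    (∀ t, T + rlog T ≤ t → t ≤ 2*T - rlog T → ‖Sloc T l t‖ ≤ A + P t + 1 / rlog T) →
    FF T l ≤ T * (A^2 + 3 * A + 4) + (1 + A + 1 / rlog T) * ∫ t in (T + rlog T)..(2*T - rlog T), (P t)^2 := by
  obtain ⟨C, hC, hE⟩ := edge_ev hbox
  have hlo : ∀ᶠ T : ℝ in atTop, (rlog T)^1 ≤ (1/8) * T := by
    have := (Real.isLittleO_pow_log_id_atTop (n := 1)).bound (show (0:ℝ) < 1/8 by norm_num)
    filter_upwards [this, eventually_ge_atTop 1] with T h1 h2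
    simp only [id, Real.norm_eq_abs] at h1
    rw [abs_of_nonneg (by linarith : (0:ℝ) ≤ T)] at h1
    exact (le_abs_self _).trans h1
  have hlo3 : ∀ᶠ T : ℝ in atTop, 4 * C^2 * (rlog T)^3 ≤ T := by
    have := (Real.isLittleO_pow_log_id_atTop (n := 3)).bound (show (0:ℝ) < 1/(4*C^2+1) by positivity)
    filter_upwards [this, eventually_ge_atTop 1] with T h1 h2
    simp only [id, Real.norm_eq_abs] at h1
    rw [abs_of_nonneg (by linarith : (0:ℝ) ≤ T)] at h1
    have h3 := (le_abs_self _).trans h1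
    rw [div_mul_eq_mul_div, le_div_iff₀ (by positivity)] at h3
    have : 0 ≤ (rlog T)^3 := pow_nonneg (Real.log_nonneg h2) _
    nlinarith
  filter_upwards [tail_ev, hE, hlo, hlo3, eventually_ge_atTop 3] with T h1 hE h2 h3 hT l A P hl hA hP hP0 hmid
  rw [pow_one] at h2
  set L := rlog T with hLd
  have hL : 0 < L := Real.log_pos (by linarith)
  have hL1 : 1 ≤ L := by
    rw [hLd, Real.le_log_iff_exp_le (by linarith)]; linarith [Real.exp_one_lt_d9]
  have hint := (FF_eq T l).1
  have hII : ∀ a b : ℝ, IntervalIntegrable (fun t => ‖Sloc T l t‖^2) volume a b := fun a b => hint.intervalIntegrable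
  have e1 : FF T l = (∫ t in (T - L)..(2*T+L), ‖Sloc T l t‖^2) + ∫ t in (Icc (T - L) (2 * T + L))ᶜ, ‖Sloc T l t‖^2 := by
    rw [intervalIntegral.integral_of_le (by linarith), ← integral_Icc_eq_integral_Ioc, integral_add_compl measurableSet_Icc hint]
    rfl
  have e2 : (∫ t in (T - L)..(2*T+L), ‖Sloc T l t‖^2) = (∫ t in (T - L)..(T+L), ‖Sloc T l t‖^2) + (∫ t in (T + L)..(2*T-L), ‖Sloc T l t‖^2) + ∫ t in (2*T - L)..(2*T+L), ‖Sloc T l t‖^2 := by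
    rw [intervalIntegral.integral_add_adjacent_intervals (hII _ _) (hII _ _), intervalIntegral.integral_add_adjacent_intervals (hII _ _) (hII _ _)]
  have edge : ∀ c : ℝ, T ≤ c → c ≤ 2*T → ∫ t in (c - L)..(c+L), ‖Sloc T l t‖^2 ≤ 2*C^2*L^3 := by
    intro c hc1 hc2
    have : ∫ t in (c - L)..(c+L), ‖Sloc T l t‖^2 ≤ ∫ t in (c - L)..(c+L), (C*L)^2 := by
      refine intervalIntegral.integral_mono_on (by linarith) (hII _ _) intervalIntegrable_const fun t ht => ?_
      have := hE l t hl (by linarith [ht.1]) (by linarith [ht.2])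
      gcongr
    refine this.trans (le_of_eq ?_)
    rw [intervalIntegral.integral_const, smul_eq_mul]; ring
  have hmidI : ∫ t in (T + L)..(2*T-L), ‖Sloc T l t‖^2 ≤ T * (A^2+3*A+2) + (1 + A + 1 / L) * ∫ t in (T + L)..(2*T - L), (P t)^2 := by
    have hiL : 0 < 1 / L := by positivity
    have hiL1 : 1 / L ≤ 1 := by rw [div_le_one hL]; exact hL1
    have : ∫ t in (T + L)..(2*T-L), ‖Sloc T l t‖^2 ≤ ∫ t in (T + L)..(2*T-L), ((A^2+3*A+2) + (1 + A + 1 / L) * (P t)^2) := by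
      refine intervalIntegral.integral_mono_on (by linarith) (hII _ _) (Continuous.intervalIntegrable (by fun_prop) _ _) fun t ht => ?_
      have a := hmid t ht.1 ht.2
      have p := hP0 t
      generalize 1 / L = e at *
      calc ‖Sloc T l t‖^2 ≤ (A + P t + e)^2 := by gcongr
        _ ≤ _ := by nlinarith [mul_nonneg hA (sq_nonneg (P t - 1)), mul_nonneg hiL.le (sq_nonneg (P t - 1)), mul_nonneg hA (sub_nonneg.mpr hiL1), mul_nonneg hiL.le (sub_nonneg.mpr hiL1)]
    refine this.trans ?_
    rw [intervalIntegral.integral_add intervalIntegrable_const (Continuous.intervalIntegrable (by fun_prop) _ _), intervalIntegral.integral_const, intervalIntegral.integral_const_mul, smul_eq_mul]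
    gcongr
    linarith
  have := edge T le_rfl (by linarith)
  have := edge (2*T) (by linarith) le_rfl
  have := h1 l hl
  rw [e1, e2]
  nlinarith

lemma log_rpow_ev (K : ℝ) (s : ℝ) (hs : 0 < s) : ∀ᶠ T : ℝ in atTop, K * rlog T ≤ rexp (s * rlog T) := by
  have h1 : ∀ᶠ x : ℝ in atTop, K * x ≤ rexp (s * x) := by
    filter_upwards [eventually_ge_atTop (2 * |K| / s^2), eventually_ge_atTop 0] with x hx h0
    have := Real.quadratic_le_exp_of_nonneg (mul_nonneg hs.le h0)
    rw [div_le_iff₀ (by positivity)] at hx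
    have h3 : K * x ≤ |K| * x := mul_le_mul_of_nonneg_right (le_abs_self _) h0
    have h4 : |K| * x ≤ (s*x)^2/2 := by nlinarith
    have : 0 ≤ s * x := by positivity
    linarith
  exact Real.tendsto_log_atTop.eventually h1

lemma Sloc_mid : ∃ C : ℝ, 0 ≤ C ∧ ∀ᶠ T : ℝ in atTop, ∀ l t : ℝ, 0 ≤ l → l ≤ 4/5 * rlog T →
    T + rlog T ≤ t → t ≤ 2*T - rlog T →
    ‖Sloc T l t‖ ≤ (rlog T + C) * gg l + ‖pp l t‖ + 1 / rlog T ∧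
    ‖Sloc T (-l) t‖ ≤ (rlog T + C) * gg l + ‖pp l (-t)‖ + 1 / rlog T := by
  obtain ⟨C, hC, h⟩ := SS_eval
  refine ⟨C + 1, by positivity, ?_⟩
  filter_upwards [mid_close, log_rpow_ev (C+1) (1/5) (by norm_num), eventually_ge_atTop 3] with T h1 h2 hT l t hl0 hl ht1 ht2
  set L := rlog T with hLd
  have hL : 0 < L := Real.log_pos (by linarith)
  have hTe : T = rexp L := (Real.exp_log (by linarith)).symm
  have key : ∀ s : ℝ, |s| = t → ‖SS l s‖ ≤ (L + C + 1) * gg l + ‖pp l s‖ + C * rexp l / T := by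
    intro s hs
    have a := h l s hl0
    rw [hs] at a
    have b : ‖SS l s‖ ≤ ‖SS l s - ((gg l * rlog (1+t) : ℝ) - pp l s)‖ + ‖((gg l * rlog (1+t) : ℝ) : ℂ)‖ + ‖pp l s‖ := by
      have : SS l s = (SS l s - ((gg l * rlog (1+t) : ℝ) - pp l s)) + ((gg l * rlog (1+t) : ℝ) : ℂ) - pp l s := by ring
      calc ‖SS l s‖ = _ := by rw [this]
        _ ≤ _ := (norm_sub_le _ _).trans (by gcongr; exact norm_add_le _ _)
    have c1 : 0 ≤ rlog (1+t) := Real.log_nonneg (by linarith)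
    have c2 : rlog (1+t) ≤ L + 1 := by
      rw [Real.log_le_iff_le_exp (by linarith), Real.exp_add, ← hTe]
      have := Real.exp_one_gt_d9
      have : 1 ≤ L := by
        rw [hLd, Real.le_log_iff_exp_le (by linarith)]; linarith [Real.exp_one_lt_d9]
      nlinarith
    have g := (gg_pos l).le
    rw [Complex.norm_real, Real.norm_eq_abs, abs_of_nonneg (by positivity)] at b
    have c3 : C * rexp l / (1+t) ≤ C * rexp l / T := by gcongr; linarith
    have c4 : gg l * rlog (1+t) ≤ gg l * (L+1) := by gcongr
    nlinarith
  have fin : C * rexp l / T + 1 / T ≤ 1 / L := by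
    have a1 : rexp l ≤ rexp (4/5*L) := Real.exp_le_exp.mpr hl
    have a2 : (1:ℝ) ≤ rexp (4/5*L) := Real.one_le_exp (by positivity)
    rw [← add_div, div_le_div_iff₀ (by linarith) hL]
    calc (C * rexp l + 1) * L ≤ ((C+1) * L) * rexp (4/5*L) := by
          have : C * rexp l + 1 ≤ (C+1) * rexp (4/5*L) := by nlinarith
          nlinarith
      _ ≤ rexp (1/5*L) * rexp (4/5*L) := by gcongr
      _ = 1 * T := by rw [← Real.exp_add, hTe, ← hTe]; rw [show 1/5*L+4/5*L = L by ring, ← hTe]; ring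
  have tri : ∀ l' s, |l'| = l → SS l' t = SS l s → |s| = t → ‖Sloc T l' t‖ ≤ (L + (C + 1)) * gg l + ‖pp l s‖ + 1 / L := by
    intro l' s hl' hs hst
    have a := h1 l' t (by rw [hl']; linarith) ht1 ht2
    have b : ‖Sloc T l' t‖ ≤ ‖SS l' t‖ + ‖SS l' t - Sloc T l' t‖ := by
      have : Sloc T l' t = SS l' t - (SS l' t - Sloc T l' t) := by ring
      calc _ = ‖SS l' t - (SS l' t - Sloc T l' t)‖ := by rw [← this]
        _ ≤ _ := norm_sub_le _ _
    rw [hs] at a b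
    have := key s hst
    have : (L + (C + 1)) * gg l = (L + C + 1) * gg l := by ring
    linarith
  have ht0 : 0 ≤ t := by linarith
  exact ⟨tri l t (abs_of_nonneg hl0) rfl (abs_of_nonneg ht0), tri (-l) (-t) (by rw [abs_neg, abs_of_nonneg hl0]) (SS_neg l t) (by rw [abs_neg, abs_of_nonneg ht0])⟩

noncomputable def AA (C L l : ℝ) : ℝ := (L + C) * gg l

lemma FF_upper (hbox : ∀ᶠ T in atTop, Box T) : ∃ C : ℝ, 0 ≤ C ∧ ∀ᶠ T : ℝ in atTop, ∀ l : ℝ, 0 ≤ l → l ≤ 4/5 * rlog T →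
    FF T l + FF T (-l) ≤ 2 * T * ((AA C (rlog T) l)^2 + 3 * AA C (rlog T) l + 5 + (1 + AA C (rlog T) l + 1 / rlog T) * DD l) := by
  obtain ⟨C, hC, h⟩ := Sloc_mid
  obtain ⟨Z, hZ, hp⟩ := pp_mv
  refine ⟨C, hC, ?_⟩
  filter_upwards [h, FF_core hbox, log_rpow_ev (Z * (C+3)) (1/25) (by norm_num), eventually_ge_atTop 100] with T h1 h2 h3 hT l hl0 hl
  set L := rlog T with hLd
  have hL : 0 < L := Real.log_pos (by linarith)
  have hL1 : 1 ≤ L := by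
    rw [hLd, Real.le_log_iff_exp_le (by linarith)]; linarith [Real.exp_one_lt_d9]
  have hTe : T = rexp L := (Real.exp_log (by linarith)).symm
  have hLT : L ≤ T / 2 := by
    have := Real.quadratic_le_exp_of_nonneg hL.le
    rw [← hTe] at this
    nlinarith
  set A := AA C L l with hA
  have hg := gg_pos l
  have hA0 : 0 ≤ A := by rw [hA, AA]; positivity
  have hA1 : A ≤ L + C := by
    rw [hA, AA]; exact mul_le_of_le_one_right (by linarith) (gg_le_one l)
  have hD := DD_nonneg l
  have main : ∀ (l' : ℝ) (P : ℝ → ℝ), |l'| = l → Continuous P → (∀ t, 0 ≤ P t) →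
      (∀ t, T + L ≤ t → t ≤ 2*T - L → ‖Sloc T l' t‖ ≤ A + P t + 1 / L) →
      (∫ t in (T + L)..(2*T - L), (P t)^2 ≤ T * DD l + Z * rexp ((6/5)*l)) →
      FF T l' ≤ T * (A^2 + 3*A + 5 + (1 + A + 1/L) * DD l) := by
    intro l' P hl' hPc hP0 hm hi
    refine (h2 l' A P (by rw [hl']; linarith) hA0 hPc hP0 hm).trans ?_
    have a1 : Z * rexp ((6/5)*l) ≤ Z * rexp (24/25*L) := by
      exact mul_le_mul_of_nonneg_left (Real.exp_le_exp.mpr (by linarith)) hZ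
    have iL : 1 / L ≤ 1 := by rw [div_le_one hL]; exact hL1
    have a2 : (1 + A + 1/L) * (Z * rexp ((6/5)*l)) ≤ T := by
      calc _ ≤ ((C+3) * L) * (Z * rexp (24/25*L)) := by
            apply mul_le_mul _ a1 (by positivity) (by positivity)
            nlinarith
        _ = (Z * (C+3) * L) * rexp (24/25*L) := by ring
        _ ≤ rexp (1/25*L) * rexp (24/25*L) := by gcongr
        _ = T := by rw [← Real.exp_add, show 1/25*L+24/25*L = L by ring, ← hTe]
    have iL0 : 0 < 1 / L := by positivity
    have a3 : (1 + A + 1/L) * (∫ t in (T + L)..(2*T - L), (P t)^2) ≤ (1 + A + 1/L) * (T * DD l + Z * rexp ((6/5)*l)) :=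
      mul_le_mul_of_nonneg_left hi (by positivity)
    linarith
  have hi0 : (2*T - L - (T+L)) * DD l ≤ T * DD l := by gcongr; linarith
  have b1 := main l (fun t => ‖pp l t‖) (abs_of_nonneg hl0) (pp_cont l).norm (fun t => norm_nonneg _)
    (fun t ht1 ht2 => (h1 l t hl0 hl ht1 ht2).1) ((hp l _ _ (by linarith)).trans (by linarith))
  have b2 := main (-l) (fun t => ‖pp l (-t)‖) (by rw [abs_neg, abs_of_nonneg hl0]) ((pp_cont l).comp continuous_neg).norm (fun t => norm_nonneg _)
    (fun t ht1 ht2 => (h1 l t hl0 hl ht1 ht2).2) (by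
      rw [intervalIntegral.integral_comp_neg (fun t => ‖pp l t‖^2)]
      refine (hp l _ _ (by linarith)).trans ?_
      linarith)
  linarith

lemma kap_le_one {a : ℝ} (h0 : 0 ≤ a) (h1 : a ≤ 1) : kap a ≤ 1 := by
  unfold kap; nlinarith

lemma poly_int (a b : ℝ) : ∫ x in (0:ℝ)..1, (11/10 - x/5) * (a * (x + 1/80)^2 + b) = a * (12630/38400) + b := by
  have h : ∀ x ∈ uIcc (0:ℝ) 1, HasDerivAt (fun x : ℝ => a * ((11/10) * (x^3/3 + x^2/80 + x/6400) - (1/5) * (x^4/4 + x^3/120 + x^2/12800)) + b * (11/10*x - x^2/10)) ((11/10 - x/5) * (a * (x + 1/80)^2 + b)) x := by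
    intro x _
    have h1 := hasDerivAt_id' x
    have h2 := ((h1.pow 3).div_const 3)
    refine (((((h1.pow 3).div_const 3).add ((h1.pow 2).div_const 80)).add (h1.div_const 6400)).const_mul (11/10) |>.sub
      ((((h1.pow 4).div_const 4).add ((h1.pow 3).div_const 120)).add ((h1.pow 2).div_const 12800) |>.const_mul (1/5)) |>.const_mul a |>.add
      (((h1.const_mul (11/10)).sub ((h1.pow 2).div_const 10)).const_mul b)).congr_deriv ?_
    push_cast
    ring
  rw [intervalIntegral.integral_eq_sub_of_hasDerivAt h (Continuous.intervalIntegrable (by fun_prop) _ _)]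
  norm_num

lemma II_bound : ∃ C : ℝ, 0 ≤ C ∧ ∀ᶠ L : ℝ in atTop, ∀ l : ℝ, 0 ≤ l → l ≤ 4/5 * L →
    ∫ x in (0:ℝ)..l, DD x ≤ 1/(2*rsq rpi) * ((l + (4/5*L)/80)^2/2) + C * L := by
  obtain ⟨C, hC, h⟩ := DD_int
  set q := 1/(2*rsq rpi) with hq
  have hq0 : 0 ≤ q := by positivity
  refine ⟨q * C + C, by positivity, ?_⟩
  filter_upwards [eventually_ge_atTop 30000] with L hL l hl0 hl
  have h1 := h l ((4/5*L)/80) hl0 (by linarith)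
  refine h1.trans ?_
  have a1 : l * rexp (l/10 - ((4/5*L)/80)^2/2) ≤ 1 := by
    have b1 : l ≤ rexp L := by linarith [Real.add_one_le_exp L]
    calc _ ≤ rexp L * rexp (l/10 - ((4/5*L)/80)^2/2) := by gcongr
      _ = rexp (L + (l/10 - ((4/5*L)/80)^2/2)) := by rw [Real.exp_add]
      _ ≤ 1 := by rw [Real.exp_le_one_iff]; nlinarith
  have a2 : C * (l * rexp (l/10 - ((4/5*L)/80)^2/2)) ≤ C * L := by gcongr; linarith
  have a3 : q * (C * (l + (4/5*L)/80)) ≤ q * (C * L) := by gcongr; linarith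
  linarith

lemma main_int : ∃ C : ℝ, 0 ≤ C ∧ ∀ᶠ L : ℝ in atTop,
    ∫ l in (0:ℝ)..(4/5*L), kap (l/(4/5*L)) * DD l ≤ 1/(2*rsq rpi) * (L^2/2) * 0.21051 + C * L := by
  obtain ⟨C, hC, h⟩ := II_bound
  refine ⟨C, by positivity, ?_⟩
  filter_upwards [h, eventually_ge_atTop 1] with L h1 hL
  set q := 1/(2*rsq rpi) with hq
  have hq0 : 0 ≤ q := by positivity
  set V := 4/5*L with hV
  have hV0 : 0 < V := by positivity
  have hu : ∀ l ∈ uIcc 0 V, HasDerivAt (fun l : ℝ => kap (l/V)) (-((11/10 - (l/V)/5)/V)) l := by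
    intro l _
    unfold kap
    have h1 := (hasDerivAt_id' l).div_const V
    refine (((h1.const_mul (11/10)).const_sub 1).add ((h1.pow 2).const_mul (1/10))).congr_deriv ?_
    push_cast; ring
  have hv : ∀ l ∈ uIcc 0 V, HasDerivAt (fun l : ℝ => ∫ x in (0:ℝ)..l, DD x) (DD l) l := fun l _ =>
    intervalIntegral.integral_hasDerivAt_right (DD_cont.intervalIntegrable _ _) (DD_cont.stronglyMeasurableAtFilter _ _) DD_cont.continuousAt
  have hIc : Continuous (fun l : ℝ => ∫ x in (0:ℝ)..l, DD x) :=
    intervalIntegral.continuous_primitive (fun a b => DD_cont.intervalIntegrable a b) 0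
  rw [intervalIntegral.integral_mul_deriv_eq_deriv_mul hu hv (Continuous.intervalIntegrable (by fun_prop) _ _) (DD_cont.intervalIntegrable _ _)]
  have k1 : kap (V/V) = 0 := by rw [div_self hV0.ne']; unfold kap; norm_num
  rw [k1, intervalIntegral.integral_same, mul_zero, zero_mul, sub_zero, zero_sub, ← intervalIntegral.integral_neg]
  have hle : ∫ l in (0:ℝ)..V, -(-((11/10 - (l/V)/5)/V) * ∫ x in (0:ℝ)..l, DD x) ≤
      ∫ l in (0:ℝ)..V, (1/V) * (fun x : ℝ => (11/10 - x/5) * ((q * V^2/2) * (x + 1/80)^2 + C * L)) (l/V) := by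
    refine intervalIntegral.integral_mono_on hV0.le (Continuous.intervalIntegrable (by fun_prop) _ _) (Continuous.intervalIntegrable (by fun_prop) _ _) fun l hl => ?_
    have a := h1 l hl.1 hl.2
    have b : l/V ≤ 1 := by rw [div_le_one hV0]; exact hl.2
    have e : q * ((l + V/80)^2/2) + C * L = (q * V^2/2) * (l/V + 1/80)^2 + C * L := by
      field_simp
    rw [e] at a
    have : 0 ≤ (11/10 - (l/V)/5)/V := div_nonneg (by linarith) hV0.le
    have := mul_le_mul_of_nonneg_left a this
    calc _ = (11/10 - (l/V)/5)/V * ∫ x in (0:ℝ)..l, DD x := by ring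
      _ ≤ _ := this
      _ = _ := by simp only; ring
  refine hle.trans ?_
  rw [intervalIntegral.integral_const_mul, intervalIntegral.integral_comp_div (fun x : ℝ => (11/10 - x/5) * ((q * V^2/2) * (x + 1/80)^2 + C * L)) hV0.ne', zero_div, div_self hV0.ne', poly_int, smul_eq_mul]
  have : 1 / V * (V * (q * V ^ 2 / 2 * (12630/38400) + C * L)) = q * V ^ 2 / 2 * (12630/38400) + C * L := by
    field_simp
  rw [this, hV]
  nlinarith [mul_nonneg hq0 (sq_nonneg L)]

lemma gg_half (V : ℝ) (hV : 0 ≤ V) : ∫ l in (0:ℝ)..V, (gg l)^2 ≤ 1/(2*rsq rpi)/2 := by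
  have h := gg_sq_int
  have h1 : ∫ l in (-V)..V, (gg l)^2 = 2 * ∫ l in (0:ℝ)..V, (gg l)^2 := by
    have hi : ∀ a b : ℝ, IntervalIntegrable (fun l => (gg l)^2) volume a b := fun a b => (gg_cont.pow 2).intervalIntegrable a b
    rw [← intervalIntegral.integral_add_adjacent_intervals (hi (-V) 0) (hi 0 V)]
    have : ∫ l in (-V)..0, (gg l)^2 = ∫ l in (0:ℝ)..V, (gg l)^2 := by
      have := intervalIntegral.integral_comp_neg (a := (0:ℝ)) (b := V) (fun l => (gg l)^2)
      simp only [gg_even, neg_zero] at this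
      exact this.symm
    rw [this]; ring
  have h2 : ∫ l in (-V)..V, (gg l)^2 ≤ ∫ l, (gg l)^2 := by
    rw [intervalIntegral.integral_of_le (by linarith)]
    exact setIntegral_le_integral h.1 (Eventually.of_forall fun l => sq_nonneg _)
  rw [h.2] at h2
  linarith

lemma exp_int (V : ℝ) : ∫ l in (0:ℝ)..V, rexp (-l) ≤ 1 := by
  rw [intervalIntegral.integral_comp_neg (fun x => rexp x), integral_exp]
  simp [Real.exp_pos, (Real.exp_pos _).le]

lemma QQ_upper (hbox : ∀ᶠ T in atTop, Box T) : ∃ C : ℝ, 0 ≤ C ∧ ∀ᶠ T : ℝ in atTop,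
    QQ T (4/5 * rlog T) ≤ T * (1/(2*rsq rpi)) * (rlog T)^2 * 1.21051 + C * T * rlog T := by
  obtain ⟨C, hC, h⟩ := FF_upper hbox
  obtain ⟨C1, hC1, hm⟩ := main_int
  obtain ⟨C2, hC2, hI⟩ := II_bound
  obtain ⟨C3, hC3, hD⟩ := DD_crude
  set q := 1/(2*rsq rpi) with hq
  have hq0 : 0 ≤ q := by positivity
  set K := 3 * rexp (1/2) + rexp ((11/10)^2/2) * C3 with hK
  have hK0 : 0 ≤ K := by positivity
  have hgK : ∀ l : ℝ, gg l * (3 + DD l) ≤ K * rexp (-l) := by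
    intro l
    have a1 := gg_exp (-1) l
    have a2 := gg_exp (-(11/10)) l
    have a3 := hD l
    have g := gg_pos l
    have b1 : gg l ≤ rexp (1/2) * rexp (-l) := by
      refine a1.trans (le_of_eq ?_); rw [← Real.exp_add]; congr 1; ring
    have b2 : gg l * DD l ≤ rexp ((11/10)^2/2) * C3 * rexp (-l) := by
      calc _ ≤ rexp ((-(11/10))^2/2 + (-(11/10))*l) * (C3 * rexp (l/10)) := mul_le_mul a2 a3 (DD_nonneg l) (Real.exp_pos _).le
        _ = rexp ((11/10)^2/2) * C3 * (rexp (-(11/10)*l) * rexp (l/10)) := by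
            rw [Real.exp_add, neg_sq]; ring
        _ = _ := by rw [← Real.exp_add]; congr 2; ring
    rw [hK]; nlinarith
  refine ⟨2 * (q * (C + C^2) + K * (1 + C) + 4 + (q + C2) + C1), by positivity, ?_⟩
  filter_upwards [h, Real.tendsto_log_atTop.eventually hm, Real.tendsto_log_atTop.eventually hI, eventually_ge_atTop 3] with T h hm hI hT
  set L := rlog T with hLd
  have hL1 : 1 ≤ L := by
    rw [hLd, Real.le_log_iff_exp_le (by linarith)]; linarith [Real.exp_one_lt_d9]
  set V := 4/5*L with hV
  have hV0 : 0 < V := by positivity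
  have hFc := FF_cont T
  have hkc := kap_cont
  have hgc := gg_cont
  have hDc := DD_cont
  have h1 : QQ T V ≤ ∫ l in (0:ℝ)..V, 2 * T * ((L+C)^2 * (gg l)^2 + (L + C) * K * rexp (-l) + 5 + (1/L) * DD l + kap (l/V) * DD l) := by
    unfold QQ
    refine intervalIntegral.integral_mono_on hV0.le (Continuous.intervalIntegrable (by fun_prop) _ _) (Continuous.intervalIntegrable (by fun_prop) _ _) fun l hl => ?_
    have a := h l hl.1 hl.2
    have b : l/V ≤ 1 := by rw [div_le_one hV0]; exact hl.2
    have b0 : 0 ≤ l/V := div_nonneg hl.1 hV0.le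
    have k0 := kap_nonneg _ b
    have k1 := kap_le_one b0 b
    have g := gg_pos l
    have d := DD_nonneg l
    have e := mul_le_mul_of_nonneg_left a k0
    refine e.trans ?_
    have f : kap (l/V) * ((AA C L l)^2 + 3 * AA C L l + 5 + (1 + AA C L l + 1/L) * DD l) ≤ (L+C)^2 * (gg l)^2 + (L + C) * K * rexp (-l) + 5 + (1/L) * DD l + kap (l/V) * DD l := by
      have iL : 0 < 1/L := by positivity
      have e1 : (AA C L l)^2 + 3 * AA C L l + 5 + (1 + AA C L l + 1/L) * DD l = ((L+C)^2 * (gg l)^2 + (L+C) * (gg l * (3 + DD l)) + 5 + (1/L) * DD l) + DD l := by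
        unfold AA; ring
      have e2 : (L+C) * (gg l * (3 + DD l)) ≤ (L+C) * (K * rexp (-l)) := mul_le_mul_of_nonneg_left (hgK l) (by positivity)
      have e3 : 0 ≤ (L+C)^2 * (gg l)^2 + (L+C) * (gg l * (3 + DD l)) + 5 + (1/L) * DD l := by positivity
      rw [e1, mul_add]
      have := mul_le_of_le_one_left e3 k1
      linarith
    calc _ = 2 * T * (kap (l/V) * ((AA C L l)^2 + 3 * AA C L l + 5 + (1 + AA C L l + 1/L) * DD l)) := by ring
      _ ≤ _ := mul_le_mul_of_nonneg_left f (by linarith)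
  refine h1.trans ?_
  have i1 : IntervalIntegrable (fun l => (L+C)^2 * (gg l)^2) volume 0 V := Continuous.intervalIntegrable (by fun_prop) _ _
  have i2 : IntervalIntegrable (fun l => (L + C) * K * rexp (-l)) volume 0 V := Continuous.intervalIntegrable (by fun_prop) _ _
  have i3 : IntervalIntegrable (fun l => (1/L) * DD l) volume 0 V := Continuous.intervalIntegrable (by fun_prop) _ _
  have i4 : IntervalIntegrable (fun l => kap (l/V) * DD l) volume 0 V := Continuous.intervalIntegrable (by fun_prop) _ _
  rw [intervalIntegral.integral_const_mul, intervalIntegral.integral_add (((i1.add i2).add intervalIntegrable_const).add i3) i4,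
    intervalIntegral.integral_add ((i1.add i2).add intervalIntegrable_const) i3, intervalIntegral.integral_add (i1.add i2) intervalIntegrable_const,
    intervalIntegral.integral_add i1 i2, intervalIntegral.integral_const_mul, intervalIntegral.integral_const_mul, intervalIntegral.integral_const_mul, intervalIntegral.integral_const, smul_eq_mul]
  have j1 : (L+C)^2 * (∫ l in (0:ℝ)..V, (gg l)^2) ≤ (L+C)^2 * (q/2) := mul_le_mul_of_nonneg_left (gg_half V hV0.le) (sq_nonneg _)
  have j2 : (L+C)*K * (∫ l in (0:ℝ)..V, rexp (-l)) ≤ (L+C)*K*1 := mul_le_mul_of_nonneg_left (exp_int V) (by positivity)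
  have j3 : (1/L) * (∫ l in (0:ℝ)..V, DD l) ≤ (q + C2) * L := by
    have := hI V hV0.le le_rfl
    have a : q * ((V + V/80)^2/2) + C2 * L ≤ (q + C2) * L * L := by
      have : (V + V/80)^2/2 ≤ L^2 := by rw [hV]; nlinarith
      have := mul_le_mul_of_nonneg_left this hq0
      have : C2 * L ≤ C2 * L * L := le_mul_of_one_le_right (by positivity) hL1
      nlinarith
    rw [one_div, inv_mul_le_iff₀ (by positivity)]
    linarith
  have tot : (L+C)^2 * (∫ l in (0:ℝ)..V, (gg l)^2) + (L+C)*K * (∫ l in (0:ℝ)..V, rexp (-l)) + (V - 0) * 5 + (1/L) * (∫ l in (0:ℝ)..V, DD l) + (∫ l in (0:ℝ)..V, kap (l/V) * DD l)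
     ≤ q * L^2 * (1.21051/2) + (q * (C + C^2) + K * (1 + C) + 4 + (q + C2) + C1) * L := by
    have e1 : (L+C)^2 * (q/2) ≤ q * L^2/2 + q * (C+C^2) * L := by
      have : C^2 ≤ C^2 * L := le_mul_of_one_le_right (by positivity) hL1
      have := mul_le_mul_of_nonneg_left this hq0
      have : 0 ≤ q * C^2 := by positivity
      nlinarith
    have e2 : (L+C)*K*1 ≤ K * (1+C) * L := by
      have : C ≤ C * L := le_mul_of_one_le_right hC hL1
      nlinarith
    have e3 : (V-0)*5 = 4 * L := by rw [hV]; ring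
    rw [e3]
    linarith
  have := mul_le_mul_of_nonneg_left tot (by linarith : (0:ℝ) ≤ 2 * T)
  refine this.trans (le_of_eq ?_)
  ring

lemma simple_of_mu {ρ : ℂ} (h : IsNontrivialZero ρ) (h1 : mu ρ = 1) : zetaMult ρ = 1 := by
  have hne : ρ ≠ 1 := by rintro rfl; simpa using h.2.2
  have key : deriv riemannZeta ρ ≠ 0 := by
    intro hd
    have hz := (differentiableAt_riemannZeta hne).hasDerivAt
    rw [hd] at hz
    have hG : DifferentiableAt ℂ cGR ρ := by
      unfold Complex.Gammaℝ
      refine DifferentiableAt.mul ?_ ?_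
      · refine DifferentiableAt.const_cpow (by fun_prop) (Or.inl ?_)
        exact_mod_cast Real.pi_ne_zero
      · have : DifferentiableAt ℂ Complex.Gamma (ρ/2) := by
          refine Complex.differentiableAt_Gamma _ fun m hm => ?_
          have h2 := congrArg Complex.re hm
          have h3 : (ρ/2).re = ρ.re/2 := by simp
          rw [h3] at h2
          simp at h2
          have : (0:ℝ) ≤ m := Nat.cast_nonneg m
          linarith [h.2.1]
        exact this.comp ρ (by fun_prop)
    have hf : DifferentiableAt ℂ (fun s : ℂ => s * (s-1)) ρ := by fun_prop
    have hD := hf.hasDerivAt.mul (hG.hasDerivAt.mul hz)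
    have hev : xi =ᶠ[𝓝 ρ] ((fun s : ℂ => s * (s-1)) * (cGR * riemannZeta)) := by
      have o1 : ∀ᶠ s : ℂ in 𝓝 ρ, 0 < s.re := (isOpen_lt continuous_const Complex.continuous_re).mem_nhds h.2.1
      have o2 : ∀ᶠ s : ℂ in 𝓝 ρ, s ≠ 1 := isOpen_ne.mem_nhds hne
      filter_upwards [o1, o2] with s a b
      simpa using xi_eq' a b
    have hx := (hD.congr_of_eventuallyEq hev).deriv
    simp only [h.1, mul_zero, add_zero, Pi.mul_apply] at hx
    have ho : ((2:ℕ) : ℕ∞) ≤ analyticOrderAt xi ρ := by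
      rw [natCast_le_analyticOrderAt_iff_iteratedDeriv_eq_zero (xi_diff.analyticAt ρ)]
      intro i hi
      interval_cases i
      · simpa using xi_zero_iff.mpr h
      · rw [iteratedDeriv_one]; exact hx
    have ht := ord_ne_top xi_diff xi_ne ρ
    have : (analyticOrderNatAt xi ρ : ℕ∞) = analyticOrderAt xi ρ := Nat.cast_analyticOrderNatAt ht
    rw [← this] at ho
    have h5 : 2 ≤ analyticOrderNatAt xi ρ := by exact_mod_cast ho
    change 2 ≤ mu ρ at h5
    omega
  unfold zetaMult
  have hmem : (1:ℕ) ∈ {n : ℕ | iteratedDeriv n riemannZeta ρ ≠ 0} := by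
    change iteratedDeriv 1 riemannZeta ρ ≠ 0
    rwa [iteratedDeriv_one]
  refine le_antisymm (Nat.sInf_le hmem) ?_
  have hm := Nat.sInf_mem ⟨1, hmem⟩
  by_contra hc
  have h0 : sInf {n : ℕ | iteratedDeriv n riemannZeta ρ ≠ 0} = 0 := by omega
  rw [h0] at hm
  change iteratedDeriv 0 riemannZeta ρ ≠ 0 at hm
  rw [iteratedDeriv_zero] at hm
  exact hm h.1

lemma N1_le (T : ℝ) : (((bd T).filter fun ρ => ρ.re = 1/2 ∧ mu ρ = 1).card : ℝ) ≤ NlineSimple T := by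
  unfold NlineSimple
  have hfin : ({ρ ∈ zeroBand T | ρ.re = 1/2 ∧ zetaMult ρ = 1} : Set ℂ).Finite := (band_finite T).subset fun ρ h => h.1
  rw [finsum_mem_eq_finite_toFinset_sum _ hfin, Finset.sum_const, nsmul_eq_mul, mul_one]
  have : ((bd T).filter fun ρ => ρ.re = 1/2 ∧ mu ρ = 1) ⊆ hfin.toFinset := by
    intro ρ hρ
    rw [Finset.mem_filter] at hρ
    rw [hfin.mem_toFinset]
    have hb := mem_bd.mp hρ.1
    exact ⟨hb, hρ.2.1, simple_of_mu hb.1 hρ.2.2⟩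
  exact_mod_cast Finset.card_le_card this

lemma PP_lower (T : ℝ) : 2 * NN T - NlineSimple T ≤ PP T := by
  have h1 := N1_le T
  have h2 : 2 * NN T - (((bd T).filter fun ρ => ρ.re = 1/2 ∧ mu ρ = 1).card : ℝ) ≤ PP T := by
    have e : (((bd T).filter fun ρ => ρ.re = 1/2 ∧ mu ρ = 1).card : ℝ) = ∑ ρ ∈ bd T, if ρ.re = 1/2 ∧ mu ρ = 1 then (1:ℝ) else 0 := by
      rw [Finset.sum_boole]
    rw [e, NN, Finset.mul_sum, ← Finset.sum_sub_distrib, PP]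
    refine Finset.sum_le_sum fun ρ hρ => ?_
    have hb := mem_bd.mp hρ
    have hmu : (1:ℝ) ≤ mu ρ := by exact_mod_cast mu_pos_iff.mpr hb.1
    have h0 : ∀ ρ' ∈ bd T, 0 ≤ ((mu ρ : ℝ) * mu ρ') * (if ρ.im = ρ'.im then 1 else 0) := fun ρ' _ => by
      split_ifs <;> positivity
    have hs := Finset.single_le_sum h0 hρ
    simp only [if_true, mul_one] at hs
    split_ifs with hc
    · have : (mu ρ : ℝ) = 1 := by exact_mod_cast hc.2
      rw [this] at hs ⊢
      linarith
    · by_cases hre : ρ.re = 1/2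
      · have h2 : 2 ≤ mu ρ := by
          have a : mu ρ ≠ 1 := fun h => hc ⟨hre, h⟩
          have b := mu_pos_iff.mpr hb.1
          omega
        have h2 : (2:ℝ) ≤ mu ρ := by exact_mod_cast h2
        nlinarith
      · set σ := 1 - cJ ρ with hσ
        have him : σ.im = ρ.im := by simp [hσ]
        have hz := zero_symm hb.1
        have hσb : σ ∈ bd T := mem_bd.mpr ⟨hz, by rw [him]; exact hb.2.1, by rw [him]; exact hb.2.2⟩
        have hne : ρ ≠ σ := by
          intro heq
          have := congrArg Complex.re heq
          simp [hσ] at this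
          exact hre (by linarith)
        have hp : ∑ ρ' ∈ ({ρ, σ} : Finset ℂ), ((mu ρ : ℝ) * mu ρ') * (if ρ.im = ρ'.im then 1 else 0) ≤ ∑ ρ' ∈ bd T, ((mu ρ : ℝ) * mu ρ') * (if ρ.im = ρ'.im then 1 else 0) := by
          refine Finset.sum_le_sum_of_subset_of_nonneg ?_ fun ρ' h _ => h0 ρ' h
          intro x hx
          rw [Finset.mem_insert, Finset.mem_singleton] at hx
          rcases hx with rfl | rfl <;> assumption
        rw [Finset.sum_pair hne, him] at hp
        simp only [if_true, mul_one] at hp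
        have hmu2 : (1:ℝ) ≤ mu σ := by exact_mod_cast mu_pos_iff.mpr hz
        nlinarith
  linarith

lemma tau_ev : ∀ᶠ T : ℝ in atTop, 4 * rexp (-(rlog T)^2/4) * (NN T)^2 ≤ 1 := by
  obtain ⟨K, hK, h⟩ := NN_crude
  filter_upwards [tiny (4 * K^2), eventually_ge_atTop 3] with T h1 h2
  have hL : 0 < rlog T := Real.log_pos (by linarith)
  have hT1 : 1 / T ≤ 1 := by rw [div_le_one (by linarith)]; linarith
  refine le_trans ?_ (h1.trans hT1)
  have h6 : NN T ≤ K * rexp (3 * rlog T) := by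
    rw [show 3 * rlog T = (3:ℕ) * rlog T by norm_num, Real.exp_nat_mul, Real.exp_log (by linarith)]
    exact h T (by linarith)
  have := NN_nonneg T
  calc _ ≤ 4 * rexp (-(rlog T)^2/4) * (K * rexp (3 * rlog T))^2 := by gcongr
    _ = 4 * K^2 * (rexp (-(rlog T)^2/4) * (rexp (3 * rlog T) * rexp (3 * rlog T))) := by ring
    _ ≤ _ := by
        refine mul_le_mul_of_nonneg_left ?_ (by positivity)
        rw [← Real.exp_add, ← Real.exp_add]
        apply Real.exp_le_exp.mpr
        linarith

lemma final_bound (hb : ∀ᶠ T in atTop, Box T) : ∀ᶠ T : ℝ in atTop, 0.34500129 * (T / (2 * rpi)) * rlog T ≤ NlineSimple T := by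
  obtain ⟨C0, hN⟩ := N_lower hb
  obtain ⟨C1, hC1, hQ⟩ := QQ_upper hb
  filter_upwards [hb, hN, hQ, tau_ev, eventually_ge_atTop 3, Real.tendsto_log_atTop.eventually_ge_atTop (2 * rpi * (2 * C0 + 2 * (C1 + 2)) / 0.08)] with T hB h1 h2 h3 hT hbig
  have h4 := QQ_lower T hT hB
  have h5 := PP_lower T
  have hL1 : 1 ≤ rlog T := by
    rw [Real.le_log_iff_exp_le (by linarith)]; linarith [Real.exp_one_lt_d9]
  set τ := 4 * rexp (-(rlog T)^2/4) * (NN T)^2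
  have h6 := h4.trans h2
  set L := rlog T
  set s := rsq rpi with hs
  have hs2 : s * s = rpi := Real.mul_self_sqrt Real.pi_pos.le
  have hs1 : 1 ≤ s := by rw [hs, Real.one_le_sqrt]; linarith [Real.pi_gt_three]
  have hq : 1/(2*s) = s / (2 * rpi) := by
    rw [← hs2]; field_simp
  set X := T * L / (2 * rpi) with hX
  have e1 : T * (1/(2*s)) * L^2 * 1.21051 = s * L * (1.21051 * X) := by
    rw [hq, hX]; ring
  rw [e1] at h6
  have e2 : C1 * T * L ≤ s * L * (C1 * T) := by
    have : 0 ≤ C1 * T * L := by positivity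
    nlinarith
  have h7 : s * L * (8/5 * (29/60 * PP T - τ)) ≤ s * L * (1.21051 * X + C1 * T) := by
    have : s * L * (8/5 * (29/60 * PP T - τ)) = s * (2 * (4/5 * L)) * (29/60 * PP T - τ) := by ring
    rw [this]; linarith
  have h8 := le_of_mul_le_mul_left h7 (by positivity)
  have e3 : (2 * C0 + 2 * (C1 + 2)) * T ≤ 0.08 * X := by
    rw [div_le_iff₀ (by norm_num)] at hbig
    rw [hX, ← mul_div_assoc, le_div_iff₀ (by positivity)]
    nlinarith
  have e4 : 0.34500129 * (T / (2 * rpi)) * L = 0.34500129 * X := by rw [hX]; ring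
  rw [e4]
  have hX0 : 0 ≤ X := by positivity
  have hCT : 0 ≤ C1 * T := by positivity
  linarith

/-- If all nontrivial zeros with `T < γ ≤ 2T` lie in the box of width `0.001 / log T`
centered at the critical line, then the number of simple critical-line zeros with
`T < γ ≤ 2T` is at least `(0.34500129 + o(1)) (T/2π) log T`. -/
theorem simple_critical_bound_b_point001
    (hbox : ∀ᶠ T in atTop, ∀ ρ ∈ zeroBand T, |ρ.re - 1/2| < 0.001 / (2 * Real.log T)) :
    ∃ ε : ℝ → ℝ, Tendsto ε atTop (nhds 0) ∧
      ∀ᶠ T in atTop, (0.34500129 + ε T) * (T / (2 * Real.pi)) * Real.log T ≤ NlineSimple T := by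
  refine ⟨fun _ => 0, tendsto_const_nhds, ?_⟩
  filter_upwards [final_bound (box_ev hbox)] with T h
  simpa using h
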